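/- Let A ⊆ ℝⁿ (n ≥ 2) be a measurable set with positive Lebesgue measure m(A). Then there is a constant C_n (depending only on n) such that the Haar probability measure of the set of unimodular lattices Λ ∈ SL(n,ℝ)/SL(n,ℤ) with Λ ∩ A = ∅ is at most C_n / m(A). -/

import Mathlib

open MeasureTheory Filter Matrix Real ENNReal

noncomputable section

/-- `SL(n, ℝ)`. -/
abbrev SLR (n : ℕ) := Matrix.SpecialLinearGroup (Fin n) ℝ

instance (n : ℕ) : TopologicalSpace (SLR n) :=
  TopologicalSpace.induced (fun g => (g : Matrix (Fin n) (Fin n) ℝ)) inferInstance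

/-- The image of `SL(n, ℤ)` in `SL(n, ℝ)`. -/
def latticeGamma (n : ℕ) : Subgroup (SLR n) :=
  (Matrix.SpecialLinearGroup.map (n := Fin n) (Int.castRingHom ℝ)).range

/-- The space of unimodular lattices `X_n = SL(n,ℝ)/SL(n,ℤ)`. -/
abbrev LatticeSpace (n : ℕ) := SLR n ⧸ latticeGamma n

instance (n : ℕ) : MeasurableSpace (LatticeSpace n) := borel _

/-- The real vector `g · m` of the lattice `g ℤⁿ` coming from the integer vector `m`. -/
def vecOf (n : ℕ) (g : SLR n) (m : Fin n → ℤ) : Fin n → ℝ :=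
  (g : Matrix (Fin n) (Fin n) ℝ).mulVec (fun i => (m i : ℝ))

/-- Euclidean norm on `Fin n → ℝ`. -/
def eNorm {n : ℕ} (v : Fin n → ℝ) : ℝ := ‖(WithLp.equiv 2 (Fin n → ℝ)).symm v‖

/-- The lattice `Λ` contains a nonzero vector lying in `A`. -/
def Intersects (n : ℕ) (Λ : LatticeSpace n) (A : Set (Fin n → ℝ)) : Prop :=
  ∀ g : SLR n, (QuotientGroup.mk g : LatticeSpace n) = Λ →
    ∃ m : Fin n → ℤ, m ≠ 0 ∧ vecOf n g m ∈ A

/-- `α₁(Λ) = sup_{0 ≠ v ∈ Λ} 1/‖v‖` (Euclidean norm). -/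
def alpha1 (n : ℕ) (Λ : LatticeSpace n) : ℝ :=
  sSup {r : ℝ | ∃ g : SLR n, (QuotientGroup.mk g : LatticeSpace n) = Λ ∧
    ∃ m : Fin n → ℤ, m ≠ 0 ∧ r = 1 / eNorm (vecOf n g m)}

instance (n : ℕ) : MeasurableSpace (SLR n) := borel _

instance (n : ℕ) : BorelSpace (SLR n) := ⟨rfl⟩

instance (n : ℕ) : BorelSpace (LatticeSpace n) := ⟨rfl⟩

instance (n : ℕ) : IsTopologicalGroup (SLR n) :=
  Matrix.SpecialLinearGroup.topologicalGroup

lemma isEmbedding_coe_SLR (n : ℕ) :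
    Topology.IsEmbedding (fun g : SLR n => (g : Matrix (Fin n) (Fin n) ℝ)) :=
  ⟨⟨rfl⟩, Subtype.val_injective⟩

instance (n : ℕ) : SecondCountableTopology (SLR n) :=
  haveI : SecondCountableTopology (Matrix (Fin n) (Fin n) ℝ) :=
    inferInstanceAs (SecondCountableTopology (Fin n → Fin n → ℝ))
  (isEmbedding_coe_SLR n).isInducing.secondCountableTopology

lemma continuous_coe_SLR (n : ℕ) :
    Continuous (fun g : SLR n => (g : Matrix (Fin n) (Fin n) ℝ)) :=
  (isEmbedding_coe_SLR n).continuous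

lemma measurable_SLR_entry {n : ℕ} (i j : Fin n) :
    Measurable (fun g : SLR n => (g : Matrix (Fin n) (Fin n) ℝ) i j) :=
  ((continuous_coe_SLR n).matrix_elem i j).measurable

lemma measurable_to_SLR {α : Type*} [MeasurableSpace α] {n : ℕ} {f : α → SLR n}
    (h : ∀ i j, Measurable fun a => (f a : Matrix (Fin n) (Fin n) ℝ) i j) : Measurable f := by
  have hb : (inferInstance : MeasurableSpace (SLR n)) =
      (borel (Fin n → Fin n → ℝ)).comap
        (fun g : SLR n => (g : Matrix (Fin n) (Fin n) ℝ)) := by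
    have := (isEmbedding_coe_SLR n).isInducing.eq_induced
    change @borel _ _ = _
    rw [this]
    exact borel_comap
  change @Measurable _ _ _ (inferInstance : MeasurableSpace (SLR n)) f
  rw [hb]
  refine measurable_comap_iff.mpr ?_
  have : borel (Fin n → Fin n → ℝ) = MeasurableSpace.pi := (BorelSpace.measurable_eq).symm
  rw [this]
  exact measurable_pi_lambda _ fun i => measurable_pi_lambda _ fun j => h i j

/-- The integral matrix `γ` seen in `SL(n, ℝ)`. -/
def intSL {n : ℕ} (γ : Matrix.SpecialLinearGroup (Fin n) ℤ) : SLR n :=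
  Matrix.SpecialLinearGroup.map (n := Fin n) (Int.castRingHom ℝ) γ

lemma intSL_apply {n : ℕ} (γ : Matrix.SpecialLinearGroup (Fin n) ℤ) (i j : Fin n) :
    (intSL γ : Matrix (Fin n) (Fin n) ℝ) i j = ((γ : Matrix (Fin n) (Fin n) ℤ) i j : ℝ) := rfl

lemma intSL_mul {n : ℕ} (γ δ : Matrix.SpecialLinearGroup (Fin n) ℤ) :
    intSL (γ * δ) = intSL γ * intSL δ := map_mul _ _ _

lemma intSL_one {n : ℕ} : intSL (1 : Matrix.SpecialLinearGroup (Fin n) ℤ) = 1 := map_one _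

lemma exists_isOpen_one_intSL (n : ℕ) : ∃ N : Set (SLR n), IsOpen N ∧ (1 : SLR n) ∈ N ∧
    ∀ γ : Matrix.SpecialLinearGroup (Fin n) ℤ, intSL γ ∈ N → γ = 1 := by
  refine ⟨⋂ i, ⋂ j, {g : SLR n | |(g : Matrix (Fin n) (Fin n) ℝ) i j
      - (1 : Matrix (Fin n) (Fin n) ℝ) i j| < 1}, ?_, ?_, ?_⟩
  · refine isOpen_iInter_of_finite fun i => isOpen_iInter_of_finite fun j => ?_
    exact isOpen_lt (((continuous_coe_SLR n).matrix_elem i j).sub continuous_const).abs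
      continuous_const
  · simp
  · intro γ hab
    refine Matrix.SpecialLinearGroup.ext _ _ fun i j => ?_
    have := Set.mem_iInter.mp (Set.mem_iInter.mp hab i) j
    rw [Set.mem_ofPred_eq, intSL_apply] at this
    have e : (1 : Matrix (Fin n) (Fin n) ℝ) i j
        = ((1 : Matrix (Fin n) (Fin n) ℤ) i j : ℝ) := by
      simp only [Matrix.one_apply]; split_ifs <;> simp
    rw [e] at this
    have h2 : |γ i j - (1 : Matrix (Fin n) (Fin n) ℤ) i j| < 1 := by exact_mod_cast this
    have := Int.abs_lt_one_iff.mp h2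
    change γ i j = (1 : Matrix (Fin n) (Fin n) ℤ) i j
    omega

/-- An open neighbourhood of the identity on which two elements never differ by a nontrivial
integral matrix. -/
lemma exists_nhds_one_intSL (n : ℕ) : ∃ U : Set (SLR n), IsOpen U ∧ (1 : SLR n) ∈ U ∧
    ∀ a ∈ U, ∀ b ∈ U, ∀ γ : Matrix.SpecialLinearGroup (Fin n) ℤ, a⁻¹ * b = intSL γ → γ = 1 := by
  obtain ⟨N, hN, h1, hγ⟩ := exists_isOpen_one_intSL n
  obtain ⟨V, hV, hVN⟩ := exists_nhds_split_inv (hN.mem_nhds h1)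
  obtain ⟨W, hWV, hWo, h1W⟩ := mem_nhds_iff.mp hV
  refine ⟨W⁻¹, hWo.inv, by simpa using h1W, fun a ha b hb γ h => hγ γ ?_⟩
  rw [← h]
  have := hVN _ (hWV ha) _ (hWV hb)
  rwa [div_inv_eq_mul] at this

/-- A countable open cover by sets as in `exists_nhds_one_intSL`. -/
lemma exists_cover_intSL (n : ℕ) : ∃ V : ℕ → Set (SLR n), (∀ i, IsOpen (V i)) ∧
    (⋃ i, V i = Set.univ) ∧ ∀ i, ∀ a ∈ V i, ∀ b ∈ V i,
      ∀ γ : Matrix.SpecialLinearGroup (Fin n) ℤ, b = a * intSL γ → γ = 1 := by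
  obtain ⟨U, hUo, h1, hU⟩ := exists_nhds_one_intSL n
  obtain ⟨d, hd⟩ := TopologicalSpace.exists_dense_seq (SLR n)
  refine ⟨fun i => (fun g => (d i)⁻¹ * g) ⁻¹' U, fun i => hUo.preimage (by fun_prop), ?_, ?_⟩
  · refine Set.eq_univ_of_forall fun g => ?_
    have ho : IsOpen ((fun h : SLR n => h⁻¹ * g) ⁻¹' U) := hUo.preimage (by fun_prop)
    obtain ⟨i, hi⟩ := hd.exists_mem_open ho ⟨g, by simpa using h1⟩
    exact Set.mem_iUnion.mpr ⟨i, hi⟩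
  · intro i a ha b hb γ h
    refine hU _ ha _ hb γ ?_
    rw [h]; group

/-- A Borel section of `SL(n, ℝ) → SL(n, ℝ) / SL(n, ℤ)`. -/
lemma exists_measurable_section (n : ℕ) : ∃ s : LatticeSpace n → SLR n, Measurable s ∧
    ∀ x, (QuotientGroup.mk (s x) : LatticeSpace n) = x := by
  classical
  obtain ⟨V, hVo, hVc, hV⟩ := exists_cover_intSL n
  let q : SLR n → LatticeSpace n := QuotientGroup.mk
  have hinj : ∀ i, ∀ a ∈ V i, ∀ b ∈ V i, q a = q b → a = b := by
    intro i a ha b hb h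
    obtain ⟨γ, hγ⟩ := QuotientGroup.eq.mp h
    have hb' : b = a * intSL γ := by
      change intSL γ = _ at hγ
      rw [hγ]; group
    have := hV i a ha b hb γ hb'
    rw [hb', this, intSL_one, mul_one]
  have hex : ∀ x : LatticeSpace n, ∃ i, x ∈ q '' V i := by
    intro x
    obtain ⟨g, rfl⟩ := QuotientGroup.mk_surjective x
    have : g ∈ ⋃ i, V i := hVc ▸ Set.mem_univ g
    obtain ⟨i, hi⟩ := Set.mem_iUnion.mp this
    exact ⟨i, g, hi, rfl⟩
  let s : LatticeSpace n → SLR n := fun x => (Nat.find_spec (hex x)).choose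
  have hs : ∀ x, s x ∈ V (Nat.find (hex x)) ∧ q (s x) = x := fun x =>
    (Nat.find_spec (hex x)).choose_spec
  have hopen : ∀ O : Set (SLR n), IsOpen O → MeasurableSet (q '' O) := fun O hO =>
    (QuotientGroup.isOpenMap_coe O hO).measurableSet
  refine ⟨s, ?_, fun x => (hs x).2⟩
  refine measurable_of_isOpen fun O hO => ?_
  have : s ⁻¹' O = ⋃ i, (q '' (V i ∩ O) \ ⋃ j ∈ Finset.range i, q '' V j) := by
    ext x
    simp only [Set.mem_preimage, Set.mem_iUnion, Set.mem_sdiff, Finset.mem_range, not_exists]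
    constructor
    · intro hx
      refine ⟨Nat.find (hex x), ⟨s x, ⟨(hs x).1, hx⟩, (hs x).2⟩, fun j hj => ?_⟩
      exact Nat.find_min (hex x) hj
    · rintro ⟨i, ⟨g, ⟨hgV, hgO⟩, hgx⟩, hlt⟩
      have hi : Nat.find (hex x) = i := by
        refine le_antisymm (Nat.find_min' _ ⟨g, hgV, hgx⟩) ?_
        by_contra hcon
        push Not at hcon
        exact hlt _ hcon (Nat.find_spec (hex x))
      have h1 := (hs x).1
      rw [hi] at h1
      rw [hinj i _ h1 _ hgV ((hs x).2.trans hgx.symm)]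
      exact hgO
  rw [this]
  refine MeasurableSet.iUnion fun i => (hopen _ ((hVo i).inter hO)).diff ?_
  exact Finset.measurableSet_biUnion _ fun j _ => hopen _ (hVo j)

/-- A probability measure on `SL(n, ℝ)` whose image in the space of lattices is invariant. -/
structure LatticeInvariant {n : ℕ} (m : Measure (SLR n)) : Prop where
  prob : IsProbabilityMeasure m
  inv : ∀ F : SLR n → ℝ≥0∞, Measurable F →
    (∀ g, ∀ γ : Matrix.SpecialLinearGroup (Fin n) ℤ, F (g * intSL γ) = F g) →
    ∀ h, ∫⁻ g, F (h * g) ∂m = ∫⁻ g, F g ∂m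

/-- The elements `g` such that `g ℤⁿ` avoids `A` outside of the origin. -/
def avoidSet (n : ℕ) (A : Set (Fin n → ℝ)) : Set (SLR n) :=
  {g | ∀ m : Fin n → ℤ, m ≠ 0 → vecOf n g m ∉ A}

lemma vecOf_mul_intSL {n : ℕ} (g : SLR n) (γ : Matrix.SpecialLinearGroup (Fin n) ℤ)
    (m : Fin n → ℤ) : vecOf n (g * intSL γ) m
      = vecOf n g ((γ : Matrix (Fin n) (Fin n) ℤ).mulVec m) := by
  unfold vecOf
  rw [Matrix.SpecialLinearGroup.coe_mul, ← Matrix.mulVec_mulVec]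
  congr 1
  ext i
  simp [Matrix.mulVec, dotProduct, intSL_apply]

lemma avoidSet_mul_intSL {n : ℕ} (A : Set (Fin n → ℝ)) (g : SLR n)
    (γ : Matrix.SpecialLinearGroup (Fin n) ℤ) :
    g * intSL γ ∈ avoidSet n A ↔ g ∈ avoidSet n A := by
  have key : ∀ (g : SLR n) (γ : Matrix.SpecialLinearGroup (Fin n) ℤ), g ∈ avoidSet n A →
      g * intSL γ ∈ avoidSet n A := by
    intro g γ hg m hm
    rw [vecOf_mul_intSL]
    refine hg _ fun h0 => hm ?_
    have := congrArg (fun v => ((γ⁻¹ : Matrix.SpecialLinearGroup (Fin n) ℤ) :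
      Matrix (Fin n) (Fin n) ℤ).mulVec v) h0
    simpa [Matrix.mulVec_mulVec, ← Matrix.SpecialLinearGroup.coe_mul,
      -Matrix.SpecialLinearGroup.coe_inv] using this
  refine ⟨fun h => ?_, key g γ⟩
  have := key _ γ⁻¹ h
  rwa [mul_assoc, ← intSL_mul, mul_inv_cancel, intSL_one, mul_one] at this

lemma measurable_vecOf {n : ℕ} (m : Fin n → ℤ) : Measurable fun g : SLR n => vecOf n g m := by
  refine measurable_pi_lambda _ fun i => ?_
  simp only [vecOf, Matrix.mulVec, dotProduct]
  exact Finset.measurable_sum _ fun j _ => (measurable_SLR_entry i j).mul_const _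

lemma measurableSet_avoidSet {n : ℕ} {A : Set (Fin n → ℝ)} (hA : MeasurableSet A) :
    MeasurableSet (avoidSet n A) := by
  have : avoidSet n A = ⋂ m : Fin n → ℤ, ⋂ _ : m ≠ 0, (fun g => vecOf n g m) ⁻¹' Aᶜ := by
    ext g; simp [avoidSet]
  rw [this]
  exact MeasurableSet.iInter fun m => MeasurableSet.iInter fun _ => measurable_vecOf m hA.compl

theorem exists_latticeInvariant (n : ℕ) (μ : Measure (LatticeSpace n)) [IsProbabilityMeasure μ]
    (hinv : ∀ (g : SLR n) (s : Set (LatticeSpace n)), μ ((fun x => g • x) ⁻¹' s) = μ s) :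
    ∃ m : Measure (SLR n), LatticeInvariant m ∧ ∀ A : Set (Fin n → ℝ), MeasurableSet A →
      μ {Λ : LatticeSpace n | ¬ Intersects n Λ A} = m (avoidSet n A) := by
  obtain ⟨s, hs, hsx⟩ := exists_measurable_section n
  refine ⟨μ.map s, ⟨Measure.isProbabilityMeasure_map hs.aemeasurable, ?_⟩, ?_⟩
  · intro F hF hFγ h
    have hact : Measurable fun x : LatticeSpace n => h • x := by
      have : Continuous fun x : LatticeSpace n => h • x := continuous_const_smul h
      exact this.measurable
    have hmap : μ.map (fun x : LatticeSpace n => h • x) = μ := by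
      ext t ht
      rw [Measure.map_apply hact ht, hinv]
    have hFh : Measurable fun g => F (h * g) := hF.comp (measurable_const_mul h)
    rw [lintegral_map hFh hs, lintegral_map hF hs]
    conv_rhs => rw [← hmap]
    have hFs : Measurable fun x => F (s x) := hF.comp hs
    rw [lintegral_map hFs hact]
    refine lintegral_congr fun x => ?_
    have : (QuotientGroup.mk (h * s x) : LatticeSpace n) = QuotientGroup.mk (s (h • x)) := by
      rw [hsx, ← smul_eq_mul, ← MulAction.Quotient.smul_mk, hsx]
    obtain ⟨γ, hγ⟩ := QuotientGroup.eq.mp this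
    change intSL γ = _ at hγ
    have h2 : s (h • x) = (h * s x) * intSL γ := by rw [hγ]; group
    change _ = F (s (h • x))
    rw [h2, hFγ]
  · intro A hA
    rw [Measure.map_apply hs (measurableSet_avoidSet hA)]
    congr 1
    ext x
    simp only [Set.mem_ofPred_eq, Intersects, Set.mem_preimage, not_forall]
    constructor
    · rintro ⟨g, hg, hx⟩
      have hg' : g ∈ avoidSet n A := fun m hm hA => hx ⟨m, hm, hA⟩
      obtain ⟨γ, hγ⟩ := QuotientGroup.eq.mp (hg.trans (hsx x).symm)
      change intSL γ = _ at hγ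
      have h2 : s x = g * intSL γ := by rw [hγ]; group
      rw [h2, avoidSet_mul_intSL]
      exact hg'
    · intro hx
      exact ⟨s x, hsx x, fun ⟨m, hm, hA⟩ => hx m hm hA⟩

/-- `k`-tuples of vectors in `ℝⁿ`. -/
abbrev Tup (n k : ℕ) := Fin k → Fin n → ℝ

/-- The diagonal action of `SL(n, ℝ)` on tuples of vectors. -/
def actT {n k : ℕ} (g : SLR n) (V : Tup n k) : Tup n k :=
  fun i => (g : Matrix (Fin n) (Fin n) ℝ).mulVec (V i)

lemma actT_mul {n k : ℕ} (g h : SLR n) (V : Tup n k) : actT (g * h) V = actT g (actT h V) := by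
  funext i
  simp [actT, Matrix.mulVec_mulVec]

lemma continuous_actT {n k : ℕ} (g : SLR n) : Continuous (actT (k := k) g) := by
  unfold actT
  fun_prop

lemma measurable_actT {n k : ℕ} (g : SLR n) : Measurable (actT (k := k) g) :=
  (continuous_actT g).measurable

lemma measurePreserving_mulVec {n : ℕ} (g : SLR n) :
    MeasurePreserving (fun v : Fin n → ℝ => (g : Matrix (Fin n) (Fin n) ℝ).mulVec v)
      volume volume := by
  refine ⟨by fun_prop, ?_⟩
  have h : (g : Matrix (Fin n) (Fin n) ℝ).det = 1 := g.2
  have := Real.map_matrix_volume_pi_eq_smul_volume_pi (M := (g : Matrix (Fin n) (Fin n) ℝ))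
    (by rw [h]; exact one_ne_zero)
  rw [h] at this
  rw [abs_inv, abs_one, inv_one, ENNReal.ofReal_one, one_smul] at this
  exact this

lemma measurePreserving_actT {n k : ℕ} (g : SLR n) :
    MeasurePreserving (actT (k := k) g) volume volume :=
  volume_preserving_pi fun _ => measurePreserving_mulVec g

/-- The square matrix with columns `V` and `W`, placed according to `e`. -/
def colM {n k l : ℕ} (e : Fin k ⊕ Fin l ≃ Fin n) (V : Tup n k) (W : Tup n l) :
    Matrix (Fin n) (Fin n) ℝ :=
  Matrix.of fun i j => Sum.elim V W (e.symm j) i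

section colM

variable {n k l : ℕ} (e : Fin k ⊕ Fin l ≃ Fin n)

lemma mul_colM (g : SLR n) (V : Tup n k) (W : Tup n l) :
    (g : Matrix (Fin n) (Fin n) ℝ) * colM e V W = colM e (actT g V) (actT g W) := by
  ext i j
  rw [Matrix.mul_apply]
  simp only [colM, Matrix.of_apply]
  rcases e.symm j with a | a <;> simp [actT, Matrix.mulVec, dotProduct]

lemma det_colM_act (g : SLR n) (V : Tup n k) (W : Tup n l) :
    (colM e (actT g V) (actT g W)).det = (colM e V W).det := by
  rw [← mul_colM, Matrix.det_mul, g.2, one_mul]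

lemma colM_smul (c : ℝ) (V : Tup n k) (W : Tup n l) :
    (colM e V (c • W)).det = c ^ l * (colM e V W).det := by
  have : colM e V (c • W) = colM e V W * Matrix.diagonal
      (fun j => Sum.elim (fun _ => 1) (fun _ => c) (e.symm j)) := by
    ext i j
    rw [Matrix.mul_diagonal]
    simp only [colM, Matrix.of_apply]
    rcases e.symm j with a | a <;> simp [mul_comm]
  rw [this, Matrix.det_mul, Matrix.det_diagonal, mul_comm]
  congr 1
  rw [← e.prod_comp]
  simp

lemma colM_update (V : Tup n k) (W : Tup n l) (j : Fin l) (c : ℝ) :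
    (colM e V (Function.update W j (c • W j))).det = c * (colM e V W).det := by
  have h : colM e V (Function.update W j (c • W j))
      = (colM e V W).updateCol (e (Sum.inr j)) (c • W j) := by
    ext i x
    simp only [colM, Matrix.of_apply, Matrix.updateCol_apply]
    obtain ⟨y, rfl⟩ := e.surjective x
    rcases y with a | a
    · simp
    · by_cases ha : a = j
      · subst ha; simp
      · simp [ha]
  have h2 : (colM e V W).updateCol (e (Sum.inr j)) (W j) = colM e V W := by
    ext i x
    simp only [colM, Matrix.of_apply, Matrix.updateCol_apply]
    split_ifs with hx
    · subst hx; simp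
    · rfl
  rw [h, Matrix.det_updateCol_smul, h2]

lemma continuous_colM_det :
    Continuous fun p : Tup n k × Tup n l => (colM e p.1 p.2).det := by
  refine Continuous.matrix_det ?_
  refine continuous_matrix fun i j => ?_
  simp only [colM, Matrix.of_apply]
  rcases e.symm j with a | a <;> simp only [Sum.elim_inl, Sum.elim_inr] <;> fun_prop

/-- The pairs of tuples with determinant in `(0, 1]`. -/
def detDom : Set (Tup n k × Tup n l) :=
  {p | 0 < (colM e p.1 p.2).det ∧ (colM e p.1 p.2).det ≤ 1}

lemma measurableSet_detDom : MeasurableSet (detDom e) :=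
  (measurableSet_lt measurable_const (continuous_colM_det e).measurable).inter
    (measurableSet_le (continuous_colM_det e).measurable measurable_const)

/-- The columns of an element of `SL(n, ℝ)` of the first kind. -/
def colL (g : SLR n) : Tup n k := fun a i => (g : Matrix (Fin n) (Fin n) ℝ) i (e (Sum.inl a))

/-- The columns of an element of `SL(n, ℝ)` of the second kind. -/
def colR (g : SLR n) : Tup n l := fun a i => (g : Matrix (Fin n) (Fin n) ℝ) i (e (Sum.inr a))

lemma measurable_colL : Measurable (colL e) :=
  measurable_pi_lambda _ fun _ => measurable_pi_lambda _ fun _ => measurable_SLR_entry _ _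

lemma measurable_colR : Measurable (colR e) :=
  measurable_pi_lambda _ fun _ => measurable_pi_lambda _ fun _ => measurable_SLR_entry _ _

lemma det_rescale (hl : 0 < l) {V : Tup n k} {W : Tup n l} (h : 0 < (colM e V W).det) :
    (colM e V (((colM e V W).det ^ (-(1 / (l : ℝ)))) • W)).det = 1 := by
  rw [colM_smul, ← Real.rpow_natCast, ← Real.rpow_mul h.le]
  have : -(1 / (l : ℝ)) * (l : ℝ) = -1 := by
    have : (l : ℝ) ≠ 0 := by positivity
    field_simp
  rw [this, Real.rpow_neg_one, inv_mul_cancel₀ h.ne']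

/-- A real matrix of determinant one as an element of `SL(n, ℝ)`. -/
def mkSL (M : Matrix (Fin n) (Fin n) ℝ) (h : M.det = 1) : SLR n := ⟨M, h⟩

lemma coe_mkSL (M : Matrix (Fin n) (Fin n) ℝ) (h : M.det = 1) :
    (mkSL M h : Matrix (Fin n) (Fin n) ℝ) = M := rfl

open Classical in
/-- Rescaling of the second block of columns, so as to obtain determinant one. -/
def toSL (hl : 0 < l) (p : Tup n k × Tup n l) : SLR n :=
  if h : 0 < (colM e p.1 p.2).det then
    mkSL (colM e p.1 (((colM e p.1 p.2).det ^ (-(1 / (l : ℝ)))) • p.2)) (det_rescale e hl h)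
  else 1

lemma coe_toSL (hl : 0 < l) {p : Tup n k × Tup n l} (hp : 0 < (colM e p.1 p.2).det) :
    (toSL e hl p : Matrix (Fin n) (Fin n) ℝ)
      = colM e p.1 (((colM e p.1 p.2).det ^ (-(1 / (l : ℝ)))) • p.2) := by
  rw [toSL, dif_pos hp, coe_mkSL]

lemma toSL_act (hl : 0 < l) (g : SLR n) {p : Tup n k × Tup n l}
    (hp : 0 < (colM e p.1 p.2).det) :
    toSL e hl (actT g p.1, actT g p.2) = g * toSL e hl p := by
  have h' := hp
  rw [← det_colM_act e g] at h'
  apply Subtype.ext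
  rw [Matrix.SpecialLinearGroup.coe_mul]
  change (toSL e hl (actT g p.1, actT g p.2) : Matrix (Fin n) (Fin n) ℝ) = _
  rw [coe_toSL e hl hp, coe_toSL e hl h', mul_colM, det_colM_act]
  congr 1
  funext a
  simp [actT, Matrix.mulVec_smul]

lemma colL_toSL (hl : 0 < l) {p : Tup n k × Tup n l} (hp : 0 < (colM e p.1 p.2).det) :
    colL e (toSL e hl p) = p.1 := by
  funext a i
  simp [colL, coe_toSL e hl hp, colM]

lemma colR_toSL (hl : 0 < l) {p : Tup n k × Tup n l} (hp : 0 < (colM e p.1 p.2).det) :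
    colR e (toSL e hl p) = ((colM e p.1 p.2).det ^ (-(1 / (l : ℝ)))) • p.2 := by
  funext a i
  simp [colR, coe_toSL e hl hp, colM]

lemma measurable_toSL (hl : 0 < l) : Measurable (toSL (n := n) (k := k) e hl) := by
  have hd := (continuous_colM_det (n := n) e).measurable
  refine measurable_to_SLR fun i j => ?_
  have : (fun p : Tup n k × Tup n l => (toSL e hl p : Matrix (Fin n) (Fin n) ℝ) i j)
      = fun p => if 0 < (colM e p.1 p.2).det then
        colM e p.1 (((colM e p.1 p.2).det ^ (-(1 / (l : ℝ)))) • p.2) i j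
        else (1 : Matrix (Fin n) (Fin n) ℝ) i j := by
    funext p
    by_cases hp : 0 < (colM e p.1 p.2).det
    · rw [coe_toSL e hl hp, if_pos hp]
    · rw [toSL, dif_neg hp, if_neg hp]; rfl
  rw [this]
  refine Measurable.ite (measurableSet_lt measurable_const hd) ?_ measurable_const
  simp only [colM, Matrix.of_apply]
  have hd' : Measurable fun p : Tup n k × Tup n l => (colM e p.1 p.2).det ^ (-(1 / (l : ℝ))) :=
    hd.pow_const _
  rcases e.symm j with a | a
  · simp only [Sum.elim_inl]; fun_prop
  · simp only [Sum.elim_inr, Pi.smul_apply, smul_eq_mul]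
    exact hd'.mul (by fun_prop)

/-- The measure on `SL(n, ℝ)` induced by a measure on tuples. -/
def indSL (hl : 0 < l) (ν : Measure (Tup n k)) : Measure (SLR n) :=
  ((ν.prod volume).restrict (detDom e)).map (toSL e hl)

lemma lintegral_indSL (hl : 0 < l) (ν : Measure (Tup n k)) [SFinite ν] {F : SLR n → ℝ≥0∞}
    (hF : Measurable F) : ∫⁻ g, F g ∂(indSL e hl ν)
      = ∫⁻ V, ∫⁻ W : Tup n l, (detDom e).indicator (fun p => F (toSL e hl p)) (V, W) ∂volume ∂ν := by
  rw [indSL, lintegral_map hF (measurable_toSL e hl), ← lintegral_indicator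
    (measurableSet_detDom e), lintegral_prod]
  exact ((hF.comp (measurable_toSL e hl)).indicator (measurableSet_detDom e)).aemeasurable

lemma map_mul_indSL (hl : 0 < l) (ν : Measure (Tup n k)) [SFinite ν]
    (hν : ∀ g, ν.map (actT g) = ν) (g : SLR n) :
    (indSL e hl ν).map (fun h => g * h) = indSL e hl ν := by
  have hg : MeasurePreserving (fun p : Tup n k × Tup n l => (actT g p.1, actT g p.2))
      (ν.prod volume) (ν.prod volume) :=
    MeasurePreserving.prod ⟨measurable_actT g, hν g⟩ (measurePreserving_actT g)
  have hpre : (fun p : Tup n k × Tup n l => (actT g p.1, actT g p.2)) ⁻¹' (detDom e)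
      = detDom e := by
    ext p
    simp [detDom, det_colM_act]
  have hr := hg.restrict_preimage (measurableSet_detDom e)
  rw [hpre] at hr
  rw [indSL, Measure.map_map (measurable_const_mul g) (measurable_toSL e hl)]
  conv_rhs => rw [← hr.map_eq]
  rw [Measure.map_map (measurable_toSL e hl) hg.measurable]
  refine Measure.map_congr ?_
  filter_upwards [ae_restrict_mem (measurableSet_detDom e)] with p hp
  exact (toSL_act e hl g hp.1).symm

lemma norm_le_norm_colR (hl : 0 < l) {p : Tup n k × Tup n l} (hp : p ∈ detDom e) :
    ‖p.2‖ ≤ ‖colR e (toSL e hl p)‖ := by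
  rw [colR_toSL e hl hp.1, norm_smul, Real.norm_of_nonneg (Real.rpow_nonneg hp.1.le _)]
  refine le_mul_of_one_le_left (norm_nonneg _) ?_
  exact Real.one_le_rpow_of_pos_of_le_one_of_nonpos hp.1 hp.2 (by simp)

instance sigmaFinite_indSL (hl : 0 < l) (ν : Measure (Tup n k)) [SigmaFinite ν] :
    SigmaFinite (indSL e hl ν) := by
  refine ⟨⟨⟨fun m => {g | colL e g ∈ spanningSets ν m ∧ ‖colR e g‖ ≤ m}, fun _ => trivial,
    fun m => ?_, ?_⟩⟩⟩
  · have hm : MeasurableSet {g : SLR n | colL e g ∈ spanningSets ν m ∧ ‖colR e g‖ ≤ m} :=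
      (measurable_colL e (measurableSet_spanningSets ν m)).inter
        (measurableSet_le (measurable_colR e).norm measurable_const)
    rw [indSL, Measure.map_apply (measurable_toSL e hl) hm, Measure.restrict_apply
      (measurable_toSL e hl hm)]
    refine lt_of_le_of_lt (measure_mono (t := spanningSets ν m ×ˢ Metric.closedBall 0 m) ?_) ?_
    · rintro p ⟨hp1, hp2⟩
      have := hp1.1
      rw [colL_toSL e hl hp2.1] at this
      exact ⟨this, by simpa using (norm_le_norm_colR e hl hp2).trans hp1.2⟩
    · rw [Measure.prod_prod]
      exact ENNReal.mul_lt_top (measure_spanningSets_lt_top ν m) measure_closedBall_lt_top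
  · refine Set.eq_univ_of_forall fun g => ?_
    obtain ⟨a, ha⟩ := exists_nat_ge ‖colR e g‖
    have : colL e g ∈ ⋃ i, spanningSets ν i := by rw [iUnion_spanningSets]; trivial
    obtain ⟨b, hb⟩ := Set.mem_iUnion.mp this
    refine Set.mem_iUnion.mpr ⟨max a b, ?_, ?_⟩
    · exact monotone_spanningSets ν (le_max_right a b) hb
    · exact ha.trans (by exact_mod_cast le_max_left a b)

/-- Tuples that can be completed to a basis. -/
def goodT : Set (Tup n k) := {V | ∃ W, (colM e V W).det ≠ 0}

lemma isOpen_detSlice (V : Tup n k) :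
    IsOpen {W : Tup n l | 0 < (colM e V W).det ∧ (colM e V W).det < 1} := by
  have h : Continuous fun W : Tup n l => (colM e V W).det :=
    (continuous_colM_det e).comp (by fun_prop : Continuous fun W : Tup n l => (V, W))
  exact (isOpen_lt continuous_const h).inter (isOpen_lt h continuous_const)

lemma exists_mem_detSlice (hl : 0 < l) {V : Tup n k} (hV : V ∈ goodT e) :
    {W : Tup n l | 0 < (colM e V W).det ∧ (colM e V W).det < 1}.Nonempty := by
  obtain ⟨W, hW⟩ := hV
  refine ⟨Function.update W ⟨0, hl⟩ ((1 / 2 / (colM e V W).det) • W ⟨0, hl⟩), ?_⟩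
  have := colM_update e V W ⟨0, hl⟩ (1 / 2 / (colM e V W).det)
  rw [div_mul_cancel₀ _ hW] at this
  rw [Set.mem_ofPred_eq, this]
  norm_num

/-- Integrable weight used to disintegrate measures on `SL(n, ℝ)`. -/
def wt (W : Tup n l) : ℝ≥0∞ :=
  ENNReal.ofReal ((1 + ‖W‖) ^ (-((Module.finrank ℝ (Tup n l) : ℝ) + 1)))

lemma wt_pos (W : Tup n l) : wt W ≠ 0 := by
  simp only [wt, ne_eq, ENNReal.ofReal_eq_zero, not_le]
  positivity

lemma measurable_wt : Measurable (wt (n := n) (l := l)) := by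
  unfold wt
  fun_prop

lemma lintegral_wt : ∫⁻ W : Tup n l, wt W < ∞ := by
  have h := integrable_one_add_norm (E := Tup n l) (μ := volume)
    (r := (Module.finrank ℝ (Tup n l) : ℝ) + 1) (by linarith)
  exact h.lintegral_lt_top

lemma wt_anti {W W' : Tup n l} (h : ‖W‖ ≤ ‖W'‖) : wt W' ≤ wt W := by
  refine ENNReal.ofReal_le_ofReal ?_
  refine Real.rpow_le_rpow_of_nonpos (by positivity) (by linarith) ?_
  have : (0 : ℝ) ≤ Module.finrank ℝ (Tup n l) := by positivity
  linarith

/-- Normalising factor in the disintegration of `indSL`. -/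
def wtInt (hl : 0 < l) (V : Tup n k) : ℝ≥0∞ :=
  ∫⁻ W, (detDom e).indicator (fun p => wt (colR e (toSL e hl p))) (V, W)

lemma measurable_wtArg (hl : 0 < l) : Measurable
    ((detDom (n := n) e).indicator fun p => wt (colR e (toSL e hl p))) :=
  (measurable_wt.comp ((measurable_colR e).comp (measurable_toSL e hl))).indicator
    (measurableSet_detDom e)

lemma measurable_wtInt (hl : 0 < l) : Measurable (wtInt (n := n) e hl) :=
  (measurable_wtArg e hl).lintegral_prod_right'

lemma wtInt_lt_top (hl : 0 < l) (V : Tup n k) : wtInt e hl V ≠ ∞ := by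
  have h : ∀ W : Tup n l,
      (detDom e).indicator (fun p => wt (colR e (toSL e hl p))) (V, W) ≤ wt W := by
    intro W
    by_cases hp : (V, W) ∈ detDom e
    · rw [Set.indicator_of_mem hp]
      have h1 : ‖W‖ ≤ ‖colR e (toSL e hl (V, W))‖ := norm_le_norm_colR e hl (p := (V, W)) hp
      exact wt_anti h1
    · rw [Set.indicator_of_notMem hp]
      exact zero_le
  have h2 : wtInt e hl V ≤ ∫⁻ W : Tup n l, wt W := lintegral_mono h
  exact ne_top_of_le_ne_top lintegral_wt.ne h2

lemma wtInt_ne_zero_iff (hl : 0 < l) (V : Tup n k) : wtInt e hl V ≠ 0 ↔ V ∈ goodT e := by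
  have hm : Measurable fun W : Tup n l =>
      (detDom e).indicator (fun p => wt (colR e (toSL e hl p))) (V, W) :=
    (measurable_wtArg e hl).comp measurable_prodMk_left
  constructor
  · intro h
    by_contra hV
    apply h
    refine (lintegral_eq_zero_iff hm).mpr ?_
    refine Eventually.of_forall fun W => ?_
    refine Set.indicator_of_notMem (fun hW => ?_) _
    exact hV ⟨W, hW.1.ne'⟩
  · intro hV h
    have h := (lintegral_eq_zero_iff hm).mp h
    have hpos := (isOpen_detSlice e V).measure_pos volume (exists_mem_detSlice e hl hV)
    refine hpos.ne' (measure_mono_null ?_ (ae_iff.mp h))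
    rintro W ⟨h0, h1⟩
    have : (V, W) ∈ detDom e := ⟨h0, h1.le⟩
    intro h
    have h2 := (Set.indicator_of_mem this (fun p => wt (colR e (toSL e hl p)))).symm.trans h
    exact wt_pos _ h2

lemma measurableSet_goodT (hl : 0 < l) : MeasurableSet (goodT (n := n) e) := by
  have : goodT (n := n) e = wtInt e hl ⁻¹' {0}ᶜ := by
    ext V
    simp [← wtInt_ne_zero_iff e hl V]
  rw [this]
  exact measurable_wtInt e hl (measurableSet_singleton 0).compl

lemma indSL_recover (hl : 0 < l) (ν : Measure (Tup n k)) [SFinite ν] {B : Set (Tup n k)}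
    (hB : MeasurableSet B) :
    ∫⁻ g, B.indicator 1 (colL e g) * (wt (colR e g) / wtInt e hl (colL e g)) ∂(indSL e hl ν)
      = ν (B ∩ goodT e) := by
  have hm1 : Measurable fun g : SLR n => B.indicator (1 : Tup n k → ℝ≥0∞) (colL e g) :=
    (measurable_one.indicator hB).comp (measurable_colL e)
  have hm2 : Measurable fun g : SLR n => wt (colR e g) / wtInt e hl (colL e g) :=
    (measurable_wt.comp (measurable_colR e)).div
      ((measurable_wtInt e hl).comp (measurable_colL e))
  have hm3 : Measurable fun g : SLR n => B.indicator (1 : Tup n k → ℝ≥0∞) (colL e g) *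
      (wt (colR e g) / wtInt e hl (colL e g)) := hm1.mul hm2
  rw [lintegral_indSL e hl ν hm3]
  have hgoal : ∀ V, ∫⁻ W : Tup n l, (detDom e).indicator (fun p => B.indicator (1 : Tup n k → ℝ≥0∞)
      (colL e (toSL e hl p)) * (wt (colR e (toSL e hl p)) / wtInt e hl (colL e (toSL e hl p))))
      (V, W) = (B ∩ goodT e).indicator 1 V := by
    intro V
    have hm : Measurable fun W : Tup n l =>
        (detDom e).indicator (fun p => wt (colR e (toSL e hl p))) (V, W) :=
      (measurable_wtArg e hl).comp measurable_prodMk_left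
    have : ∀ W, (detDom e).indicator (fun p => B.indicator (1 : Tup n k → ℝ≥0∞)
      (colL e (toSL e hl p)) * (wt (colR e (toSL e hl p)) / wtInt e hl (colL e (toSL e hl p))))
      (V, W) = (B.indicator 1 V * (wtInt e hl V)⁻¹) *
        (detDom e).indicator (fun p => wt (colR e (toSL e hl p))) (V, W) := by
      intro W
      by_cases hW : (V, W) ∈ detDom e
      · rw [Set.indicator_of_mem hW, Set.indicator_of_mem hW, colL_toSL e hl hW.1]
        rw [div_eq_mul_inv]; ring
      · rw [Set.indicator_of_notMem hW, Set.indicator_of_notMem hW, mul_zero]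
    simp_rw [this]
    rw [lintegral_const_mul _ hm]
    change _ * wtInt e hl V = _
    by_cases hV : V ∈ goodT e
    · rw [mul_assoc, ENNReal.inv_mul_cancel ((wtInt_ne_zero_iff e hl V).mpr hV)
        (wtInt_lt_top e hl V), mul_one]
      by_cases hVB : V ∈ B <;> simp [hV, hVB]
    · have h0 : wtInt e hl V = 0 := by
        by_contra h
        exact hV ((wtInt_ne_zero_iff e hl V).mp h)
      simp [h0, hV]
  calc _ = ∫⁻ V, (B ∩ goodT e).indicator 1 V ∂ν := lintegral_congr hgoal
    _ = _ := lintegral_indicator_one (hB.inter (measurableSet_goodT e hl))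

lemma goodT_nonempty : (goodT (n := n) e).Nonempty := by
  refine ⟨fun a i => if i = e (Sum.inl a) then 1 else 0,
    fun a i => if i = e (Sum.inr a) then 1 else 0, ?_⟩
  have : colM e (fun a i => if i = e (Sum.inl a) then 1 else 0)
      (fun a i => if i = e (Sum.inr a) then 1 else 0) = 1 := by
    ext i j
    obtain ⟨y, rfl⟩ := e.surjective j
    rcases y with a | a <;> simp [colM, Matrix.one_apply]
  rw [this]
  simp

lemma indSL_volume_ne_zero (hl : 0 < l) : indSL (n := n) e hl (volume : Measure (Tup n k)) ≠ 0 := by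
  intro h
  have hh : ((volume : Measure (Tup n k)).prod (volume : Measure (Tup n l))) (detDom e) = 0 := by
    have : indSL (n := n) e hl (volume : Measure (Tup n k)) Set.univ = 0 := by rw [h]; simp
    rw [indSL, Measure.map_apply (measurable_toSL e hl) MeasurableSet.univ] at this
    simpa using this
  have ho : IsOpen {p : Tup n k × Tup n l | 0 < (colM e p.1 p.2).det ∧ (colM e p.1 p.2).det < 1} :=
    (isOpen_lt continuous_const (continuous_colM_det e)).inter
      (isOpen_lt (continuous_colM_det e) continuous_const)
  obtain ⟨V, hV⟩ := goodT_nonempty (n := n) e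
  obtain ⟨W, hW⟩ := exists_mem_detSlice e hl hV
  have : Measure.IsOpenPosMeasure ((volume : Measure (Tup n k)).prod (volume : Measure (Tup n l))) :=
    Measure.prod.instIsOpenPosMeasure
  have := @IsOpen.measure_pos _ _ _ ((volume : Measure (Tup n k)).prod (volume : Measure (Tup n l))) this _ ho ⟨(V, W), hW⟩
  refine this.ne' (measure_mono_null ?_ hh)
  rintro p ⟨h0, h1⟩
  exact ⟨h0, h1.le⟩

/-- Uniqueness of left-invariant measures on `SL(n, ℝ)`. -/
theorem eq_smul_indSL (hl : 0 < l) (ρ : Measure (SLR n)) [SigmaFinite ρ]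
    (hρ : ∀ g, ρ.map (fun h => g * h) = ρ) :
    ∃ c : ℝ≥0∞, c ≠ ∞ ∧ ρ = c • indSL e hl (volume : Measure (Tup n k)) := by
  set τ := indSL e hl (volume : Measure (Tup n k)) with hτ
  have : ρ.IsMulLeftInvariant := ⟨hρ⟩
  have : τ.IsMulLeftInvariant :=
    ⟨map_mul_indSL e hl volume fun g => (measurePreserving_actT g).map_eq⟩
  have h0 : τ ≠ 0 := indSL_volume_ne_zero e hl
  obtain ⟨i, hi⟩ : ∃ i, τ (spanningSets (ρ + τ) i) ≠ 0 := by
    by_contra hcon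
    push Not at hcon
    apply h0
    rw [← Measure.measure_univ_eq_zero, ← iUnion_spanningSets (ρ + τ)]
    exact measure_iUnion_null hcon
  have hlt := measure_spanningSets_lt_top (ρ + τ) i
  rw [Measure.add_apply, ENNReal.add_lt_top] at hlt
  refine ⟨_, ?_, measure_eq_div_smul ρ τ hi hlt.2.ne⟩
  exact (ENNReal.div_lt_top hlt.1.ne hi).ne

/-- Uniqueness of invariant measures on tuples that can be completed to a basis. -/
theorem invariant_eq_smul_volume (hl : 0 < l) (ν : Measure (Tup n k)) [SigmaFinite ν]
    (hν : ∀ g, ν.map (actT g) = ν) :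
    ∃ c : ℝ≥0∞, c ≠ ∞ ∧ ∀ B, MeasurableSet B → ν (B ∩ goodT e) = c * volume (B ∩ goodT e) := by
  obtain ⟨c, hc, h⟩ := eq_smul_indSL (k := k) e hl (indSL e hl ν) (map_mul_indSL e hl ν hν)
  refine ⟨c, hc, fun B hB => ?_⟩
  rw [← indSL_recover e hl ν hB, h, lintegral_smul_measure, indSL_recover e hl volume hB,
    smul_eq_mul]

end colM

/-- An integer vector as a real vector. -/
def castV {n : ℕ} (m : Fin n → ℤ) : Fin n → ℝ := fun i => (m i : ℝ)

lemma castV_injective {n : ℕ} : Function.Injective (castV (n := n)) := fun a b h => by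
  funext i
  simpa [castV] using congrFun h i

@[simp] lemma castV_zero {n : ℕ} : castV (0 : Fin n → ℤ) = 0 := by funext i; simp [castV]

@[simp] lemma castV_add {n : ℕ} (a b : Fin n → ℤ) : castV (a + b) = castV a + castV b := by
  funext i; simp [castV]

@[simp] lemma castV_sub {n : ℕ} (a b : Fin n → ℤ) : castV (a - b) = castV a - castV b := by
  funext i; simp [castV]

@[simp] lemma castV_neg {n : ℕ} (a : Fin n → ℤ) : castV (-a) = -castV a := by
  funext i; simp [castV]

@[simp] lemma castV_smul {n : ℕ} (c : ℤ) (a : Fin n → ℤ) : castV (c • a) = (c : ℝ) • castV a := by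
  funext i; simp [castV]

@[simp] lemma castV_sum {n : ℕ} {ι : Type*} (s : Finset ι) (f : ι → Fin n → ℤ) :
    castV (∑ i ∈ s, f i) = ∑ i ∈ s, castV (f i) := by
  funext j; simp [castV]

lemma vecOf_eq {n : ℕ} (g : SLR n) (m : Fin n → ℤ) :
    vecOf n g m = (g : Matrix (Fin n) (Fin n) ℝ).mulVec (castV m) := rfl

lemma castV_mulVec {n : ℕ} (γ : Matrix (Fin n) (Fin n) ℤ) (m : Fin n → ℤ) :
    castV (γ.mulVec m) = (γ.map (fun x : ℤ => (x : ℝ))).mulVec (castV m) := by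
  funext i; simp [castV, Matrix.mulVec, dotProduct]

/-- Primitive systems of integer vectors: bases of saturated sublattices of `ℤⁿ`. -/
def PrimT (n k : ℕ) : Set (Fin k → Fin n → ℤ) :=
  {p | ∀ (a : Fin k → ℝ) (m : Fin n → ℤ), ∑ i, a i • castV (p i) = castV m →
    ∀ i, ∃ b : ℤ, a i = b}

lemma PrimT.linearIndependent {n k : ℕ} {p : Fin k → Fin n → ℤ} (hp : p ∈ PrimT n k) :
    LinearIndependent ℝ fun i => castV (p i) := by
  rw [Fintype.linearIndependent_iff]
  intro a ha i
  by_contra h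
  obtain ⟨b, hb⟩ := hp (fun j => (1 / 2 / a i) * a j) 0 (by
    have := congrArg (fun v => (1 / 2 / a i) • v) ha
    simpa [Finset.smul_sum, smul_smul] using this) i
  rw [div_mul_cancel₀ _ h] at hb
  have h2 : (1 : ℝ) = ((2 * b : ℤ) : ℝ) := by push_cast; linarith
  have h3 : (1 : ℤ) = 2 * b := by exact_mod_cast h2
  omega

lemma primT_mulVec {n k : ℕ} (γ : Matrix.SpecialLinearGroup (Fin n) ℤ)
    {p : Fin k → Fin n → ℤ} (hp : p ∈ PrimT n k) :
    (fun i => (γ : Matrix (Fin n) (Fin n) ℤ).mulVec (p i)) ∈ PrimT n k := by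
  intro a m h
  refine hp a (((γ⁻¹ : Matrix.SpecialLinearGroup (Fin n) ℤ) :
    Matrix (Fin n) (Fin n) ℤ).mulVec m) ?_
  have key : ∀ v : Fin n → ℤ, ((γ⁻¹ : Matrix.SpecialLinearGroup (Fin n) ℤ) :
    Matrix (Fin n) (Fin n) ℤ).mulVec ((γ : Matrix (Fin n) (Fin n) ℤ).mulVec v) = v := by
    intro v
    rw [Matrix.mulVec_mulVec, ← Matrix.SpecialLinearGroup.coe_mul, inv_mul_cancel,
      Matrix.SpecialLinearGroup.coe_one, Matrix.one_mulVec]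
  rw [castV_mulVec, ← h, Matrix.mulVec_sum]
  refine Finset.sum_congr rfl fun i _ => ?_
  rw [Matrix.mulVec_smul, ← castV_mulVec, key]

/-- A primitive system can be enlarged by a vector in the direction of any given integer vector
outside of its span. -/
lemma PrimT.exists_cons {n k : ℕ} {p : Fin k → Fin n → ℤ} (hp : p ∈ PrimT n k)
    {m₀ : Fin n → ℤ} (hm₀ : ∀ a : Fin k → ℝ, castV m₀ ≠ ∑ i, a i • castV (p i)) :
    ∃ (q : Fin n → ℤ) (d : ℕ) (b : Fin k → ℤ), 0 < d ∧ (∀ i, 0 ≤ b i ∧ b i < d) ∧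
      (Fin.cons q p : Fin (k + 1) → Fin n → ℤ) ∈ PrimT n (k + 1) ∧
      (d : ℤ) • q = m₀ + ∑ i, b i • p i := by
  classical
  -- uniqueness of the coefficients
  have huniq : ∀ (β β' : ℝ) (α α' : Fin k → ℝ),
      β • castV m₀ + ∑ i, α i • castV (p i) = β' • castV m₀ + ∑ i, α' i • castV (p i) →
      β = β' := by
    intro β β' α α' h
    by_contra hne
    have hne' : β - β' ≠ 0 := sub_ne_zero.mpr hne
    refine hm₀ (fun i => (β - β')⁻¹ * (α' i - α i)) ?_
    have h1 : (β - β') • castV m₀ = ∑ i, (α' i - α i) • castV (p i) := by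
      simp only [sub_smul, Finset.sum_sub_distrib]
      rw [sub_eq_sub_iff_add_eq_add]
      rw [h]; abel
    have h2 := congrArg (fun v => (β - β')⁻¹ • v) h1
    simpa [smul_smul, hne', Finset.smul_sum] using h2
  let H : AddSubgroup ℝ :=
    { carrier := {β | ∃ (α : Fin k → ℝ) (m : Fin n → ℤ),
        castV m = β • castV m₀ + ∑ i, α i • castV (p i)}
      zero_mem' := ⟨0, 0, by simp⟩
      add_mem' := by
        rintro x y ⟨α, m, h⟩ ⟨α', m', h'⟩
        refine ⟨α + α', m + m', ?_⟩
        simp only [castV_add, h, h', Pi.add_apply, add_smul, Finset.sum_add_distrib]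
        abel
      neg_mem' := by
        rintro x ⟨α, m, h⟩
        refine ⟨-α, -m, ?_⟩
        simp only [castV_neg, h, Pi.neg_apply, neg_smul, Finset.sum_neg_distrib]
        abel }
  have h1H : (1 : ℝ) ∈ H := ⟨0, m₀, by simp⟩
  -- normalised representation
  have hnorm : ∀ β ∈ H, ∃ (α : Fin k → ℝ) (m : Fin n → ℤ), (∀ i, 0 ≤ α i ∧ α i < 1) ∧
      castV m = β • castV m₀ + ∑ i, α i • castV (p i) := by
    rintro β ⟨α, m, h⟩
    refine ⟨fun i => Int.fract (α i), m - ∑ i, ⌊α i⌋ • p i,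
      fun i => ⟨Int.fract_nonneg _, Int.fract_lt_one _⟩, ?_⟩
    simp only [castV_sub, castV_sum, castV_smul, h, Int.fract, sub_smul, Finset.sum_sub_distrib]
    abel
  choose! α m hα hm using hnorm
  have hfin : (H ∩ Set.Ioc 0 1 : Set ℝ).Finite := by
    let C : ℝ := ‖castV m₀‖ + ∑ i, ‖castV (p i)‖
    have hF : (Set.univ.pi fun _ : Fin n => Set.Icc (-⌈C⌉) ⌈C⌉ : Set (Fin n → ℤ)).Finite :=
      Set.Finite.pi fun _ => Set.finite_Icc _ _
    refine Set.Finite.of_finite_image (f := m) (hF.subset ?_) ?_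
    · rintro _ ⟨β, ⟨hβ, h0, h1⟩, rfl⟩ j _
      have hle : ‖castV (m β)‖ ≤ C := by
        rw [hm β hβ]
        refine (norm_add_le _ _).trans (add_le_add ?_ ((norm_sum_le _ _).trans ?_))
        · rw [norm_smul, Real.norm_of_nonneg h0.le]
          exact mul_le_of_le_one_left (norm_nonneg _) h1
        · refine Finset.sum_le_sum fun i _ => ?_
          rw [norm_smul, Real.norm_of_nonneg (hα β hβ i).1]
          exact mul_le_of_le_one_left (norm_nonneg _) (hα β hβ i).2.le
      have h2 : |(m β j : ℝ)| ≤ ⌈C⌉ := ((norm_le_pi_norm (castV (m β)) j).trans hle).trans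
        (Int.le_ceil C)
      have h3 : |m β j| ≤ ⌈C⌉ := by exact_mod_cast h2
      exact abs_le.mp h3
    · rintro β ⟨hβ, _⟩ β' ⟨hβ', _⟩ h
      have := (hm β hβ).symm.trans ((congrArg castV h).trans (hm β' hβ'))
      exact huniq _ _ _ _ this
  obtain ⟨β, ⟨hβH, hβ0, hβ1⟩, hmin⟩ :=
    hfin.exists_minimal ⟨1, h1H, by norm_num, le_rfl⟩
  have hleast : IsLeast {g : ℝ | g ∈ H ∧ 0 < g} β := by
    refine ⟨⟨hβH, hβ0⟩, fun x hx => ?_⟩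
    by_contra hcon
    push Not at hcon
    have := hmin (y := x) ⟨hx.1, hx.2, hcon.le.trans hβ1⟩ hcon.le
    linarith
  have hcyc := AddSubgroup.cyclic_of_min hleast
  have hmul : ∀ x ∈ H, ∃ z : ℤ, x = z * β := by
    intro x hx
    rw [hcyc, AddSubgroup.mem_closure_singleton] at hx
    obtain ⟨z, hz⟩ := hx
    exact ⟨z, by rw [← hz]; simp⟩
  obtain ⟨d, hd⟩ := hmul 1 h1H
  have hdpos : 0 < d := by
    have : (0 : ℝ) < d := by
      by_contra hcon
      push Not at hcon
      nlinarith
    exact_mod_cast this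
  have hq := hm β hβH
  have hdq : castV (d • m β - m₀) = ∑ i, ((d : ℝ) * α β i) • castV (p i) := by
    rw [castV_sub, castV_smul, hq, smul_add, smul_smul, ← hd, one_smul, Finset.smul_sum]
    simp only [smul_smul]
    abel
  have hb := hp _ _ hdq.symm
  choose b hb using hb
  have hd0 : (0 : ℝ) < d := by exact_mod_cast hdpos
  refine ⟨m β, d.toNat, b, by omega, fun i => ?_, ?_, ?_⟩
  · have h1 := hα β hβH i
    rw [Int.toNat_of_nonneg hdpos.le]
    constructor
    · have : (0 : ℝ) ≤ b i := by rw [← hb]; exact mul_nonneg hd0.le h1.1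
      exact_mod_cast this
    · have : (b i : ℝ) < d := by rw [← hb]; nlinarith [h1.2]
      exact_mod_cast this
  · intro a x hx
    rw [Fin.sum_univ_succ] at hx
    simp only [Fin.cons_zero, Fin.cons_succ] at hx
    have hmem : a 0 * β ∈ H := by
      refine ⟨fun i => a 0 * α β i + a i.succ, x, ?_⟩
      rw [← hx, hq, smul_add, smul_smul, Finset.smul_sum]
      simp only [add_smul, Finset.sum_add_distrib, smul_smul]
      abel
    obtain ⟨z, hz⟩ := hmul _ hmem
    have ha0 : a 0 = z := mul_right_cancel₀ hβ0.ne' hz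
    have htail := hp (fun i => a i.succ) (x - z • m β) (by
      rw [castV_sub, castV_smul, ← hx, ha0]; abel)
    intro i
    refine Fin.cases ⟨z, ha0⟩ (fun i => htail i) i
  · rw [Int.toNat_of_nonneg hdpos.le]
    apply castV_injective
    have : castV (d • m β) = castV m₀ + castV (d • m β - m₀) := by simp
    rw [this, hdq, castV_add, castV_sum]
    simp only [castV_smul, hb]

/-- Minkowski's theorem on linear forms. -/
lemma exists_int_vec_abs_lt {n : ℕ} (A : Matrix (Fin n) (Fin n) ℝ) (hA : A.det ≠ 0)
    (c : Fin n → ℝ) (hc : ∀ j, 0 < c j) (h : |A.det| < ∏ j, c j) :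
    ∃ m : Fin n → ℤ, m ≠ 0 ∧ ∀ j, |(A.mulVec (castV m)) j| < c j := by
  let b := Pi.basisFun ℝ (Fin n)
  have fund := ZSpan.isAddFundamentalDomain' b (volume : Measure (Fin n → ℝ))
  let s : Set (Fin n → ℝ) := (Matrix.toLin' A) ⁻¹' (Set.univ.pi fun j => Set.Ioo (-c j) (c j))
  have hs : ∀ x, x ∈ s ↔ ∀ j, |(A.mulVec x) j| < c j := by
    intro x
    simp [s, Set.mem_pi, abs_lt]
  have hdet : LinearMap.det (Matrix.toLin' A) = A.det := LinearMap.det_toLin' A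
  have hvol : volume s = ENNReal.ofReal |A.det|⁻¹ * ENNReal.ofReal (∏ j, (2 * c j)) := by
    rw [Measure.addHaar_preimage_linearMap _ (by rw [hdet]; exact hA), hdet, Real.volume_pi_Ioo,
      abs_inv, ENNReal.ofReal_prod_of_nonneg fun j _ => by linarith [hc j]]
    congr 2
    funext j
    congr 1
    ring
  have h_symm : ∀ y ∈ s, -y ∈ s := by
    intro y hy
    rw [hs] at hy ⊢
    intro j
    rw [Matrix.mulVec_neg, Pi.neg_apply, abs_neg]
    exact hy j
  have h_conv : Convex ℝ s :=
    (convex_pi fun j _ => convex_Ioo _ _).linear_preimage _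
  have h_lt : volume (ZSpan.fundamentalDomain b) * 2 ^ Module.finrank ℝ (Fin n → ℝ)
      < volume s := by
    rw [hvol, ZSpan.fundamentalDomain_pi_basisFun]
    simp only [Real.volume_pi_Ico, sub_zero, ENNReal.ofReal_one, Finset.prod_const_one, one_mul,
      Module.finrank_fin_fun]
    rw [← ENNReal.ofReal_mul (by positivity), Finset.prod_mul_distrib]
    simp only [Finset.prod_const, Finset.card_univ, Fintype.card_fin]
    have hpos : 0 < |A.det| := abs_pos.mpr hA
    have h2 : (2 : ℝ≥0∞) ^ n = ENNReal.ofReal (2 ^ n) := by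
      rw [ENNReal.ofReal_pow (by norm_num)]; norm_num
    rw [h2, ENNReal.ofReal_lt_ofReal_iff (mul_pos (inv_pos.mpr hpos)
      (mul_pos (by positivity) (Finset.prod_pos fun j _ => hc j)))]
    have h3 : 1 < |A.det|⁻¹ * ∏ j, c j := by
      rw [inv_mul_eq_div, one_lt_div hpos]; exact h
    have : (0 : ℝ) < 2 ^ n := by positivity
    nlinarith
  have : Countable (Submodule.span ℤ (Set.range b)).toAddSubgroup :=
    inferInstanceAs (Countable (Submodule.span ℤ (Set.range b)))
  obtain ⟨x, hx0, hx⟩ := exists_ne_zero_mem_lattice_of_measure_mul_two_pow_lt_measure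
    (s := s) fund h_symm h_conv h_lt
  have hrep : ∀ i, ∃ z : ℤ, (z : ℝ) = (x : Fin n → ℝ) i := by
    intro i
    have := (b.mem_span_iff_repr_mem ℤ (x : Fin n → ℝ)).mp x.2 i
    simpa [b] using this
  choose z hz using hrep
  have hzx : castV z = x := funext hz
  refine ⟨z, fun h0 => hx0 ?_, ?_⟩
  · apply Subtype.ext
    rw [← hzx, h0, castV_zero]
    rfl
  · rw [hzx]
    exact (hs _).mp hx

/-- The tuple of lattice vectors of `g ℤⁿ` with integer coordinates `p`. -/
def evalT {n k : ℕ} (g : SLR n) (p : Fin k → Fin n → ℤ) : Tup n k := fun i => vecOf n g (p i)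

lemma evalT_eq {n k : ℕ} (g : SLR n) (p : Fin k → Fin n → ℤ) :
    evalT g p = actT g fun i => castV (p i) := rfl

lemma evalT_mul {n k : ℕ} (h g : SLR n) (p : Fin k → Fin n → ℤ) :
    evalT (h * g) p = actT h (evalT g p) := by
  rw [evalT_eq, evalT_eq, actT_mul]

lemma evalT_mul_intSL {n k : ℕ} (g : SLR n) (γ : Matrix.SpecialLinearGroup (Fin n) ℤ)
    (p : Fin k → Fin n → ℤ) : evalT (g * intSL γ) p
      = evalT g fun i => (γ : Matrix (Fin n) (Fin n) ℤ).mulVec (p i) := by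
  funext i
  exact vecOf_mul_intSL g γ (p i)

lemma measurable_evalT {n k : ℕ} (p : Fin k → Fin n → ℤ) :
    Measurable fun g : SLR n => evalT g p :=
  measurable_pi_lambda _ fun i => measurable_vecOf (p i)

/-- The intensity measure of the tuples of lattice vectors with coordinates in `P`. -/
def nuT {n k : ℕ} (m : Measure (SLR n)) (P : Set (Fin k → Fin n → ℤ)) : Measure (Tup n k) :=
  Measure.sum fun p : P => m.map fun g => evalT g p.1

lemma lintegral_nuT {n k : ℕ} (m : Measure (SLR n)) (P : Set (Fin k → Fin n → ℤ))
    {F : Tup n k → ℝ≥0∞} (hF : Measurable F) :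
    ∫⁻ V, F V ∂(nuT m P) = ∫⁻ g, ∑' p : Fin k → Fin n → ℤ,
      P.indicator (fun p => F (evalT g p)) p ∂m := by
  rw [nuT, lintegral_sum_measure]
  have h : ∀ p : P, ∫⁻ V, F V ∂(m.map fun g => evalT g p.1) = ∫⁻ g, F (evalT g p.1) ∂m :=
    fun p => lintegral_map hF (measurable_evalT p.1)
  simp only [h]
  rw [← lintegral_tsum (f := fun (p : P) g => F (evalT g p.1))
    fun p : P => (hF.comp (measurable_evalT p.1)).aemeasurable]
  refine lintegral_congr fun g => ?_
  exact tsum_subtype P fun p => F (evalT g p)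

lemma measurable_tsum_evalT {n k : ℕ} (P : Set (Fin k → Fin n → ℤ))
    {F : Tup n k → ℝ≥0∞} (hF : Measurable F) :
    Measurable fun g : SLR n => ∑' p : Fin k → Fin n → ℤ,
      P.indicator (fun p => F (evalT g p)) p := by
  classical
  refine Measurable.tsum fun p => ?_
  by_cases h : p ∈ P
  · simp only [Set.indicator_of_mem h]
    exact hF.comp (measurable_evalT p)
  · simp only [Set.indicator_of_notMem h]
    exact measurable_const

/-- Sets of integer tuples which are invariant under `SL(n, ℤ)`. -/
def GammaInv {n k : ℕ} (P : Set (Fin k → Fin n → ℤ)) : Prop :=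
  ∀ γ : Matrix.SpecialLinearGroup (Fin n) ℤ, ∀ p ∈ P,
    (fun i => (γ : Matrix (Fin n) (Fin n) ℤ).mulVec (p i)) ∈ P

/-- The action of `SL(n, ℤ)` on integer tuples, as a permutation. -/
def gammaEquiv {n k : ℕ} (γ : Matrix.SpecialLinearGroup (Fin n) ℤ) :
    (Fin k → Fin n → ℤ) ≃ (Fin k → Fin n → ℤ) where
  toFun p := fun i => (γ : Matrix (Fin n) (Fin n) ℤ).mulVec (p i)
  invFun p := fun i => ((γ⁻¹ : Matrix.SpecialLinearGroup (Fin n) ℤ) :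
    Matrix (Fin n) (Fin n) ℤ).mulVec (p i)
  left_inv p := by
    funext i
    change ((γ⁻¹ : Matrix.SpecialLinearGroup (Fin n) ℤ) : Matrix (Fin n) (Fin n) ℤ).mulVec
      ((γ : Matrix (Fin n) (Fin n) ℤ).mulVec (p i)) = p i
    rw [Matrix.mulVec_mulVec, ← Matrix.SpecialLinearGroup.coe_mul, inv_mul_cancel,
      Matrix.SpecialLinearGroup.coe_one, Matrix.one_mulVec]
  right_inv p := by
    funext i
    change (γ : Matrix (Fin n) (Fin n) ℤ).mulVec (((γ⁻¹ : Matrix.SpecialLinearGroup (Fin n) ℤ) :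
      Matrix (Fin n) (Fin n) ℤ).mulVec (p i)) = p i
    rw [Matrix.mulVec_mulVec, ← Matrix.SpecialLinearGroup.coe_mul, mul_inv_cancel,
      Matrix.SpecialLinearGroup.coe_one, Matrix.one_mulVec]

lemma GammaInv.mem_iff {n k : ℕ} {P : Set (Fin k → Fin n → ℤ)} (hP : GammaInv P)
    (γ : Matrix.SpecialLinearGroup (Fin n) ℤ) (p : Fin k → Fin n → ℤ) :
    gammaEquiv γ p ∈ P ↔ p ∈ P := by
  refine ⟨fun h => ?_, hP γ p⟩
  have := hP γ⁻¹ _ h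
  have h2 : (gammaEquiv γ).symm (gammaEquiv γ p) ∈ P := this
  rwa [Equiv.symm_apply_apply] at h2

lemma tsum_evalT_mul_intSL {n k : ℕ} {P : Set (Fin k → Fin n → ℤ)} (hP : GammaInv P)
    (F : Tup n k → ℝ≥0∞) (g : SLR n) (γ : Matrix.SpecialLinearGroup (Fin n) ℤ) :
    ∑' p : Fin k → Fin n → ℤ, P.indicator (fun p => F (evalT (g * intSL γ) p)) p
      = ∑' p : Fin k → Fin n → ℤ, P.indicator (fun p => F (evalT g p)) p := by
  classical
  rw [← (gammaEquiv γ).tsum_eq (fun p => P.indicator (fun p => F (evalT g p)) p)]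
  refine tsum_congr fun p => ?_
  simp only [Set.indicator_apply, hP.mem_iff γ p, evalT_mul_intSL]
  rfl

lemma map_actT_nuT {n k : ℕ} {m : Measure (SLR n)} (hm : LatticeInvariant m)
    {P : Set (Fin k → Fin n → ℤ)} (hP : GammaInv P) (h : SLR n) :
    (nuT m P).map (actT h) = nuT m P := by
  ext B hB
  rw [← lintegral_indicator_one hB, lintegral_map (measurable_one.indicator hB)
    (measurable_actT h), ← lintegral_indicator_one hB, lintegral_nuT m P
    (F := fun V => B.indicator 1 (actT h V))
    ((measurable_one.indicator hB).comp (measurable_actT h)), lintegral_nuT m P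
    (measurable_one.indicator hB)]
  have := hm.inv (fun g => ∑' p : Fin k → Fin n → ℤ,
    P.indicator (fun p => B.indicator (1 : Tup n k → ℝ≥0∞) (evalT g p)) p)
    (measurable_tsum_evalT P (measurable_one.indicator hB))
    (fun g γ => tsum_evalT_mul_intSL hP _ g γ) h
  simp only [evalT_mul] at this
  exact this

lemma mem_goodT_of_linearIndependent {n k l : ℕ} (e : Fin k ⊕ Fin l ≃ Fin n) {V : Tup n k}
    (hV : LinearIndependent ℝ V) : V ∈ goodT e := by
  classical
  let b := Module.Basis.sumExtend hV
  have : Fintype (Fin k ⊕ Module.Basis.sumExtendIndex hV) :=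
    FiniteDimensional.fintypeBasisIndex b
  have : Fintype (Module.Basis.sumExtendIndex hV) :=
    Fintype.ofInjective (Sum.inr : _ → Fin k ⊕ Module.Basis.sumExtendIndex hV) Sum.inr_injective
  have hc : Fintype.card (Module.Basis.sumExtendIndex hV) = l := by
    have h1 := Module.finrank_eq_card_basis b
    have h2 := Fintype.card_congr e
    simp only [Fintype.card_sum, Fintype.card_fin, Module.finrank_fin_fun] at h1 h2
    have h3 : Fintype.card (Fin k ⊕ Module.Basis.sumExtendIndex hV)
      = k + Fintype.card (Module.Basis.sumExtendIndex hV) := by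
      rw [← Nat.card_eq_fintype_card, Nat.card_sum, Nat.card_eq_fintype_card,
        Nat.card_eq_fintype_card, Fintype.card_fin]
    have h4 : n = Fintype.card (Fin k ⊕ Module.Basis.sumExtendIndex hV) := by
      rw [← Module.finrank_eq_card_basis b, Module.finrank_fin_fun]
    omega
  let f : Fin l ≃ Module.Basis.sumExtendIndex hV := (Fintype.equivFinOfCardEq hc).symm
  refine ⟨fun i => b (Sum.inr (f i)), ?_⟩
  rw [← isUnit_iff_ne_zero, ← Matrix.isUnit_iff_isUnit_det,
    ← Matrix.linearIndependent_cols_iff_isUnit]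
  let e2 : Fin n ≃ Fin k ⊕ Module.Basis.sumExtendIndex hV :=
    e.symm.trans (Equiv.sumCongr (Equiv.refl _) f)
  have h5 : (colM e V fun i => b (Sum.inr (f i))).col = b ∘ e2 := by
    funext j i
    simp only [Matrix.col, Matrix.transpose, colM, Matrix.of_apply, Function.comp, e2,
      Equiv.trans_apply]
    rcases e.symm j with a | a
    · simp [b, Module.Basis.sumExtend]
      rfl
    · simp
  rw [h5]
  exact b.linearIndependent.comp _ e2.injective

lemma linearIndependent_evalT {n k : ℕ} (g : SLR n) {p : Fin k → Fin n → ℤ}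
    (hp : LinearIndependent ℝ fun i => castV (p i)) : LinearIndependent ℝ (evalT g p) := by
  have hu : IsUnit (g : Matrix (Fin n) (Fin n) ℝ) := by
    rw [Matrix.isUnit_iff_isUnit_det, g.2]; exact isUnit_one
  have hinj := Matrix.mulVec_injective_of_isUnit hu
  exact hp.map' (Matrix.mulVecLin (g : Matrix (Fin n) (Fin n) ℝ))
    (LinearMap.ker_eq_bot.mpr hinj)

lemma nuT_compl_goodT {n k l : ℕ} (e : Fin k ⊕ Fin l ≃ Fin n) (hl : 0 < l) (m : Measure (SLR n))
    {P : Set (Fin k → Fin n → ℤ)} (hP : ∀ p ∈ P, LinearIndependent ℝ fun i => castV (p i)) :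
    nuT m P (goodT e)ᶜ = 0 := by
  classical
  rw [← lintegral_indicator_one (measurableSet_goodT e hl).compl, lintegral_nuT m P
    (measurable_one.indicator (measurableSet_goodT e hl).compl)]
  rw [lintegral_eq_zero_iff (measurable_tsum_evalT P
    (measurable_one.indicator (measurableSet_goodT e hl).compl))]
  refine Filter.Eventually.of_forall fun g => ?_
  simp only [Pi.zero_apply, ENNReal.tsum_eq_zero]
  intro p
  by_cases h : p ∈ P
  · have := mem_goodT_of_linearIndependent e (linearIndependent_evalT g (hP p h))
    simp [this, Set.indicator]
  · simp [h]

/-- The intensity measure of an invariant family of linearly independent tuples is a multiple of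
the Lebesgue measure. -/
lemma nuT_eq_volume {n k l : ℕ} (e : Fin k ⊕ Fin l ≃ Fin n) (hl : 0 < l) {m : Measure (SLR n)}
    (hm : LatticeInvariant m) {P : Set (Fin k → Fin n → ℤ)} (hΓ : GammaInv P)
    (hP : ∀ p ∈ P, LinearIndependent ℝ fun i => castV (p i)) [SigmaFinite (nuT m P)] :
    ∃ c : ℝ≥0∞, c ≠ ∞ ∧ ∀ B, MeasurableSet B → nuT m P B = c * volume (B ∩ goodT e) := by
  obtain ⟨c, hc, h⟩ := invariant_eq_smul_volume e hl (nuT m P) (map_actT_nuT hm hΓ)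
  refine ⟨c, hc, fun B hB => ?_⟩
  rw [← h B hB]
  exact (measure_inter_conull (nuT_compl_goodT e hl m hP)).symm

lemma gammaInv_primT (n k : ℕ) : GammaInv (PrimT n k) := fun γ _ hp => primT_mulVec γ hp

lemma measurable_indicator_one {α : Type*} [MeasurableSpace α] {B : Set α}
    (hB : MeasurableSet B) : Measurable (B.indicator (1 : α → ℝ≥0∞)) :=
  measurable_one.indicator hB

lemma nuT_apply {n k : ℕ} (m : Measure (SLR n)) (P : Set (Fin k → Fin n → ℤ))
    {B : Set (Tup n k)} (hB : MeasurableSet B) : nuT m P B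
      = ∫⁻ g, ∑' p : Fin k → Fin n → ℤ,
        P.indicator (fun p => B.indicator (1 : Tup n k → ℝ≥0∞) (evalT g p)) p ∂m := by
  rw [← lintegral_indicator_one hB, lintegral_nuT m P (measurable_indicator_one hB)]

lemma tsum_indicator_le_card {α β : Type*} (S : Set α) (t : Finset β)
    (f : α → β) (hf : ∀ a ∈ S, f a ∈ t) (hinj : ∀ a ∈ S, ∀ b ∈ S, f a = f b → a = b) :
    ∑' a, S.indicator (1 : α → ℝ≥0∞) a ≤ t.card := by
  classical
  rw [ENNReal.tsum_eq_iSup_sum]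
  refine iSup_le fun s => ?_
  have h1 : ∑ a ∈ s, S.indicator (1 : α → ℝ≥0∞) a = ((s.filter (· ∈ S)).card : ℝ≥0∞) := by
    rw [Finset.card_filter]
    push_cast
    refine Finset.sum_congr rfl fun a _ => ?_
    simp [Set.indicator_apply]
  rw [h1]
  norm_cast
  refine Finset.card_le_card_of_injOn f (fun a ha => ?_) fun a ha b hb => ?_
  · simp only [Finset.coe_filter, Set.mem_ofPred_eq] at ha
    exact hf a ha.2
  · simp only [Finset.coe_filter, Set.mem_ofPred_eq] at ha hb
    exact hinj a ha.2 b hb.2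

/-- The matrix whose columns are the given vectors. -/
def colsM {R : Type*} {n : ℕ} (p : Fin n → Fin n → R) : Matrix (Fin n) (Fin n) R :=
  Matrix.of fun i j => p j i

lemma exists_mul_colsM_eq_one {n : ℕ} {p : Fin n → Fin n → ℤ} (hp : p ∈ PrimT n n) :
    ∃ Q : Matrix (Fin n) (Fin n) ℤ, colsM p * Q = 1 := by
  classical
  have hli := PrimT.linearIndependent hp
  let b := basisOfLinearIndependentOfCardEqFinrank' _ hli (by simp)
  have hb : ∀ i, b i = castV (p i) := fun i => by simp [b]
  have hex : ∀ j : Fin n, ∀ i, ∃ z : ℤ, b.repr (castV (Pi.single j 1)) i = z := by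
    intro j
    refine hp _ (Pi.single j 1) ?_
    simp only [← hb]
    exact b.sum_repr _
  choose z hz using hex
  refine ⟨Matrix.of fun i j => z j i, ?_⟩
  ext i j
  have h1 : ∑ k, (z j k : ℝ) • castV (p k) = castV (Pi.single j 1) := by
    simp only [← hb, ← hz]
    exact b.sum_repr _
  have h2 := congrFun h1 i
  simp only [Finset.sum_apply, Pi.smul_apply, castV, smul_eq_mul] at h2
  have h3 : ∑ k, z j k * p k i = (Pi.single j 1 : Fin n → ℤ) i := by exact_mod_cast h2
  rw [Matrix.mul_apply]
  simp only [colsM, Matrix.of_apply]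
  rw [Matrix.one_apply, ← Finset.sum_congr rfl fun k _ => mul_comm (z j k) (p k i), h3,
    Pi.single_apply]

lemma colsM_evalT {n : ℕ} (g : SLR n) (p : Fin n → Fin n → ℤ) :
    colsM (evalT g p) = (g : Matrix (Fin n) (Fin n) ℝ) * (colsM p).map (fun x : ℤ => (x : ℝ)) := by
  ext i j
  simp [colsM, evalT, vecOf, Matrix.mul_apply, Matrix.mulVec, dotProduct]

lemma map_intCast_mul {n : ℕ} (A B : Matrix (Fin n) (Fin n) ℤ) :
    (A * B).map (fun x : ℤ => (x : ℝ))
      = A.map (fun x : ℤ => (x : ℝ)) * B.map (fun x : ℤ => (x : ℝ)) := by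
  ext i j
  simp [Matrix.mul_apply]

lemma abs_det_colsM_evalT {n : ℕ} (g : SLR n) {p : Fin n → Fin n → ℤ} (hp : p ∈ PrimT n n) :
    |(colsM (evalT g p)).det| = 1 := by
  obtain ⟨Q, hQ⟩ := exists_mul_colsM_eq_one hp
  have h1 : (colsM p).det * Q.det = 1 := by rw [← Matrix.det_mul, hQ, Matrix.det_one]
  have h2 : |(colsM p).det| = 1 := Int.isUnit_iff_abs_eq.mp (IsUnit.of_mul_eq_one _ h1)
  have h3 : ((colsM p).map (fun x : ℤ => (x : ℝ))).det = ((colsM p).det : ℝ) :=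
    ((Int.castRingHom ℝ).map_det (colsM p)).symm
  rw [colsM_evalT, Matrix.det_mul, g.2, one_mul, h3, ← Int.cast_abs, h2, Int.cast_one]

lemma exists_card_bound_primT_self (n : ℕ) (ρ : ℝ) : ∃ N : ℕ, ∀ g : SLR n,
    ∑' p : Fin n → Fin n → ℤ, (PrimT n n).indicator
      (fun p => (Metric.closedBall (0 : Tup n n) ρ).indicator (1 : Tup n n → ℝ≥0∞) (evalT g p)) p
        ≤ N := by
  classical
  have hK : IsCompact (Metric.closedBall (0 : Tup n n) ρ) := isCompact_closedBall _ _
  have hcont : Continuous fun V : Tup n n => fun i j => (colsM V).adjugate i j := by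
    have : Continuous fun V : Tup n n => (colsM V).adjugate :=
      Continuous.matrix_adjugate (continuous_matrix fun i j => by
        simp only [colsM, Matrix.of_apply]; fun_prop)
    exact this
  obtain ⟨A, hA⟩ := hK.exists_bound_of_continuousOn hcont.continuousOn
  have hA' : ∀ V ∈ Metric.closedBall (0 : Tup n n) ρ, ∀ i j, |(colsM V).adjugate i j| ≤ A := by
    intro V hV i j
    exact ((norm_le_pi_norm ((fun i j => (colsM V).adjugate i j) i) j).trans
      (norm_le_pi_norm (fun i j => (colsM V).adjugate i j) i)).trans (hA V hV)
  set δ : ℝ := 1 / (2 * (n * (|A| + 1) + 1)) with hδ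
  have hδ0 : 0 < δ := by positivity
  obtain ⟨t, -, htK⟩ := hK.elim_nhds_subcover (fun y => Metric.ball y δ)
    fun y _ => Metric.ball_mem_nhds y hδ0
  refine ⟨t.card, fun g => ?_⟩
  have hcov : ∀ p : Fin n → Fin n → ℤ, ∃ y, evalT g p ∈ Metric.closedBall (0 : Tup n n) ρ →
      y ∈ t ∧ evalT g p ∈ Metric.ball y δ := by
    intro p
    by_cases h : evalT g p ∈ Metric.closedBall (0 : Tup n n) ρ
    · have := htK h
      simp only [Set.mem_iUnion] at this
      obtain ⟨y, hy, hpy⟩ := this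
      exact ⟨y, fun _ => ⟨hy, hpy⟩⟩
    · exact ⟨0, fun h' => absurd h' h⟩
  choose f hf using hcov
  have hset : ∀ p : Fin n → Fin n → ℤ, (PrimT n n).indicator
      (fun p => (Metric.closedBall (0 : Tup n n) ρ).indicator (1 : Tup n n → ℝ≥0∞) (evalT g p)) p
      = {p | p ∈ PrimT n n ∧ evalT g p ∈ Metric.closedBall (0 : Tup n n) ρ}.indicator 1 p := by
    intro p
    simp only [Set.indicator_apply, Set.mem_ofPred_eq, Pi.one_apply]
    split_ifs <;> simp_all
  simp only [hset]
  refine tsum_indicator_le_card _ t f (fun p hp => (hf p hp.2).1) ?_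
  rintro p ⟨hp, hpK⟩ q ⟨-, hqK⟩ hpq
  have hdist : dist (evalT g p) (evalT g q) < 2 * δ := by
    have h1 := (hf p hpK).2
    have h2 := (hf q hqK).2
    rw [hpq] at h1
    have := dist_triangle_right (evalT g p) (evalT g q) (f q)
    rw [Metric.mem_ball] at h1 h2
    linarith
  obtain ⟨Q, hQ⟩ := exists_mul_colsM_eq_one hp
  set M := colsM (evalT g p) with hM
  set M' := colsM (evalT g q) with hM'
  set γ := Q * colsM q with hγ
  have hpγ : colsM p * γ = colsM q := by rw [hγ, ← Matrix.mul_assoc, hQ, Matrix.one_mul]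
  have hMγ : M * γ.map (fun x : ℤ => (x : ℝ)) = M' := by
    rw [hM, hM', colsM_evalT, colsM_evalT, Matrix.mul_assoc, ← map_intCast_mul, hpγ]
  have hdet : |M.det| = 1 := abs_det_colsM_evalT g hp
  have hadj : M.det • (γ.map (fun x : ℤ => (x : ℝ)) - 1) = M.adjugate * (M' - M) := by
    rw [← hMγ]
    have : M * γ.map (fun x : ℤ => (x : ℝ)) - M = M * (γ.map (fun x : ℤ => (x : ℝ)) - 1) := by
      rw [Matrix.mul_sub, Matrix.mul_one]
    rw [this, ← Matrix.mul_assoc, Matrix.adjugate_mul, Matrix.smul_mul, Matrix.one_mul]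
  have hγ1 : γ = 1 := by
    ext i j
    have h1 := congrFun (congrFun hadj i) j
    rw [Matrix.smul_apply, Matrix.sub_apply, Matrix.map_apply, Matrix.mul_apply, smul_eq_mul] at h1
    have h2 : |∑ k, M.adjugate i k * (M' - M) k j| ≤ ∑ k : Fin n, (|A| + 1) * (2 * δ) := by
      refine (Finset.abs_sum_le_sum_abs _ _).trans (Finset.sum_le_sum fun k _ => ?_)
      rw [abs_mul]
      refine mul_le_mul ?_ ?_ (abs_nonneg _) (by positivity)
      · exact (hA' _ hpK i k).trans ((le_abs_self A).trans (by linarith))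
      · have h3 : (M' - M) k j = evalT g q j k - evalT g p j k := rfl
        rw [h3, abs_sub_comm, ← Real.dist_eq]
        exact ((dist_le_pi_dist (evalT g p j) (evalT g q j) k).trans
          (dist_le_pi_dist (evalT g p) (evalT g q) j)).trans hdist.le
    rw [← h1, abs_mul, hdet, one_mul, Finset.sum_const, Finset.card_univ, Fintype.card_fin,
      nsmul_eq_mul] at h2
    have h4 : (n : ℝ) * ((|A| + 1) * (2 * δ)) < 1 := by
      have : (n : ℝ) * ((|A| + 1) * (2 * δ)) = (n * (|A| + 1)) / (n * (|A| + 1) + 1) := by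
        rw [hδ]; field_simp
      rw [this, div_lt_one (by positivity)]
      linarith
    have h5 : (((γ - 1) i j : ℤ) : ℝ) = (γ i j : ℝ) - (1 : Matrix (Fin n) (Fin n) ℝ) i j := by
      rw [Matrix.sub_apply, Matrix.one_apply, Matrix.one_apply]
      push_cast
      rfl
    have h6 : |(((γ - 1) i j : ℤ) : ℝ)| < 1 := by rw [h5]; exact h2.trans_lt h4
    have h7 : |(γ - 1) i j| < 1 := by exact_mod_cast h6
    have h8 := Int.abs_lt_one_iff.mp h7
    rw [Matrix.sub_apply, sub_eq_zero] at h8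
    exact h8
  rw [hγ1, Matrix.mul_one] at hpγ
  funext j i
  exact congrFun (congrFun hpγ i) j

lemma nuT_primT_self_lt_top {n : ℕ} {m : Measure (SLR n)} (hm : LatticeInvariant m) (ρ : ℝ) :
    nuT m (PrimT n n) (Metric.closedBall 0 ρ) < ∞ := by
  have := hm.prob
  obtain ⟨N, hN⟩ := exists_card_bound_primT_self n ρ
  rw [nuT_apply m _ measurableSet_closedBall]
  refine (lintegral_mono hN).trans_lt ?_
  simp

section step

variable {n k l : ℕ} (e : Fin k ⊕ Fin l ≃ Fin n)

lemma colM_mulVec (V : Tup n k) (W : Tup n l) (y : Fin n → ℝ) :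
    (colM e V W).mulVec y = ∑ a, y (e (Sum.inl a)) • V a + ∑ b, y (e (Sum.inr b)) • W b := by
  funext i
  simp only [Matrix.mulVec, dotProduct, Pi.add_apply, Finset.sum_apply, Pi.smul_apply, smul_eq_mul]
  rw [← e.sum_comp, Fintype.sum_sum_type]
  congr 1 <;> refine Finset.sum_congr rfl fun a _ => ?_ <;> simp [colM, mul_comm]

/-- The bounded tuples which are completed to a basis by `W` in a controlled way. -/
def ctrlSet (W : Tup n l) (r b : ℝ) : Set (Tup n k) :=
  {V | r ≤ |(colM e V W).det| ∧ ‖V‖ ≤ b}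

lemma measurableSet_ctrlSet (W : Tup n l) (r b : ℝ) :
    MeasurableSet (ctrlSet (k := k) e W r b) := by
  have h : Continuous fun V : Tup n k => (colM e V W).det :=
    (continuous_colM_det e).comp (by fun_prop : Continuous fun V : Tup n k => (V, W))
  exact (measurableSet_le measurable_const h.abs.measurable).inter
    (measurableSet_le measurable_norm measurable_const)

lemma exists_primT_cons (hl : 0 < l) (W : Tup n l) {r b : ℝ} (hr : 0 < r) : ∃ ρ : ℝ,
    ∀ (g : SLR n), ∀ p ∈ PrimT n k, evalT g p ∈ ctrlSet e W r b →
      ∃ q : Fin n → ℤ, (Fin.cons q p : Fin (k + 1) → Fin n → ℤ) ∈ PrimT n (k + 1) ∧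
        evalT g (Fin.cons q p : Fin (k + 1) → Fin n → ℤ) ∈ Metric.closedBall 0 ρ := by
  set ρ₀ : ℝ := 1 / r + 1 with hρ₀
  have hr' : 0 < 1 / r := by positivity
  have hρ₀1 : 1 ≤ ρ₀ := by linarith
  refine ⟨2 * (k * |b|) + l * (ρ₀ * ‖W‖) + |b|, fun g p hp hK => ?_⟩
  obtain ⟨hdet, hb⟩ := hK
  set M := colM e (evalT g p) W with hM
  have hM0 : M.det ≠ 0 := by
    intro h0
    rw [h0, abs_zero] at hdet
    linarith
  have hMu : IsUnit M.det := isUnit_iff_ne_zero.mpr hM0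
  set A := M⁻¹ * (g : Matrix (Fin n) (Fin n) ℝ) with hA
  have hAdet : A.det = M.det⁻¹ := by
    rw [hA, Matrix.det_mul, g.2, mul_one, Matrix.det_nonsing_inv, Ring.inverse_eq_inv']
  let c : Fin n → ℝ := fun j => Sum.elim (fun _ : Fin k => (1 : ℝ)) (fun _ : Fin l => ρ₀) (e.symm j)
  have hc : ∀ j, 0 < c j := by
    intro j
    simp only [c]
    rcases e.symm j with a | a
    · exact one_pos
    · exact one_pos.trans_le hρ₀1
  have hcprod : ∏ j, c j = ρ₀ ^ l := by
    rw [← e.prod_comp, Fintype.prod_sum_type]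
    simp [c]
  obtain ⟨m₀, hm0, hy⟩ := exists_int_vec_abs_lt A (by rw [hAdet]; exact inv_ne_zero hM0) c hc (by
    rw [hAdet, hcprod, abs_inv]
    have h1 : |M.det|⁻¹ ≤ 1 / r := by
      rw [one_div]; exact inv_anti₀ hr hdet
    have h2 : ρ₀ ≤ ρ₀ ^ l := le_self_pow₀ hρ₀1 hl.ne'
    linarith)
  set y := A.mulVec (castV m₀) with hyA
  have hgm : vecOf n g m₀ = M.mulVec y := by
    rw [hyA, hA, Matrix.mulVec_mulVec, ← Matrix.mul_assoc, Matrix.mul_nonsing_inv _ hMu,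
      Matrix.one_mul, vecOf_eq]
  have hyl : ∀ a, |y (e (Sum.inl a))| < 1 := fun a => by simpa [c] using hy (e (Sum.inl a))
  have hyr : ∀ a, |y (e (Sum.inr a))| < ρ₀ := fun a => by simpa [c] using hy (e (Sum.inr a))
  have hnot : ∀ a : Fin k → ℝ, castV m₀ ≠ ∑ i, a i • castV (p i) := by
    intro a ha
    have h1 : M.mulVec y = M.mulVec fun j => Sum.elim a (fun _ : Fin l => (0 : ℝ)) (e.symm j) := by
      rw [← hgm, hM, colM_mulVec, vecOf_eq, ha, Matrix.mulVec_sum]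
      simp only [Matrix.mulVec_smul, Equiv.symm_apply_apply, Sum.elim_inl, Sum.elim_inr, zero_smul,
        Finset.sum_const_zero, add_zero]
      rfl
    have h2 := Matrix.mulVec_injective_of_isUnit ((Matrix.isUnit_iff_isUnit_det M).mpr hMu) h1
    apply hm0
    apply castV_injective
    rw [ha, castV_zero]
    refine Finset.sum_eq_zero fun i _ => ?_
    have h3 := congrFun h2 (e (Sum.inl i))
    simp only [Equiv.symm_apply_apply, Sum.elim_inl] at h3
    obtain ⟨z, hz⟩ := hp a m₀ ha.symm i
    have h4 := hyl i
    rw [h3, hz] at h4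
    have h5 : |z| < 1 := by exact_mod_cast h4
    rw [hz, Int.abs_lt_one_iff.mp h5]
    simp
  obtain ⟨q, d, β, hd, hβ, hq, hdq⟩ := PrimT.exists_cons hp hnot
  refine ⟨q, hq, ?_⟩
  have hd' : (0 : ℝ) < d := by exact_mod_cast hd
  have hpi : ∀ i, ‖vecOf n g (p i)‖ ≤ |b| := fun i =>
    ((norm_le_pi_norm (evalT g p) i).trans hb).trans (le_abs_self b)
  have hgq : (d : ℝ) • vecOf n g q = vecOf n g m₀ + ∑ i, (β i : ℝ) • vecOf n g (p i) := by
    have h1 := congrArg castV hdq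
    simp only [castV_smul, castV_add, castV_sum] at h1
    have h2 := congrArg (fun v => (g : Matrix (Fin n) (Fin n) ℝ).mulVec v) h1
    simp only [Matrix.mulVec_smul, Matrix.mulVec_add, Matrix.mulVec_sum] at h2
    simpa [vecOf_eq] using h2
  have hn1 : ‖vecOf n g m₀‖ ≤ k * |b| + l * (ρ₀ * ‖W‖) := by
    rw [hgm, hM, colM_mulVec]
    refine (norm_add_le _ _).trans (add_le_add ?_ ?_)
    · refine (norm_sum_le _ _).trans ?_
      calc ∑ a : Fin k, ‖y (e (Sum.inl a)) • evalT g p a‖ ≤ ∑ _a : Fin k, |b| := by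
            refine Finset.sum_le_sum fun a _ => ?_
            rw [norm_smul, Real.norm_eq_abs]
            exact (mul_le_mul (hyl a).le (hpi a) (norm_nonneg _) zero_le_one).trans (one_mul _).le
        _ = k * |b| := by simp
    · refine (norm_sum_le _ _).trans ?_
      calc ∑ a : Fin l, ‖y (e (Sum.inr a)) • W a‖ ≤ ∑ _a : Fin l, ρ₀ * ‖W‖ := by
            refine Finset.sum_le_sum fun a _ => ?_
            rw [norm_smul, Real.norm_eq_abs]
            exact mul_le_mul (hyr a).le (norm_le_pi_norm W a) (norm_nonneg _) (by linarith)
        _ = l * (ρ₀ * ‖W‖) := by simp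
  have hn2 : ‖∑ i, (β i : ℝ) • vecOf n g (p i)‖ ≤ d * (k * |b|) := by
    refine (norm_sum_le _ _).trans ?_
    calc ∑ i : Fin k, ‖(β i : ℝ) • vecOf n g (p i)‖ ≤ ∑ _i : Fin k, d * |b| := by
          refine Finset.sum_le_sum fun i _ => ?_
          rw [norm_smul, Real.norm_eq_abs]
          refine mul_le_mul ?_ (hpi i) (norm_nonneg _) hd'.le
          have h1 : (0 : ℝ) ≤ β i := by exact_mod_cast (hβ i).1
          have h2 : (β i : ℝ) < d := by exact_mod_cast (hβ i).2
          rw [abs_of_nonneg h1]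
          exact h2.le
      _ = d * (k * |b|) := by simp; ring
  have hd1 : (1 : ℝ) ≤ d := by exact_mod_cast hd
  have hX : 0 ≤ k * |b| + l * (ρ₀ * ‖W‖) := by positivity
  have hq : ‖vecOf n g q‖ ≤ 2 * (k * |b|) + l * (ρ₀ * ‖W‖) := by
    have h1 : (d : ℝ) * ‖vecOf n g q‖ ≤ d * (2 * (k * |b|) + l * (ρ₀ * ‖W‖)) := by
      have h2 : ‖(d : ℝ) • vecOf n g q‖ = d * ‖vecOf n g q‖ := by
        rw [norm_smul, Real.norm_eq_abs, abs_of_pos hd']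
      rw [← h2, hgq]
      refine (norm_add_le _ _).trans ((add_le_add hn1 hn2).trans ?_)
      nlinarith
    exact le_of_mul_le_mul_left h1 hd'
  have hX2 : 0 ≤ 2 * (k * |b|) + l * (ρ₀ * ‖W‖) := by positivity
  rw [mem_closedBall_zero_iff, pi_norm_le_iff_of_nonneg (by positivity)]
  intro i
  refine Fin.cases ?_ (fun i => ?_) i
  · change ‖vecOf n g q‖ ≤ _
    linarith [abs_nonneg b]
  · change ‖vecOf n g (p i)‖ ≤ _
    linarith [hpi i]

lemma nuT_ctrlSet_lt_top (hl : 0 < l) {m : Measure (SLR n)}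
    (hR : ∀ ρ, nuT m (PrimT n (k + 1)) (Metric.closedBall 0 ρ) < ∞) (W : Tup n l) {r b : ℝ}
    (hr : 0 < r) : nuT m (PrimT n k) (ctrlSet e W r b) < ∞ := by
  classical
  obtain ⟨ρ, hρ⟩ := exists_primT_cons e hl W (b := b) hr
  refine lt_of_le_of_lt ?_ (hR ρ)
  rw [nuT_apply m _ (measurableSet_ctrlSet e W r b), nuT_apply m _ measurableSet_closedBall]
  refine lintegral_mono fun g => ?_
  rw [← (Fin.consEquiv fun _ : Fin (k + 1) => Fin n → ℤ).tsum_eq, ENNReal.tsum_prod',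
    ENNReal.tsum_comm]
  refine ENNReal.tsum_le_tsum fun p => ?_
  by_cases h : p ∈ PrimT n k ∧ evalT g p ∈ ctrlSet e W r b
  · obtain ⟨q, hq1, hq2⟩ := hρ g p h.1 h.2
    refine le_trans ?_ (ENNReal.le_tsum q)
    have h3 : (Fin.consEquiv fun _ : Fin (k + 1) => Fin n → ℤ) (q, p)
      = (Fin.cons q p : Fin (k + 1) → Fin n → ℤ) := rfl
    rw [h3]
    simp [Set.indicator_apply, h.1, h.2, hq1, mem_closedBall_zero_iff.mp hq2]
  · have h0 : (PrimT n k).indicator (fun p =>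
        (ctrlSet e W r b).indicator (1 : Tup n k → ℝ≥0∞) (evalT g p)) p = 0 := by
      simp only [Set.indicator_apply]
      split_ifs <;> simp_all
    rw [h0]
    exact zero_le

end step

lemma sigmaFinite_nuT_primT {n k l : ℕ} (e : Fin k ⊕ Fin l ≃ Fin n) (hl : 0 < l) {m : Measure (SLR n)}
    (hR : ∀ ρ, nuT m (PrimT n (k + 1)) (Metric.closedBall 0 ρ) < ∞) :
    SigmaFinite (nuT m (PrimT n k)) := by
  obtain ⟨D, hDc, hDd⟩ := TopologicalSpace.exists_countable_dense (Tup n l)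
  let S : Set (Set (Tup n k)) := insert (goodT e)ᶜ
    ((fun x : Tup n l × ℕ × ℕ => ctrlSet e x.1 (1 / ((x.2.1 : ℝ) + 1)) x.2.2) ''
      (D ×ˢ Set.univ))
  refine Measure.sigmaFinite_of_countable (S := S) ?_ ?_ ?_
  · exact ((hDc.prod Set.countable_univ).image _).insert _
  · rintro s (rfl | ⟨x, -, rfl⟩)
    · rw [nuT_compl_goodT e hl m fun p hp => PrimT.linearIndependent hp]
      exact ENNReal.zero_lt_top
    · exact nuT_ctrlSet_lt_top e hl hR _ (by positivity)
  · rw [Set.eq_univ_iff_forall]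
    intro V
    by_cases hV : V ∈ goodT e
    · obtain ⟨W, hW⟩ := hV
      have hcont : Continuous fun W : Tup n l => (colM e V W).det :=
        (continuous_colM_det e).comp (by fun_prop : Continuous fun W : Tup n l => (V, W))
      obtain ⟨W', hW', hW'D⟩ := hDd.exists_mem_open (isOpen_ne_fun hcont continuous_const)
        ⟨W, hW⟩
      obtain ⟨i, hi⟩ := exists_nat_one_div_lt (abs_pos.mpr hW'D)
      obtain ⟨j, hj⟩ := exists_nat_ge ‖V‖
      exact Set.mem_sUnion.mpr ⟨_, Or.inr ⟨(W', i, j), ⟨hW', trivial⟩, rfl⟩, hi.le, hj⟩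
    · exact Set.mem_sUnion.mpr ⟨_, Or.inl rfl, hV⟩

/-- The expected number of primitive systems in a ball is finite. -/
theorem nuT_primT_closedBall_lt_top {n : ℕ} {m : Measure (SLR n)} (hm : LatticeInvariant m) {k : ℕ}
    (hkn : k ≤ n) : ∀ ρ, nuT m (PrimT n k) (Metric.closedBall 0 ρ) < ∞ := by
  induction hkn using Nat.decreasingInduction with
  | self => exact nuT_primT_self_lt_top hm
  | of_succ k hk ih =>
    intro ρ
    let e : Fin k ⊕ Fin (n - k) ≃ Fin n := finSumFinEquiv.trans (finCongr (by omega))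
    have hl : 0 < n - k := by omega
    have := sigmaFinite_nuT_primT e hl ih
    obtain ⟨c, hc, h⟩ := nuT_eq_volume e hl hm (gammaInv_primT n k)
      fun p hp => PrimT.linearIndependent hp
    rw [h _ measurableSet_closedBall]
    refine ENNReal.mul_lt_top hc.lt_top ((measure_mono Set.inter_subset_left).trans_lt ?_)
    exact (isCompact_closedBall _ _).measure_lt_top

/-- A measure on tuples which is finite on balls is `σ`-finite. -/
lemma sigmaFinite_of_closedBall {n k : ℕ} {ν : Measure (Tup n k)}
    (h : ∀ ρ, ν (Metric.closedBall 0 ρ) < ∞) : SigmaFinite ν := by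
  have : IsFiniteMeasureOnCompacts ν := ⟨fun K hK => by
    obtain ⟨ρ, hρ⟩ := hK.isBounded.subset_closedBall (0 : Tup n k)
    exact (measure_mono hρ).trans_lt (h ρ)⟩
  infer_instance

/-- Primitive integer vectors. -/
def PrimV (n : ℕ) : Set (Fin n → ℤ) :=
  {v | ∀ (a : ℝ) (m : Fin n → ℤ), a • castV v = castV m → ∃ b : ℤ, a = b}

lemma mem_primT_one {n : ℕ} {p : Fin 1 → Fin n → ℤ} : p ∈ PrimT n 1 ↔ p 0 ∈ PrimV n := by
  constructor
  · intro h a m ham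
    exact h (fun _ => a) m (by simpa using ham) 0
  · intro h a m ham i
    rw [Subsingleton.elim i 0]
    exact h (a 0) m (by simpa using ham)

lemma PrimV.ne_zero {n : ℕ} {v : Fin n → ℤ} (hv : v ∈ PrimV n) : v ≠ 0 := by
  rintro rfl
  obtain ⟨b, hb⟩ := hv (1 / 2) 0 (by simp)
  have h2 : (1 : ℝ) = ((2 * b : ℤ) : ℝ) := by push_cast; linarith
  have h3 : (1 : ℤ) = 2 * b := by exact_mod_cast h2
  omega

/-- The sum of a function over the primitive vectors of a lattice. -/
def sieg {n : ℕ} (F : (Fin n → ℝ) → ℝ≥0∞) (g : SLR n) : ℝ≥0∞ :=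
  ∑' v : Fin n → ℤ, (PrimV n).indicator (fun v => F (vecOf n g v)) v

lemma measurable_indicator_vecOf {n : ℕ} {F : (Fin n → ℝ) → ℝ≥0∞} (hF : Measurable F)
    (P : Set (Fin n → ℤ)) (v : Fin n → ℤ) :
    Measurable fun g : SLR n => P.indicator (fun v => F (vecOf n g v)) v := by
  by_cases h : v ∈ P
  · simp only [Set.indicator_of_mem h]
    exact hF.comp (measurable_vecOf v)
  · simp only [Set.indicator_of_notMem h]
    exact measurable_const

lemma measurable_sieg {n : ℕ} {F : (Fin n → ℝ) → ℝ≥0∞} (hF : Measurable F) :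
    Measurable (sieg F) :=
  Measurable.tsum fun v => measurable_indicator_vecOf hF _ v

lemma sieg_mono {n : ℕ} {F G : (Fin n → ℝ) → ℝ≥0∞} (h : F ≤ G) (g : SLR n) :
    sieg F g ≤ sieg G g :=
  ENNReal.tsum_le_tsum fun _ => Set.indicator_le_indicator (h _)

lemma tsum_evalT_primT_one {n : ℕ} (F : (Fin n → ℝ) → ℝ≥0∞) (g : SLR n) :
    ∑' p : Fin 1 → Fin n → ℤ, (PrimT n 1).indicator (fun p => F (evalT g p 0)) p = sieg F g := by
  rw [sieg, ← (Equiv.funUnique (Fin 1) (Fin n → ℤ)).tsum_eq]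
  refine tsum_congr fun p => ?_
  change _ = (PrimV n).indicator (fun v => F (vecOf n g v)) (p 0)
  by_cases h : p ∈ PrimT n 1
  · rw [Set.indicator_of_mem h, Set.indicator_of_mem (mem_primT_one.mp h)]
    rfl
  · rw [Set.indicator_of_notMem h, Set.indicator_of_notMem fun h' => h (mem_primT_one.mpr h')]

lemma exists_lintegral_sieg {n : ℕ} (hn : 2 ≤ n) {m : Measure (SLR n)} (hm : LatticeInvariant m) :
    ∃ c : ℝ≥0∞, c ≠ ∞ ∧ ∀ F : (Fin n → ℝ) → ℝ≥0∞, Measurable F →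
      ∫⁻ g, sieg F g ∂m = c * ∫⁻ x, F x := by
  have : Nonempty (Fin n) := ⟨⟨0, by omega⟩⟩
  let e : Fin 1 ⊕ Fin (n - 1) ≃ Fin n := finSumFinEquiv.trans (finCongr (by omega))
  have hl : 0 < n - 1 := by omega
  have := sigmaFinite_of_closedBall (nuT_primT_closedBall_lt_top hm (k := 1) (by omega))
  obtain ⟨c, hc, h⟩ := nuT_eq_volume e hl hm (gammaInv_primT n 1)
    fun p hp => PrimT.linearIndependent hp
  have hnull : (volume : Measure (Tup n 1)) (goodT e)ᶜ = 0 := by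
    refine measure_mono_null (t := {0}) (fun V hV => ?_) (measure_singleton _)
    by_contra hne
    refine hV (mem_goodT_of_linearIndependent e (LinearIndependent.of_subsingleton 0 fun h0 => ?_))
    exact hne (funext fun i => by rw [Subsingleton.elim i 0]; exact h0)
  have hν : nuT m (PrimT n 1) = c • volume := by
    ext B hB
    rw [h B hB, measure_inter_conull hnull]
    rfl
  refine ⟨c, hc, fun F hF => ?_⟩
  have hF1 : Measurable fun V : Tup n 1 => F (V 0) := hF.comp (measurable_pi_apply 0)
  have h1 := lintegral_nuT m (PrimT n 1) hF1
  simp only [tsum_evalT_primT_one] at h1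
  rw [← h1, hν, lintegral_smul_measure, smul_eq_mul,
    ← (volume_preserving_funUnique (Fin 1) (Fin n → ℝ)).lintegral_comp hF]
  rfl

lemma vecOf_zsmul {n : ℕ} (g : SLR n) (k : ℤ) (v : Fin n → ℤ) :
    vecOf n g (k • v) = (k : ℝ) • vecOf n g v := by
  rw [vecOf_eq, vecOf_eq, castV_smul, Matrix.mulVec_smul]

lemma exists_primV_smul {n : ℕ} {w : Fin n → ℤ} (hw : w ≠ 0) :
    ∃ (j : ℕ) (v : Fin n → ℤ), v ∈ PrimV n ∧ ((j + 1 : ℕ) : ℤ) • v = w := by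
  have h0 : (Fin.elim0 : Fin 0 → Fin n → ℤ) ∈ PrimT n 0 := fun a m h i => i.elim0
  obtain ⟨q, d, b, hd, -, hq, h⟩ := PrimT.exists_cons h0 (m₀ := w) fun a h => by
    refine hw (castV_injective ?_)
    simpa using h
  refine ⟨d - 1, q, mem_primT_one.mp hq, ?_⟩
  rw [Nat.sub_add_cancel hd]
  simpa using h

lemma primV_smul_inj {n : ℕ} {v v' : Fin n → ℤ} (hv : v ∈ PrimV n) (hv' : v' ∈ PrimV n) {j j' : ℕ}
    (h : ((j + 1 : ℕ) : ℤ) • v = ((j' + 1 : ℕ) : ℤ) • v') : j = j' ∧ v = v' := by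
  have key : ∀ {v v' : Fin n → ℤ} {j j' : ℕ}, v ∈ PrimV n →
      ((j + 1 : ℕ) : ℤ) • v = ((j' + 1 : ℕ) : ℤ) • v' → j' ≤ j := by
    intro v v' j j' hv h
    have h1 := congrArg castV h
    rw [castV_smul, castV_smul] at h1
    push_cast at h1
    have hj : (0 : ℝ) < j + 1 := by positivity
    have hj' : (0 : ℝ) < j' + 1 := by positivity
    obtain ⟨b, hb⟩ := hv ((j + 1) / (j' + 1)) v' (by
      rw [div_eq_inv_mul, mul_smul, h1, smul_smul, inv_mul_cancel₀ hj'.ne', one_smul])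
    have hb0 : (0 : ℝ) < b := hb ▸ by positivity
    have hb1 : (1 : ℝ) ≤ b := by exact_mod_cast (show (0 : ℤ) < b by exact_mod_cast hb0)
    rw [← hb, le_div_iff₀ hj'] at hb1
    have : (j' : ℝ) ≤ j := by linarith
    exact_mod_cast this
  have hjj : j = j' := le_antisymm (key hv' h.symm) (key hv h)
  subst hjj
  refine ⟨rfl, ?_⟩
  funext i
  have := congrFun h i
  simp only [Pi.smul_apply, smul_eq_mul] at this
  exact mul_left_cancel₀ (by positivity) this

/-- The sum over all nonzero lattice vectors in terms of sums over primitive vectors. -/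
lemma tsum_ne_zero_eq {n : ℕ} (F : (Fin n → ℝ) → ℝ≥0∞) (g : SLR n) :
    ∑' w : Fin n → ℤ, ({0}ᶜ : Set (Fin n → ℤ)).indicator (fun w => F (vecOf n g w)) w
      = ∑' j : ℕ, sieg (fun x => F ((j + 1 : ℝ) • x)) g := by
  let φ : ℕ × PrimV n → ({0}ᶜ : Set (Fin n → ℤ)) := fun x => ⟨((x.1 + 1 : ℕ) : ℤ) • (x.2 : Fin n → ℤ), by
    rw [Set.mem_compl_singleton_iff]
    exact smul_ne_zero (by positivity) (PrimV.ne_zero x.2.2)⟩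
  have hφ : Function.Bijective φ := by
    constructor
    · rintro ⟨j, v, hv⟩ ⟨j', v', hv'⟩ h
      obtain ⟨rfl, rfl⟩ := primV_smul_inj hv hv' (congrArg Subtype.val h)
      rfl
    · rintro ⟨w, hw⟩
      obtain ⟨j, v, hv, h⟩ := exists_primV_smul hw
      exact ⟨(j, ⟨v, hv⟩), Subtype.ext h⟩
  rw [← tsum_subtype, ← (Equiv.ofBijective φ hφ).tsum_eq, ENNReal.tsum_prod']
  refine tsum_congr fun j => ?_
  rw [sieg, ← tsum_subtype]
  refine tsum_congr fun v => ?_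
  change F (vecOf n g (((j + 1 : ℕ) : ℤ) • (v : Fin n → ℤ))) = _
  rw [vecOf_zsmul]
  push_cast
  rfl

lemma lintegral_comp_smul_vec {n : ℕ} {a : ℝ} (ha : 0 < a) {F : (Fin n → ℝ) → ℝ≥0∞}
    (hF : Measurable F) :
    ∫⁻ x, F (a • x) = ENNReal.ofReal ((a ^ n)⁻¹) * ∫⁻ x, F x := by
  have h := Measure.map_addHaar_smul (volume : Measure (Fin n → ℝ)) ha.ne'
  rw [← lintegral_map hF (measurable_const_smul a), h, lintegral_smul_measure, smul_eq_mul]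
  simp [abs_of_pos, ha]

/-- The number of lattice vectors (including `0`) in a set. -/
def cnt {n : ℕ} (B : Set (Fin n → ℝ)) (g : SLR n) : ℝ≥0∞ :=
  ∑' w : Fin n → ℤ, B.indicator (1 : (Fin n → ℝ) → ℝ≥0∞) (vecOf n g w)

lemma vecOf_zero {n : ℕ} (g : SLR n) : vecOf n g 0 = 0 := by
  rw [vecOf_eq, castV_zero, Matrix.mulVec_zero]

lemma vecOf_sub {n : ℕ} (g : SLR n) (v w : Fin n → ℤ) :
    vecOf n g (v - w) = vecOf n g v - vecOf n g w := by
  rw [vecOf_eq, vecOf_eq, vecOf_eq, castV_sub, Matrix.mulVec_sub]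

lemma cnt_eq {n : ℕ} {B : Set (Fin n → ℝ)} (h0 : (0 : Fin n → ℝ) ∈ B) (g : SLR n) :
    cnt B g = 1 + ∑' j : ℕ, sieg (fun x => B.indicator 1 ((j + 1 : ℝ) • x)) g := by
  rw [← tsum_ne_zero_eq, cnt]
  have h : ∀ w : Fin n → ℤ, B.indicator (1 : (Fin n → ℝ) → ℝ≥0∞) (vecOf n g w)
      = ({0} : Set (Fin n → ℤ)).indicator (1 : (Fin n → ℤ) → ℝ≥0∞) w
        + ({0}ᶜ : Set (Fin n → ℤ)).indicator (fun w => B.indicator 1 (vecOf n g w)) w := by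
    intro w
    by_cases hw : w = 0
    · subst hw
      simp [vecOf_zero, h0]
    · simp [hw]
  rw [tsum_congr h, ENNReal.tsum_add]
  congr 1
  rw [tsum_eq_single 0 (by intro w hw; simp [hw])]
  simp

lemma cnt_closedBall_le {n : ℕ} (R : ℕ) (g : SLR n) :
    cnt (Metric.closedBall 0 (R : ℝ)) g
      ≤ ((2 * R + 1 : ℕ) : ℝ≥0∞) ^ n * cnt (Metric.closedBall 0 1) g := by
  classical
  let fl : (Fin n → ℤ) → Fin n → ℤ := fun w i => ⌊vecOf n g w i⌋
  let s : Finset (Fin n → ℤ) := Fintype.piFinset fun _ => Finset.Icc (-(R : ℤ)) R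
  have hs : s.card = (2 * R + 1) ^ n := by
    simp only [s, Fintype.card_piFinset, Int.card_Icc, Finset.prod_const, Finset.card_univ,
      Fintype.card_fin]
    congr 1
    omega
  have h1 : ∀ w, (Metric.closedBall 0 (R : ℝ)).indicator (1 : (Fin n → ℝ) → ℝ≥0∞) (vecOf n g w)
      ≤ ∑ k ∈ s, if fl w = k then 1 else 0 := by
    intro w
    refine Set.indicator_apply_le' (fun hw => ?_) fun _ => bot_le
    have hmem : fl w ∈ s := by
      rw [Fintype.mem_piFinset]
      intro i
      rw [mem_closedBall_zero_iff] at hw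
      have h2 := abs_le.mp ((norm_le_pi_norm (vecOf n g w) i).trans hw)
      rw [Finset.mem_Icc]
      constructor
      · exact Int.le_floor.mpr (by push_cast; exact h2.1)
      · exact_mod_cast (Int.floor_le _).trans h2.2
    rw [Finset.sum_ite_eq s (fl w), if_pos hmem]
    rfl
  have h2 : ∀ k ∈ s, ∑' w, (if fl w = k then (1 : ℝ≥0∞) else 0) ≤ cnt (Metric.closedBall 0 1) g := by
    intro k _
    by_cases hk : ∃ w₀, fl w₀ = k
    · obtain ⟨w₀, hw₀⟩ := hk
      rw [cnt, ← (Equiv.subRight w₀).tsum_eq fun w =>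
        (Metric.closedBall 0 1).indicator (1 : (Fin n → ℝ) → ℝ≥0∞) (vecOf n g w)]
      refine ENNReal.tsum_le_tsum fun w => ?_
      split_ifs with hw
      · rw [Set.indicator_of_mem]
        · rfl
        · change vecOf n g (w - w₀) ∈ Metric.closedBall (0 : Fin n → ℝ) 1
          rw [vecOf_sub, mem_closedBall_zero_iff, pi_norm_le_iff_of_nonneg zero_le_one]
          intro i
          have h3 := congrFun (hw.trans hw₀.symm) i
          rw [Pi.sub_apply, Real.norm_eq_abs]
          exact (Int.abs_sub_lt_one_of_floor_eq_floor h3).le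
      · exact bot_le
    · rw [ENNReal.tsum_eq_zero.mpr]
      · exact bot_le
      · intro w
        rw [if_neg fun h => hk ⟨w, h⟩]
  calc cnt (Metric.closedBall 0 (R : ℝ)) g
      ≤ ∑' w, ∑ k ∈ s, (if fl w = k then (1 : ℝ≥0∞) else 0) := ENNReal.tsum_le_tsum h1
    _ = ∑ k ∈ s, ∑' w, (if fl w = k then (1 : ℝ≥0∞) else 0) :=
        Summable.tsum_finsetSum fun _ _ => ENNReal.summable
    _ ≤ ∑ _k ∈ s, cnt (Metric.closedBall 0 1) g := Finset.sum_le_sum h2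
    _ = _ := by rw [Finset.sum_const, hs, nsmul_eq_mul]; push_cast; rfl

lemma finite_vecOf_mem {n : ℕ} (g : SLR n) {B : Set (Fin n → ℝ)} (hB : Bornology.IsBounded B) :
    {w : Fin n → ℤ | vecOf n g w ∈ B}.Finite := by
  obtain ⟨R, hR⟩ := hB.subset_closedBall (0 : Fin n → ℝ)
  let L := LinearMap.toContinuousLinearMap
    (Matrix.toLin' ((g⁻¹ : SLR n) : Matrix (Fin n) (Fin n) ℝ))
  have hL : ∀ w, L (vecOf n g w) = castV w := fun w => by
    change ((g⁻¹ : SLR n) : Matrix (Fin n) (Fin n) ℝ).mulVec _ = _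
    rw [vecOf_eq, Matrix.mulVec_mulVec, ← Matrix.SpecialLinearGroup.coe_mul, inv_mul_cancel,
      Matrix.SpecialLinearGroup.coe_one, Matrix.one_mulVec]
  let N : ℤ := ⌈‖L‖ * R⌉
  refine (Set.finite_Icc (fun _ => -N) (fun _ => N)).subset fun w hw => ?_
  have h1 : ‖castV w‖ ≤ ‖L‖ * R := by
    rw [← hL]
    exact (L.le_opNorm _).trans (by
      gcongr
      exact mem_closedBall_zero_iff.mp (hR hw))
  have h2 : ∀ i, |(w i : ℝ)| ≤ N := fun i =>
    ((norm_le_pi_norm (castV w) i).trans h1).trans (Int.le_ceil _)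
  constructor <;> intro i <;> have := abs_le.mp (h2 i)
  · exact_mod_cast this.1
  · exact_mod_cast this.2

lemma cnt_eq_card {n : ℕ} (g : SLR n) {B : Set (Fin n → ℝ)} (hB : Bornology.IsBounded B) :
    cnt B g = (Nat.card {w : Fin n → ℤ | vecOf n g w ∈ B} : ℝ≥0∞) := by
  have hf := finite_vecOf_mem g hB
  have := hf.to_subtype
  have h : ∀ w : Fin n → ℤ, B.indicator (1 : (Fin n → ℝ) → ℝ≥0∞) (vecOf n g w)
    = {w : Fin n → ℤ | vecOf n g w ∈ B}.indicator (fun _ => 1) w := fun w => rfl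
  rw [cnt, tsum_congr h, ← tsum_subtype, ENNReal.tsum_const, ENat.card_eq_coe_natCard, mul_one]
  rfl

lemma tendsto_cnt_div_pow {n : ℕ} (g : SLR n) :
    Tendsto (fun R : ℕ => cnt (Metric.closedBall 0 (R : ℝ)) g / (R : ℝ≥0∞) ^ n) atTop
      (nhds (volume (Metric.closedBall (0 : Fin n → ℝ) 1))) := by
  let L := LinearMap.toContinuousLinearMap
    (Matrix.toLin' (g : Matrix (Fin n) (Fin n) ℝ))
  have hLmp := measurePreserving_mulVec g
  let s : Set (Fin n → ℝ) := L ⁻¹' Metric.closedBall 0 1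
  have hsm : MeasurableSet s := L.continuous.measurable measurableSet_closedBall
  have hvol : volume s = volume (Metric.closedBall (0 : Fin n → ℝ) 1) :=
    hLmp.measure_preimage measurableSet_closedBall.nullMeasurableSet
  have hinv : ∀ x, ((g⁻¹ : SLR n) : Matrix (Fin n) (Fin n) ℝ).mulVec (L x) = x := fun x => by
    change ((g⁻¹ : SLR n) : Matrix (Fin n) (Fin n) ℝ).mulVec
      ((g : Matrix (Fin n) (Fin n) ℝ).mulVec x) = _
    rw [Matrix.mulVec_mulVec, ← Matrix.SpecialLinearGroup.coe_mul, inv_mul_cancel,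
      Matrix.SpecialLinearGroup.coe_one, Matrix.one_mulVec]
  have hsb : Bornology.IsBounded s := by
    let L' := LinearMap.toContinuousLinearMap
      (Matrix.toLin' ((g⁻¹ : SLR n) : Matrix (Fin n) (Fin n) ℝ))
    refine ((L'.lipschitz.isBounded_image
      (Metric.isBounded_closedBall (x := (0 : Fin n → ℝ)) (r := 1)))).subset fun x hx => ?_
    exact ⟨L x, hx, hinv x⟩
  have hconv : Convex ℝ s := (convex_closedBall (0 : Fin n → ℝ) 1).linear_preimage L.toLinearMap
  have hT := tendsto_card_div_pow_atTop_volume (ι := Fin n) s hsb hsm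
    (hconv.addHaar_frontier volume)
  have hreal := (ENNReal.continuous_ofReal.tendsto _).comp hT
  rw [measureReal_def, ENNReal.ofReal_toReal (by
    rw [hvol]; exact (isCompact_closedBall _ _).measure_lt_top.ne), hvol] at hreal
  refine hreal.congr' ?_
  filter_upwards [eventually_gt_atTop 0] with R hR
  have hR' : (0 : ℝ) < R := by exact_mod_cast hR
  rw [Function.comp_apply, Fintype.card_fin, cnt_eq_card g Metric.isBounded_closedBall,
    ENNReal.ofReal_div_of_pos (by positivity), ENNReal.ofReal_natCast,
    ENNReal.ofReal_pow hR'.le, ENNReal.ofReal_natCast]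
  congr 2
  symm
  refine Nat.card_congr (Equiv.ofBijective (fun w => ⟨(R : ℝ)⁻¹ • castV w.1, ?_, ?_⟩) ⟨?_, ?_⟩)
  · have hw := w.2
    rw [Set.mem_ofPred_eq, mem_closedBall_zero_iff] at hw
    change L _ ∈ Metric.closedBall (0 : Fin n → ℝ) 1
    rw [map_smul, mem_closedBall_zero_iff, norm_smul, norm_inv, Real.norm_natCast,
      inv_mul_le_iff₀ hR', mul_one]
    exact hw
  · refine Set.smul_mem_smul_set ?_
    rw [SetLike.mem_coe, Module.Basis.mem_span_iff_repr_mem]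
    exact fun i => ⟨w.1 i, by simp [castV]⟩
  · intro w w' h
    have h1 := congrArg Subtype.val h
    exact Subtype.ext (castV_injective (smul_right_injective _ (inv_ne_zero hR'.ne') h1))
  · rintro ⟨x, hx, hx'⟩
    obtain ⟨y, hy, rfl⟩ := Set.mem_smul_set.mp hx'
    rw [SetLike.mem_coe, Module.Basis.mem_span_iff_repr_mem] at hy
    choose z hz using hy
    have hyz : castV z = y := funext fun i => by simpa [castV] using hz i
    subst hyz
    refine ⟨⟨z, ?_⟩, rfl⟩
    change L _ ∈ Metric.closedBall (0 : Fin n → ℝ) 1 at hx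
    rw [map_smul, mem_closedBall_zero_iff, norm_smul, norm_inv, Real.norm_natCast,
      inv_mul_le_iff₀ hR', mul_one] at hx
    exact mem_closedBall_zero_iff.mpr hx

/-- The zeta value `∑ 1 / jⁿ`. -/
def zetaT (n : ℕ) : ℝ≥0∞ := ∑' j : ℕ, ENNReal.ofReal (((j + 1 : ℝ) ^ n)⁻¹)

lemma zetaT_ne_top {n : ℕ} (hn : 2 ≤ n) : zetaT n ≠ ∞ := by
  have h : Summable fun j : ℕ => ((j + 1 : ℝ) ^ n)⁻¹ := by
    have := (summable_nat_add_iff 1).mpr (Real.summable_nat_pow_inv.mpr (show 1 < n by omega))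
    simpa using this
  exact h.tsum_ofReal_ne_top

lemma volume_closedBall_pi {n : ℕ} {R : ℝ} (hR : 0 ≤ R) :
    volume (Metric.closedBall (0 : Fin n → ℝ) R)
      = ENNReal.ofReal R ^ n * volume (Metric.closedBall (0 : Fin n → ℝ) 1) := by
  rw [Real.volume_pi_closedBall _ hR, Real.volume_pi_closedBall _ zero_le_one,
    ← ENNReal.ofReal_pow hR, ← ENNReal.ofReal_mul (by positivity), Fintype.card_fin, mul_pow]
  congr 1
  ring

lemma volume_closedBall_one_ne_zero {n : ℕ} :
    volume (Metric.closedBall (0 : Fin n → ℝ) 1) ≠ 0 :=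
  (Metric.measure_closedBall_pos _ _ zero_lt_one).ne'

lemma volume_closedBall_ne_top {n : ℕ} (R : ℝ) :
    volume (Metric.closedBall (0 : Fin n → ℝ) R) ≠ ∞ :=
  (isCompact_closedBall _ _).measure_lt_top.ne

lemma measurable_indicator_smul {n : ℕ} {B : Set (Fin n → ℝ)} (hB : MeasurableSet B) (a : ℝ) :
    Measurable fun x : Fin n → ℝ => B.indicator (1 : (Fin n → ℝ) → ℝ≥0∞) (a • x) :=
  (measurable_indicator_one hB).comp (measurable_const_smul a)

lemma tsum_lintegral_smul {n : ℕ} {B : Set (Fin n → ℝ)} (hB : MeasurableSet B) :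
    ∑' j : ℕ, ∫⁻ x : Fin n → ℝ, B.indicator (1 : (Fin n → ℝ) → ℝ≥0∞) ((j + 1 : ℝ) • x)
      = zetaT n * volume B := by
  rw [zetaT, ← ENNReal.tsum_mul_right]
  refine tsum_congr fun j => ?_
  rw [lintegral_comp_smul_vec (by positivity) (measurable_indicator_one hB),
    lintegral_indicator_one hB]

lemma measurable_cnt {n : ℕ} {B : Set (Fin n → ℝ)} (hB : MeasurableSet B) :
    Measurable (cnt B) :=
  Measurable.tsum fun v => (measurable_indicator_one hB).comp (measurable_vecOf v)

lemma tendsto_one_div_pow_add {n : ℕ} (hn : n ≠ 0) (a : ℝ≥0∞) :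
    Tendsto (fun R : ℕ => 1 / (R : ℝ≥0∞) ^ n + a) atTop (nhds a) := by
  have h1 : Tendsto (fun R : ℕ => ((R : ℝ≥0∞)⁻¹) ^ n) atTop (nhds (0 ^ n)) :=
    ((ENNReal.continuous_pow n).tendsto _).comp ENNReal.tendsto_inv_nat_nhds_zero
  rw [zero_pow hn] at h1
  have h2 := h1.add (tendsto_const_nhds (x := a))
  rw [zero_add] at h2
  refine h2.congr fun R => ?_
  rw [one_div, ENNReal.inv_pow]

lemma one_le_mul_zetaT {n : ℕ} (hn : 2 ≤ n) {m : Measure (SLR n)} (hm : LatticeInvariant m)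
    {c : ℝ≥0∞} (hc : ∀ F : (Fin n → ℝ) → ℝ≥0∞, Measurable F →
      ∫⁻ g, sieg F g ∂m = c * ∫⁻ x, F x) : 1 ≤ c * zetaT n := by
  have := hm.prob
  set β := volume (Metric.closedBall (0 : Fin n → ℝ) 1) with hβ
  have hbound : ∀ R : ℕ, ∫⁻ g, cnt (Metric.closedBall 0 (R : ℝ)) g ∂m
      = 1 + c * (zetaT n * ((R : ℝ≥0∞) ^ n * β)) := by
    intro R
    have hB : MeasurableSet (Metric.closedBall (0 : Fin n → ℝ) R) := measurableSet_closedBall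
    simp only [cnt_eq (Metric.mem_closedBall_self (Nat.cast_nonneg R))]
    rw [lintegral_add_left measurable_const, lintegral_const, measure_univ, mul_one,
      lintegral_tsum fun j => (measurable_sieg (measurable_indicator_smul hB _)).aemeasurable]
    congr 1
    simp only [hc _ (measurable_indicator_smul hB _)]
    rw [ENNReal.tsum_mul_left, tsum_lintegral_smul hB, volume_closedBall_pi (Nat.cast_nonneg R),
      ENNReal.ofReal_natCast]
  have hfat := lintegral_liminf_le (μ := m) (u := atTop)
    (f := fun (R : ℕ) g => cnt (Metric.closedBall (0 : Fin n → ℝ) R) g / (R : ℝ≥0∞) ^ n)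
    fun R => (measurable_cnt measurableSet_closedBall).div_const _
  simp only [(tendsto_cnt_div_pow _).liminf_eq, lintegral_const, measure_univ, mul_one] at hfat
  have hlim : Tendsto (fun R : ℕ => ∫⁻ g, cnt (Metric.closedBall (0 : Fin n → ℝ) R) g
      / (R : ℝ≥0∞) ^ n ∂m) atTop (nhds (c * zetaT n * β)) := by
    refine (tendsto_one_div_pow_add (show n ≠ 0 by omega) _).congr' ?_
    filter_upwards [eventually_gt_atTop 0] with R hR
    have hR0 : (R : ℝ≥0∞) ^ n ≠ 0 := pow_ne_zero _ (by exact_mod_cast hR.ne')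
    have hRt : (R : ℝ≥0∞) ^ n ≠ ∞ := ENNReal.pow_ne_top (ENNReal.natCast_ne_top R)
    simp only [div_eq_mul_inv]
    rw [lintegral_mul_const _ (measurable_cnt measurableSet_closedBall), hbound R, add_mul, one_mul]
    congr 1
    rw [show c * (zetaT n * ((R : ℝ≥0∞) ^ n * β)) * ((R : ℝ≥0∞) ^ n)⁻¹
      = c * zetaT n * β * ((R : ℝ≥0∞) ^ n * ((R : ℝ≥0∞) ^ n)⁻¹) by ring,
      ENNReal.mul_inv_cancel hR0 hRt, mul_one]
  rw [hlim.liminf_eq] at hfat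
  have hβt : β ≠ ∞ := volume_closedBall_ne_top 1
  refine (ENNReal.mul_le_mul_iff_left (volume_closedBall_one_ne_zero (n := n)) hβt).mp ?_
  rw [one_mul]
  exact hfat

/-- Linearly independent pairs of primitive vectors. -/
def PairT (n : ℕ) : Set (Fin 2 → Fin n → ℤ) :=
  {p | p 0 ∈ PrimV n ∧ p 1 ∈ PrimV n ∧ LinearIndependent ℝ fun i => castV (p i)}

lemma PrimV.neg {n : ℕ} {v : Fin n → ℤ} (hv : v ∈ PrimV n) : -v ∈ PrimV n := by
  intro a m h
  obtain ⟨b, hb⟩ := hv (-a) m (by simpa using h)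
  exact ⟨-b, by push_cast; rw [← hb]; ring⟩

lemma PrimV.eq_or_neg {n : ℕ} {v w : Fin n → ℤ} (hv : v ∈ PrimV n) (hw : w ∈ PrimV n)
    (h : ¬ LinearIndependent ℝ fun i => castV ((![v, w] : Fin 2 → Fin n → ℤ) i)) :
    w = v ∨ w = -v := by
  have hpair : (fun i => castV ((![v, w] : Fin 2 → Fin n → ℤ) i)) = ![castV v, castV w] := by
    funext i
    fin_cases i <;> rfl
  rw [hpair, LinearIndependent.pair_iff] at h
  push Not at h
  obtain ⟨s, t, hst, hne⟩ := h
  have hv0 : castV v ≠ 0 := fun h0 => PrimV.ne_zero hv (castV_injective (by simpa using h0))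
  have hw0 : castV w ≠ 0 := fun h0 => PrimV.ne_zero hw (castV_injective (by simpa using h0))
  have ht : t ≠ 0 := by
    rintro rfl
    have hs : s = 0 := by simpa [hv0] using hst
    exact hne hs rfl
  have hs : s ≠ 0 := by
    rintro rfl
    exact ht (by simpa [hw0] using hst)
  have h1 : (-s / t) • castV v = castV w := by
    have h2 : -(s • castV v) = t • castV w := neg_eq_of_add_eq_zero_right hst
    rw [div_eq_inv_mul, mul_smul, neg_smul, h2, smul_smul, inv_mul_cancel₀ ht, one_smul]
  have h1' : (-t / s) • castV w = castV v := by
    rw [← h1, smul_smul, div_mul_div_comm, neg_mul_neg, mul_comm, div_self (mul_ne_zero hs ht),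
      one_smul]
  obtain ⟨a, ha⟩ := hv _ _ h1
  obtain ⟨b, hb⟩ := hw _ _ h1'
  have hab : a * b = 1 := by
    have : (a * b : ℝ) = 1 := by
      rw [← ha, ← hb]
      field_simp
    exact_mod_cast this
  rw [ha] at h1
  rcases Int.eq_one_or_neg_one_of_mul_eq_one hab with rfl | rfl
  · left
    exact castV_injective (by rw [← h1]; simp)
  · right
    exact castV_injective (by rw [← h1]; simp)

lemma vecOf_neg {n : ℕ} (g : SLR n) (v : Fin n → ℤ) : vecOf n g (-v) = -vecOf n g v := by
  rw [vecOf_eq, vecOf_eq, castV_neg, Matrix.mulVec_neg]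

lemma tsum_finTwo {α : Type*} (f : (Fin 2 → α) → ℝ≥0∞) :
    ∑' p, f p = ∑' v, ∑' w, f ![v, w] := by
  rw [← (finTwoArrowEquiv α).symm.tsum_eq, ENNReal.tsum_prod']
  rfl

/-- Diagonal and off-diagonal contributions to a product of two sums over primitive vectors. -/
lemma sieg_mul_sieg {n : ℕ} (F G : (Fin n → ℝ) → ℝ≥0∞) (g : SLR n) :
    sieg F g * sieg G g = sieg (fun x => F x * (G x + G (-x))) g
      + ∑' p, (PairT n).indicator (fun p => F (evalT g p 0) * G (evalT g p 1)) p := by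
  classical
  rw [tsum_finTwo, sieg, sieg, sieg, ← ENNReal.tsum_mul_right, ← ENNReal.tsum_add]
  refine tsum_congr fun v => ?_
  by_cases hv : v ∈ PrimV n
  swap
  · rw [Set.indicator_of_notMem hv, Set.indicator_of_notMem hv, zero_mul, zero_add, eq_comm,
      ENNReal.tsum_eq_zero]
    intro w
    exact Set.indicator_of_notMem (fun h => hv h.1) _
  rw [Set.indicator_of_mem hv, Set.indicator_of_mem hv, ← ENNReal.tsum_mul_left]
  have hvv : v ≠ -v := fun h => PrimV.ne_zero hv (self_eq_neg.mp h)
  have key : ∀ w, F (vecOf n g v) * (PrimV n).indicator (fun v => G (vecOf n g v)) w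
      = ((if w = v then F (vecOf n g v) * G (vecOf n g v) else 0)
        + (if w = -v then F (vecOf n g v) * G (-vecOf n g v) else 0))
        + (PairT n).indicator (fun p => F (evalT g p 0) * G (evalT g p 1)) ![v, w] := by
    intro w
    by_cases hw : w ∈ PrimV n
    swap
    · rw [Set.indicator_of_notMem hw, Set.indicator_of_notMem fun h => hw h.2.1,
        if_neg (fun h : w = v => hw (h ▸ hv)),
        if_neg (fun h : w = -v => hw (h ▸ PrimV.neg hv))]
      simp
    rw [Set.indicator_of_mem hw]
    by_cases hl : LinearIndependent ℝ fun i => castV ((![v, w] : Fin 2 → Fin n → ℤ) i)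
    · have hmem : ![v, w] ∈ PairT n := ⟨hv, hw, hl⟩
      have h1 : w ≠ v := by
        rintro rfl
        exact absurd (hl.injective (a₁ := 0) (a₂ := 1) rfl) (by decide)
      have h2 : w ≠ -v := by
        rintro rfl
        have h3 := Fintype.linearIndependent_iff.mp hl (fun _ => 1) (by
          simp [Fin.sum_univ_two]) 0
        simp at h3
      rw [Set.indicator_of_mem hmem, if_neg h1, if_neg h2, add_zero, zero_add]
      rfl
    · rw [Set.indicator_of_notMem fun h => hl h.2.2, add_zero]
      rcases PrimV.eq_or_neg hv hw hl with rfl | rfl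
      · rw [if_pos rfl, if_neg hvv, add_zero]
      · rw [if_neg hvv.symm, if_pos rfl, zero_add, vecOf_neg]
  rw [tsum_congr key, ENNReal.tsum_add, ENNReal.tsum_add, tsum_ite_eq, tsum_ite_eq, mul_add]

lemma primV_mulVec {n : ℕ} (γ : Matrix.SpecialLinearGroup (Fin n) ℤ)
    {v : Fin n → ℤ} (hv : v ∈ PrimV n) : (γ : Matrix (Fin n) (Fin n) ℤ).mulVec v ∈ PrimV n := by
  have h : (fun _ : Fin 1 => v) ∈ PrimT n 1 := mem_primT_one.mpr hv
  exact mem_primT_one.mp (primT_mulVec γ h)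

lemma gammaInv_pairT (n : ℕ) : GammaInv (PairT n) := by
  rintro γ p ⟨h0, h1, hl⟩
  refine ⟨primV_mulVec γ h0, primV_mulVec γ h1, ?_⟩
  have h := linearIndependent_evalT (intSL γ) hl
  convert h using 2 with i
  funext i
  rw [castV_mulVec, evalT, vecOf_eq]
  congr 1

lemma lintegral_tup_two {n : ℕ} {Φ : Tup n 2 → ℝ≥0∞} (hΦ : Measurable Φ) :
    ∫⁻ V : Tup n 2, Φ V = ∫⁻ x : Fin n → ℝ, ∫⁻ y : Fin n → ℝ, Φ ![x, y] := by
  have h := (volume_preserving_finTwoArrow (Fin n → ℝ)).symm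
  rw [← h.lintegral_comp hΦ, Measure.volume_eq_prod, lintegral_prod]
  · rfl
  · exact (hΦ.comp h.measurable).aemeasurable

lemma measurable_cons_two {n : ℕ} :
    Measurable fun p : (Fin n → ℝ) × (Fin n → ℝ) => (![p.1, p.2] : Tup n 2) := by
  refine measurable_pi_lambda _ fun i => ?_
  fin_cases i
  · exact measurable_fst
  · exact measurable_snd

/-- The shear-and-scale map on pairs. -/
def shearT {n : ℕ} (d b : ℝ) (V : Tup n 2) : Tup n 2 := ![V 1, d • V 0 - b • V 1]

lemma measurable_shearT {n : ℕ} (d b : ℝ) : Measurable (shearT (n := n) d b) := by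
  refine measurable_pi_lambda _ fun i => ?_
  fin_cases i
  · exact measurable_pi_apply 1
  · exact ((measurable_pi_apply 0).const_smul d).sub ((measurable_pi_apply 1).const_smul b)

lemma volume_preimage_shearT {n : ℕ} {d : ℝ} (hd : 0 < d) (b : ℝ) {B : Set (Tup n 2)}
    (hB : MeasurableSet B) :
    volume (shearT d b ⁻¹' B) = ENNReal.ofReal ((d ^ n)⁻¹) * volume B := by
  rw [← lintegral_indicator_one (measurable_shearT d b hB), ← lintegral_indicator_one hB,
    lintegral_tup_two (measurable_indicator_one (measurable_shearT d b hB)),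
    lintegral_tup_two (measurable_indicator_one hB)]
  rw [lintegral_lintegral_swap (f := fun x y : Fin n → ℝ =>
    (shearT d b ⁻¹' B).indicator (1 : Tup n 2 → ℝ≥0∞) ![x, y])
    ((measurable_indicator_one (measurable_shearT d b hB)).comp measurable_cons_two).aemeasurable,
    ← lintegral_const_mul' _ _ ENNReal.ofReal_ne_top]
  refine lintegral_congr fun y => ?_
  have hm : Measurable fun x : Fin n → ℝ => B.indicator (1 : Tup n 2 → ℝ≥0∞) ![y, x - b • y] :=
    (measurable_indicator_one hB).comp
      (measurable_cons_two.comp (measurable_const.prodMk (measurable_id.sub_const _)))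
  have h1 := lintegral_comp_smul_vec hd hm
  rw [lintegral_sub_right_eq_self (fun x : Fin n → ℝ => B.indicator (1 : Tup n 2 → ℝ≥0∞) ![y, x])] at h1
  exact h1

lemma exists_shear_primT {n : ℕ} {p : Fin 2 → Fin n → ℤ} (hp : p ∈ PairT n) :
    ∃ (x : Σ d : ℕ, Fin (d + 1)) (r : Fin 2 → Fin n → ℤ), r ∈ PrimT n 2 ∧
      p = ![r 1, ((x.1 + 1 : ℕ) : ℤ) • r 0 - ((x.2 : ℕ) : ℤ) • r 1] := by
  obtain ⟨h0, h1, hl⟩ := hp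
  have h0' : (fun _ : Fin 1 => p 0) ∈ PrimT n 1 := mem_primT_one.mpr h0
  obtain ⟨q, d, b, hd, hb, hq, h⟩ := PrimT.exists_cons h0' (m₀ := p 1) fun a ha => by
      have h3 := Fintype.linearIndependent_iff.mp hl ![a 0, -1] (by
        rw [Fin.sum_univ_two, ha]
        simp) 1
      simp at h3
  have hb0 := hb 0
  refine ⟨⟨d - 1, ⟨(b 0).toNat, by omega⟩⟩, _, hq, ?_⟩
  funext i
  fin_cases i
  · rfl
  · have hd' : ((d - 1 + 1 : ℕ) : ℤ) = d := by rw [Nat.sub_add_cancel hd]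
    have hb' : (((b 0).toNat : ℕ) : ℤ) = b 0 := Int.toNat_of_nonneg hb0.1
    change p 1 = ((d - 1 + 1 : ℕ) : ℤ) • q - (((b 0).toNat : ℕ) : ℤ) • p 0
    rw [hd', hb', h]
    simp

lemma evalT_shear {n : ℕ} (g : SLR n) (d b : ℤ) (r : Fin 2 → Fin n → ℤ) :
    evalT g ![r 1, d • r 0 - b • r 1] = shearT d b (evalT g r) := by
  funext i
  fin_cases i
  · rfl
  · change vecOf n g (d • r 0 - b • r 1) = (d : ℝ) • vecOf n g (r 0) - (b : ℝ) • vecOf n g (r 1)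
    rw [vecOf_sub, vecOf_zsmul, vecOf_zsmul]

lemma nuT_pairT_closedBall_lt_top {n : ℕ} (hn : 3 ≤ n) {m : Measure (SLR n)}
    (hm : LatticeInvariant m) (ρ : ℝ) : nuT m (PairT n) (Metric.closedBall 0 ρ) < ∞ := by
  let e : Fin 2 ⊕ Fin (n - 2) ≃ Fin n := finSumFinEquiv.trans (finCongr (by omega))
  have := sigmaFinite_of_closedBall (nuT_primT_closedBall_lt_top hm (k := 2) (by omega))
  obtain ⟨c, hc, h⟩ := nuT_eq_volume e (by omega) hm (gammaInv_primT n 2)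
    fun p hp => PrimT.linearIndependent hp
  set B : Set (Tup n 2) := Metric.closedBall 0 ρ
  have hB : MeasurableSet B := measurableSet_closedBall
  have hex : ∀ p : PairT n, ∃ y : (Σ d : ℕ, Fin (d + 1)) × (Fin 2 → Fin n → ℤ), y.2 ∈ PrimT n 2 ∧
      p.1 = ![y.2 1, ((y.1.1 + 1 : ℕ) : ℤ) • y.2 0 - ((y.1.2 : ℕ) : ℤ) • y.2 1] := fun p => by
    obtain ⟨x, r, hr, hpr⟩ := exists_shear_primT p.2
    exact ⟨(x, r), hr, hpr⟩
  choose ι hι1 hι2 using hex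
  have hinj : Function.Injective ι := fun p q hpq => Subtype.ext (by rw [hι2, hι2, hpq])
  let S : (Σ d : ℕ, Fin (d + 1)) → Set (Tup n 2) := fun x =>
    shearT ((x.1 + 1 : ℕ) : ℤ) ((x.2 : ℕ) : ℤ) ⁻¹' B
  have hS : ∀ x, MeasurableSet (S x) := fun x => measurable_shearT _ _ hB
  have hpt : ∀ g, ∑' p : Fin 2 → Fin n → ℤ,
      (PairT n).indicator (fun p => B.indicator (1 : Tup n 2 → ℝ≥0∞) (evalT g p)) p
      ≤ ∑' x : Σ d : ℕ, Fin (d + 1), ∑' r : Fin 2 → Fin n → ℤ,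
        (PrimT n 2).indicator (fun r => (S x).indicator (1 : Tup n 2 → ℝ≥0∞) (evalT g r)) r := by
    intro g
    rw [← tsum_subtype, ← ENNReal.tsum_prod]
    refine le_trans (le_of_eq (tsum_congr fun p => ?_))
      (ENNReal.tsum_comp_le_tsum_of_injective hinj _)
    rw [Set.indicator_of_mem (hι1 p)]
    conv_lhs => rw [hι2 p, evalT_shear]
    rfl
  rw [nuT_apply m _ hB]
  refine (lintegral_mono hpt).trans_lt ?_
  rw [lintegral_tsum fun x => (measurable_tsum_evalT (PrimT n 2)
    (measurable_indicator_one (hS x))).aemeasurable]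
  simp only [← nuT_apply m (PrimT n 2) (hS _)]
  have hle : ∀ x : Σ d : ℕ, Fin (d + 1), nuT m (PrimT n 2) (S x)
      ≤ c * volume B * ENNReal.ofReal (((x.1 + 1 : ℝ) ^ n)⁻¹) := fun x => by
    rw [h _ (hS x)]
    refine (mul_le_mul_right (measure_mono Set.inter_subset_left) c).trans (le_of_eq ?_)
    simp only [S]
    rw [volume_preimage_shearT (by positivity) _ hB]
    push_cast
    ring
  refine (ENNReal.tsum_le_tsum hle).trans_lt ?_
  rw [ENNReal.tsum_mul_left, ENNReal.tsum_sigma']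
  refine ENNReal.mul_lt_top (ENNReal.mul_lt_top hc.lt_top (isCompact_closedBall _ _).measure_lt_top)
    (lt_of_eq_of_lt ?_ (zetaT_ne_top (n := n - 1) (by omega)).lt_top)
  rw [zetaT]
  refine tsum_congr fun d => ?_
  simp only
  rw [tsum_fintype, Finset.sum_const, Finset.card_univ, Fintype.card_fin, nsmul_eq_mul,
    ← ENNReal.ofReal_natCast, ← ENNReal.ofReal_mul (by positivity)]
  congr 1
  obtain ⟨k, rfl⟩ : ∃ k, n = k + 1 := ⟨n - 1, by omega⟩
  push_cast
  rw [pow_succ]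
  field_simp

lemma volume_compl_goodT_two {n l : ℕ} (hn : 2 ≤ n) (e : Fin 2 ⊕ Fin l ≃ Fin n) (hl : 0 < l) :
    (volume : Measure (Tup n 2)) (goodT e)ᶜ = 0 := by
  have : Nonempty (Fin n) := ⟨⟨0, by omega⟩⟩
  have hmg : MeasurableSet (goodT (n := n) e)ᶜ := (measurableSet_goodT e hl).compl
  rw [← lintegral_indicator_one hmg, lintegral_tup_two (measurable_indicator_one hmg),
    lintegral_eq_zero_iff' ]
  swap
  · exact (((measurable_indicator_one hmg).comp measurable_cons_two).lintegral_prod_right').aemeasurable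
  have h0 : ∀ᵐ x : Fin n → ℝ, x ≠ 0 := by
    rw [ae_iff]
    simp
  filter_upwards [h0] with x hx
  have hspan : volume (Submodule.span ℝ {x} : Set (Fin n → ℝ)) = 0 := by
    refine Measure.addHaar_submodule _ _ fun htop => ?_
    have h1 := finrank_span_singleton (K := ℝ) hx
    rw [htop, finrank_top, Module.finrank_fin_fun] at h1
    omega
  have h2 : ∫⁻ y : Fin n → ℝ, (Submodule.span ℝ {x} : Set (Fin n → ℝ)).indicator 1 y = 0 := by
    rw [lintegral_indicator_one (Submodule.closed_of_finiteDimensional _).measurableSet, hspan]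
  refine le_antisymm (le_trans (lintegral_mono fun y => ?_) h2.le) bot_le
  refine Set.indicator_apply_le' (fun hy => ?_) fun _ => bot_le
  suffices hmem : y ∈ (Submodule.span ℝ {x} : Set (Fin n → ℝ)) by
    rw [Set.indicator_of_mem hmem]
    exact le_rfl
  by_contra hns
  refine hy (mem_goodT_of_linearIndependent e ?_)
  rw [LinearIndependent.pair_iff' hx]
  intro a ha
  exact hns (Submodule.mem_span_singleton.mpr ⟨a, ha⟩)

lemma exists_lintegral_sieg_mul_sieg {n : ℕ} (hn : 3 ≤ n) {m : Measure (SLR n)}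
    (hm : LatticeInvariant m) {c : ℝ≥0∞} (hc : ∀ F : (Fin n → ℝ) → ℝ≥0∞, Measurable F →
      ∫⁻ g, sieg F g ∂m = c * ∫⁻ x, F x) :
    ∃ c₂ : ℝ≥0∞, c₂ ≠ ∞ ∧ ∀ F G : (Fin n → ℝ) → ℝ≥0∞, Measurable F → Measurable G →
      ∫⁻ g, sieg F g * sieg G g ∂m
        = c * (∫⁻ x, F x * (G x + G (-x))) + c₂ * ((∫⁻ x, F x) * ∫⁻ x, G x) := by
  let e : Fin 2 ⊕ Fin (n - 2) ≃ Fin n := finSumFinEquiv.trans (finCongr (by omega))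
  have hl : 0 < n - 2 := by omega
  have := sigmaFinite_of_closedBall (nuT_pairT_closedBall_lt_top hn hm)
  obtain ⟨c₂, hc₂, h⟩ := nuT_eq_volume e hl hm (gammaInv_pairT n) fun p hp => hp.2.2
  have hnull := volume_compl_goodT_two (by omega) e hl
  have hν : nuT m (PairT n) = c₂ • volume := by
    ext B hB
    rw [h B hB, measure_inter_conull hnull]
    rfl
  refine ⟨c₂, hc₂, fun F G hF hG => ?_⟩
  have hD : Measurable fun x : Fin n → ℝ => F x * (G x + G (-x)) :=
    hF.mul (hG.add (hG.comp measurable_neg))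
  have hP : Measurable fun V : Tup n 2 => F (V 0) * G (V 1) :=
    (hF.comp (measurable_pi_apply 0)).mul (hG.comp (measurable_pi_apply 1))
  simp only [sieg_mul_sieg]
  rw [lintegral_add_left (measurable_sieg hD), hc _ hD, ← lintegral_nuT m (PairT n) hP, hν,
    lintegral_smul_measure, lintegral_tup_two hP, smul_eq_mul]
  congr 2
  change ∫⁻ x : Fin n → ℝ, ∫⁻ y : Fin n → ℝ, F x * G y = _
  simp only [lintegral_const_mul _ hG]
  rw [lintegral_mul_const _ hF]

lemma pair_constant_le {n : ℕ} (hn : 2 ≤ n) {m : Measure (SLR n)} (hm : LatticeInvariant m)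
    {c c₂ : ℝ≥0∞} (hct : c ≠ ∞) (hc : ∀ F : (Fin n → ℝ) → ℝ≥0∞, Measurable F →
      ∫⁻ g, sieg F g ∂m = c * ∫⁻ x, F x) (hc₂t : c₂ ≠ ∞)
    (hc₂ : ∀ F G : (Fin n → ℝ) → ℝ≥0∞, Measurable F → Measurable G →
      ∫⁻ g, sieg F g * sieg G g ∂m
        = c * (∫⁻ x, F x * (G x + G (-x))) + c₂ * ((∫⁻ x, F x) * ∫⁻ x, G x)) :
    c₂ ≤ c * c := by
  have := hm.prob
  set β := volume (Metric.closedBall (0 : Fin n → ℝ) 1) with hβ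
  have hβ0 : β ≠ 0 := volume_closedBall_one_ne_zero
  have hβt : β ≠ ∞ := volume_closedBall_ne_top 1
  set D : Set (Fin n → ℝ) := Metric.closedBall 0 2 \ Metric.closedBall 0 1
  have hD : MeasurableSet D := measurableSet_closedBall.diff measurableSet_closedBall
  have hDt : volume D ≠ ∞ :=
    ((measure_mono Set.sdiff_subset).trans_lt (volume_closedBall_ne_top 2).lt_top).ne
  have hD0 : volume D ≠ 0 := by
    have hlt : β < volume (Metric.closedBall (0 : Fin n → ℝ) 2) := by
      rw [volume_closedBall_pi (by norm_num : (0 : ℝ) ≤ 2)]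
      calc β = 1 * β := (one_mul _).symm
        _ < ENNReal.ofReal 2 ^ n * β := by
          rw [ENNReal.mul_lt_mul_iff_left hβ0 hβt]
          exact one_lt_pow₀ (by simp) (by omega)
    intro h0
    have h1 := measure_sdiff_le_iff_le_add (μ := (volume : Measure (Fin n → ℝ)))
      (s := Metric.closedBall 0 1) (t := Metric.closedBall 0 2)
      measurableSet_closedBall.nullMeasurableSet
      (Metric.closedBall_subset_closedBall (by norm_num)) hβt (ε := 0)
    have h2 := h1.mp h0.le
    rw [add_zero] at h2
    exact absurd h2 (not_le.mpr hlt)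
  set f : (Fin n → ℝ) → ℝ≥0∞ := D.indicator 1
  have hf : Measurable f := measurable_indicator_one hD
  have hfint : ∫⁻ x, f x = volume D := lintegral_indicator_one hD
  let G : ℕ → ℕ → (Fin n → ℝ) → ℝ≥0∞ := fun R j x =>
    (Metric.closedBall (0 : Fin n → ℝ) R).indicator 1 ((j + 1 : ℝ) • x)
  have hG : ∀ R j, Measurable (G R j) := fun R j =>
    measurable_indicator_smul measurableSet_closedBall _
  have hexp : ∀ R : ℕ, ∫⁻ g, sieg f g * cnt (Metric.closedBall (0 : Fin n → ℝ) R) g ∂m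
      = c * volume D + ((∑' j, c * ∫⁻ x, f x * (G R j x + G R j (-x)))
        + c₂ * volume D * (zetaT n * ((R : ℝ≥0∞) ^ n * β))) := by
    intro R
    have hpt : ∀ g : SLR n, sieg f g * cnt (Metric.closedBall (0 : Fin n → ℝ) R) g
        = sieg f g + ∑' j, sieg f g * sieg (G R j) g := fun g => by
      rw [cnt_eq (Metric.mem_closedBall_self (Nat.cast_nonneg R)), mul_add, mul_one,
        ENNReal.tsum_mul_left]
    simp only [hpt]
    rw [lintegral_add_left (measurable_sieg hf), hc f hf, hfint]
    congr 1
    rw [lintegral_tsum (f := fun j g => sieg f g * sieg (G R j) g)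
      fun j => ((measurable_sieg hf).mul (measurable_sieg (hG R j))).aemeasurable]
    simp only [hc₂ f _ hf (hG R _), hfint]
    rw [ENNReal.tsum_add]
    congr 1
    simp only [← mul_assoc]
    rw [ENNReal.tsum_mul_left, tsum_lintegral_smul measurableSet_closedBall,
      volume_closedBall_pi (Nat.cast_nonneg R), ENNReal.ofReal_natCast]
    ring
  have hone : ∫⁻ g, sieg f g * cnt (Metric.closedBall (0 : Fin n → ℝ) 1) g ∂m ≠ ∞ := by
    have h1 := hexp 1
    rw [Nat.cast_one] at h1
    rw [h1]
    have h2 : ∀ j, c * ∫⁻ x, f x * (G 1 j x + G 1 j (-x)) = 0 := by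
      intro j
      rw [mul_eq_zero]
      right
      rw [lintegral_eq_zero_iff (f := fun x => f x * (G 1 j x + G 1 j (-x))) (hf.mul ((hG 1 j).add ((hG 1 j).comp measurable_neg)))]
      refine Eventually.of_forall fun x => ?_
      by_cases hx : x ∈ D
      · have hx1 : 1 < ‖x‖ := by
          have := hx.2
          rwa [mem_closedBall_zero_iff, not_le] at this
        have hnot : ∀ y : Fin n → ℝ, ‖y‖ = ‖x‖ → G 1 j y = 0 := by
          intro y hy
          refine Set.indicator_of_notMem ?_ _
          rw [mem_closedBall_zero_iff, norm_smul, hy, Nat.cast_one, not_le, Real.norm_eq_abs,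
            abs_of_pos (by positivity)]
          have : (0 : ℝ) ≤ j := Nat.cast_nonneg j
          nlinarith
        change f x * (G 1 j x + G 1 j (-x)) = 0
        rw [hnot x rfl, hnot (-x) (norm_neg x), add_zero, mul_zero]
      · change f x * _ = 0
        rw [show f x = 0 from Set.indicator_of_notMem hx _, zero_mul]
    simp only [h2, tsum_zero, zero_add, Nat.cast_one, one_pow, one_mul]
    exact ENNReal.add_ne_top.mpr ⟨ENNReal.mul_ne_top hct hDt,
      ENNReal.mul_ne_top (ENNReal.mul_ne_top hc₂t hDt)
        (ENNReal.mul_ne_top (zetaT_ne_top hn) hβt)⟩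
  have hlim := tendsto_lintegral_of_dominated_convergence (μ := m)
    (F := fun (R : ℕ) g => sieg f g *
      (cnt (Metric.closedBall (0 : Fin n → ℝ) (R + 1 : ℕ)) g / ((R + 1 : ℕ) : ℝ≥0∞) ^ n))
    (f := fun g => sieg f g * β)
    (fun g => 3 ^ n * (sieg f g * cnt (Metric.closedBall (0 : Fin n → ℝ) 1) g))
    (fun R => (measurable_sieg hf).mul ((measurable_cnt measurableSet_closedBall).div_const _))
    (fun R => Eventually.of_forall fun g => by
      change sieg f g * _ ≤ 3 ^ n * (sieg f g * _)
      rw [mul_left_comm]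
      refine mul_le_mul_right (ENNReal.div_le_of_le_mul ?_) _
      refine (cnt_closedBall_le (R + 1) g).trans ?_
      rw [mul_right_comm, ← mul_pow]
      refine mul_le_mul_left (pow_le_pow_left' ?_ n) _
      norm_cast
      omega)
    (by
      rw [lintegral_const_mul
        (f := fun g => sieg f g * cnt (Metric.closedBall (0 : Fin n → ℝ) 1) g) _
        ((measurable_sieg hf).mul (measurable_cnt measurableSet_closedBall))]
      exact ENNReal.mul_ne_top (ENNReal.pow_ne_top (by simp)) hone)
    (Eventually.of_forall fun g => by
      exact ENNReal.Tendsto.const_mul ((tendsto_cnt_div_pow g).comp (tendsto_add_atTop_nat 1))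
        (Or.inl hβ0))
  rw [lintegral_mul_const _ (measurable_sieg hf), hc f hf, hfint] at hlim
  have hle : c₂ * zetaT n * (volume D * β) ≤ c * (volume D * β) := by
    rw [← mul_assoc c]
    refine ge_of_tendsto' hlim fun R => ?_
    have hR0 : ((R + 1 : ℕ) : ℝ≥0∞) ^ n ≠ 0 := pow_ne_zero _ (by simp)
    have hRt : ((R + 1 : ℕ) : ℝ≥0∞) ^ n ≠ ∞ := ENNReal.pow_ne_top (ENNReal.natCast_ne_top _)
    simp only [← mul_div_assoc]
    simp only [div_eq_mul_inv]
    rw [lintegral_mul_const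
        (f := fun g => sieg f g * cnt (Metric.closedBall (0 : Fin n → ℝ) (R + 1 : ℕ)) g) _
        ((measurable_sieg hf).mul (measurable_cnt measurableSet_closedBall)),
      hexp, ← div_eq_mul_inv, ENNReal.le_div_iff_mul_le (Or.inl hR0) (Or.inl hRt)]
    refine le_trans (le_of_eq ?_) (le_add_self.trans le_add_self)
    ring
  have hle' : c₂ * zetaT n ≤ c :=
    (ENNReal.mul_le_mul_iff_left (mul_ne_zero hD0 hβ0) (ENNReal.mul_ne_top hDt hβt)).mp hle
  calc c₂ = c₂ * 1 := (mul_one _).symm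
    _ ≤ c₂ * (c * zetaT n) := mul_le_mul_right (one_le_mul_zetaT hn hm hc) _
    _ = c * (c₂ * zetaT n) := by ring
    _ ≤ c * c := mul_le_mul_right hle' _

/-- The second moment bound in dimension at least three. -/
theorem lintegral_sieg_sq_le_of_three_le {n : ℕ} (hn : 3 ≤ n) {m : Measure (SLR n)}
    (hm : LatticeInvariant m) {c : ℝ≥0∞} (hct : c ≠ ∞)
    (hc : ∀ F : (Fin n → ℝ) → ℝ≥0∞, Measurable F → ∫⁻ g, sieg F g ∂m = c * ∫⁻ x, F x)
    {K : Set (Fin n → ℝ)} (hK : MeasurableSet K) :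
    ∫⁻ g, sieg (K.indicator 1) g * sieg (K.indicator 1) g ∂m
      ≤ (c * volume K) * (c * volume K) + 4 * c * volume K := by
  obtain ⟨c₂, hc₂t, hc₂⟩ := exists_lintegral_sieg_mul_sieg hn hm hc
  have hle := pair_constant_le (by omega) hm hct hc hc₂t hc₂
  have hK1 : ∀ x, K.indicator (1 : (Fin n → ℝ) → ℝ≥0∞) x ≤ 1 := fun x =>
    Set.indicator_apply_le' (fun _ => le_rfl) fun _ => bot_le
  rw [hc₂ _ _ (measurable_indicator_one hK) (measurable_indicator_one hK),
    lintegral_indicator_one hK, add_comm]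
  refine add_le_add ?_ ?_
  · rw [mul_mul_mul_comm]
    exact mul_le_mul_left hle _
  · rw [mul_comm 4 c, mul_assoc]
    refine mul_le_mul_right ?_ c
    calc ∫⁻ x, K.indicator (1 : (Fin n → ℝ) → ℝ≥0∞) x * (K.indicator 1 x + K.indicator 1 (-x))
        ≤ ∫⁻ x, 4 * K.indicator (1 : (Fin n → ℝ) → ℝ≥0∞) x := by
          refine lintegral_mono fun x => ?_
          rw [mul_comm]
          refine mul_le_mul_left ((add_le_add (hK1 x) (hK1 (-x))).trans ?_) _
          norm_num
      _ = 4 * volume K := by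
          rw [lintegral_const_mul _ (measurable_indicator_one hK), lintegral_indicator_one hK]

/-- The lift to `SL(n, ℝ)` of the measure induced on the quotient by `SL(n, ℤ)`. -/
def unfoldedMeasure {n : ℕ} (m : Measure (SLR n)) : Measure (SLR n) :=
  Measure.sum fun γ : Matrix.SpecialLinearGroup (Fin n) ℤ => m.map fun g => g * intSL γ

instance countable_intSL (n : ℕ) : Countable (Matrix.SpecialLinearGroup (Fin n) ℤ) :=
  inferInstanceAs (Countable {A : Fin n → Fin n → ℤ // Matrix.det A = 1})

lemma measurable_mul_intSL {n : ℕ} (γ : Matrix.SpecialLinearGroup (Fin n) ℤ) :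
    Measurable fun g : SLR n => g * intSL γ := by
  have : Continuous fun g : SLR n => g * intSL γ := by fun_prop
  exact this.measurable

lemma lintegral_unfoldedMeasure {n : ℕ} (m : Measure (SLR n)) {Φ : SLR n → ℝ≥0∞} (hΦ : Measurable Φ) :
    ∫⁻ g, Φ g ∂(unfoldedMeasure m)
      = ∫⁻ g, ∑' γ : Matrix.SpecialLinearGroup (Fin n) ℤ, Φ (g * intSL γ) ∂m := by
  rw [unfoldedMeasure, lintegral_sum_measure, lintegral_tsum (f := fun γ g => Φ (g * intSL γ))
    fun γ => (hΦ.comp (measurable_mul_intSL γ)).aemeasurable]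
  exact tsum_congr fun γ => lintegral_map hΦ (measurable_mul_intSL γ)

lemma map_mul_left_unfoldedMeasure {n : ℕ} {m : Measure (SLR n)} (hm : LatticeInvariant m) (h : SLR n) :
    (unfoldedMeasure m).map (fun g => h * g) = unfoldedMeasure m := by
  have hmeas : Measurable fun g : SLR n => h * g := by
    have : Continuous fun g : SLR n => h * g := by fun_prop
    exact this.measurable
  refine Measure.ext_of_lintegral _ fun Φ hΦ => ?_
  rw [lintegral_map hΦ hmeas, lintegral_unfoldedMeasure (Φ := fun g => Φ (h * g)) m (hΦ.comp hmeas), lintegral_unfoldedMeasure m hΦ]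
  simp only [← mul_assoc]
  refine hm.inv (fun g => ∑' γ : Matrix.SpecialLinearGroup (Fin n) ℤ, Φ (g * intSL γ))
    (Measurable.tsum fun γ => hΦ.comp (measurable_mul_intSL γ)) (fun g δ => ?_) h
  simp only [mul_assoc, ← intSL_mul]
  exact (Equiv.mulLeft δ).tsum_eq fun γ => Φ (g * intSL γ)

lemma sigmaFinite_unfoldedMeasure {n : ℕ} {m : Measure (SLR n)} (hm : LatticeInvariant m) :
    SigmaFinite (unfoldedMeasure m) := by
  have := hm.prob
  obtain ⟨V, hVo, hVc, hV⟩ := exists_cover_intSL n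
  refine ⟨⟨⟨V, fun _ => trivial, fun i => ?_, hVc⟩⟩⟩
  rw [← lintegral_indicator_one (hVo i).measurableSet,
    lintegral_unfoldedMeasure m (measurable_indicator_one (hVo i).measurableSet)]
  refine lt_of_le_of_lt (b := ∫⁻ _, 1 ∂m) (lintegral_mono fun g => ?_) (by simp)
  by_cases h : ∃ δ : Matrix.SpecialLinearGroup (Fin n) ℤ, g * intSL δ ∈ V i
  · obtain ⟨δ, hδ⟩ := h
    refine (tsum_eq_single δ fun γ hγ => Set.indicator_of_notMem (fun hmem => hγ ?_) _).trans_le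
      (Set.indicator_apply_le' (fun _ => le_rfl) fun _ => bot_le)
    have := hV i _ hδ _ hmem (δ⁻¹ * γ) (by rw [mul_assoc, ← intSL_mul, mul_inv_cancel_left])
    rw [inv_mul_eq_one] at this
    exact this.symm
  · push Not at h
    refine (le_of_eq ?_).trans bot_le
    exact ENNReal.tsum_eq_zero.mpr fun γ => Set.indicator_of_notMem (h γ) _

/-- Unfolding over the quotient by `SL(n, ℤ)`. -/
lemma exists_lintegral_tsum_intSL {n k l : ℕ} (e : Fin k ⊕ Fin l ≃ Fin n) (hl : 0 < l)
    {m : Measure (SLR n)} (hm : LatticeInvariant m) :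
    ∃ c : ℝ≥0∞, c ≠ ∞ ∧ ∀ Φ : SLR n → ℝ≥0∞, Measurable Φ →
      ∫⁻ g, ∑' γ : Matrix.SpecialLinearGroup (Fin n) ℤ, Φ (g * intSL γ) ∂m
        = c * ∫⁻ g, Φ g ∂(indSL e hl volume) := by
  have := sigmaFinite_unfoldedMeasure hm
  obtain ⟨c, hc, h⟩ := eq_smul_indSL e hl (unfoldedMeasure m) (map_mul_left_unfoldedMeasure hm)
  refine ⟨c, hc, fun Φ hΦ => ?_⟩
  rw [← lintegral_unfoldedMeasure m hΦ, h, lintegral_smul_measure, smul_eq_mul]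

/-- The vector orthogonal to `v` spanning with `v` a parallelogram of area one. -/
def perpV (v : Fin 2 → ℝ) : Fin 2 → ℝ := (v 0 ^ 2 + v 1 ^ 2)⁻¹ • ![-v 1, v 0]

/-- The determinant of two plane vectors. -/
def detV (v w : Fin 2 → ℝ) : ℝ := v 0 * w 1 - v 1 * w 0

lemma sq_add_sq_pos {v : Fin 2 → ℝ} (hv : v ≠ 0) : 0 < v 0 ^ 2 + v 1 ^ 2 := by
  by_contra h
  apply hv
  funext i
  fin_cases i
  · change v 0 = 0
    nlinarith [sq_nonneg (v 0), sq_nonneg (v 1)]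
  · change v 1 = 0
    nlinarith [sq_nonneg (v 0), sq_nonneg (v 1)]

lemma detV_perpV {v : Fin 2 → ℝ} (hv : v ≠ 0) (s τ : ℝ) :
    detV v (s • perpV v + τ • v) = s := by
  have h := (sq_add_sq_pos hv).ne'
  simp only [detV, perpV, Pi.add_apply, Pi.smul_apply, smul_eq_mul, Matrix.cons_val_zero,
    Matrix.cons_val_one]
  field_simp
  ring

lemma measurable_perpV : Measurable perpV := by
  refine measurable_pi_lambda _ fun i => ?_
  fin_cases i
  · change Measurable fun v : Fin 2 → ℝ => (v 0 ^ 2 + v 1 ^ 2)⁻¹ * -v 1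
    fun_prop
  · change Measurable fun v : Fin 2 → ℝ => (v 0 ^ 2 + v 1 ^ 2)⁻¹ * v 0
    fun_prop

lemma lintegral_plane_eq {v : Fin 2 → ℝ} (hv : v ≠ 0) {φ : (Fin 2 → ℝ) → ℝ≥0∞}
    (hφ : Measurable φ) :
    ∫⁻ w, φ w = ∫⁻ s : ℝ, ∫⁻ τ : ℝ, φ (s • perpV v + τ • v) := by
  have h1 := detV_perpV hv 1 0
  rw [one_smul, zero_smul, add_zero, detV] at h1
  let g : SLR 2 := ⟨!![v 0, perpV v 0; v 1, perpV v 1], by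
    rw [Matrix.det_fin_two_of]; linarith⟩
  have hg := measurePreserving_mulVec g
  rw [← hg.lintegral_comp hφ]
  have h2 := (volume_preserving_finTwoArrow ℝ).symm
  have hmeas : Measurable fun w => φ ((g : Matrix (Fin 2) (Fin 2) ℝ).mulVec w) :=
    hφ.comp hg.measurable
  rw [← h2.lintegral_comp hmeas]
  refine (lintegral_prod_symm' (μ := (volume : Measure ℝ)) (ν := (volume : Measure ℝ)) _
    (hmeas.comp h2.measurable)).trans ?_
  refine lintegral_congr fun s => lintegral_congr fun τ => ?_
  refine congrArg φ ?_
  funext i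
  fin_cases i <;>
  simp [g, Matrix.mulVec, dotProduct, MeasurableEquiv.finTwoArrow, Fin.sum_univ_two] <;> ring

lemma lintegral_comp_mul_real {a : ℝ} (ha : 0 < a) {φ : ℝ → ℝ≥0∞} (hφ : Measurable φ) :
    ∫⁻ x, φ (a * x) = ENNReal.ofReal a⁻¹ * ∫⁻ x, φ x := by
  have h := Real.map_volume_mul_left ha.ne'
  rw [← lintegral_map hφ (measurable_const_mul a), h, lintegral_smul_measure,
    abs_of_pos (inv_pos.mpr ha), smul_eq_mul]

lemma lintegral_tup_one {n : ℕ} {φ : (Fin n → ℝ) → ℝ≥0∞} (hφ : Measurable φ) :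
    ∫⁻ V : Tup n 1, φ (V 0) = ∫⁻ v, φ v := by
  have := (volume_preserving_funUnique (Fin 1) (Fin n → ℝ)).lintegral_comp hφ
  rw [← this]
  rfl

/-- The columns of an element of `SL(n, ℝ)`. -/
def colV {n : ℕ} (g : SLR n) (j : Fin n) : Fin n → ℝ :=
  fun i => (g : Matrix (Fin n) (Fin n) ℝ) i j

lemma measurable_colV {n : ℕ} (j : Fin n) : Measurable fun g : SLR n => colV g j :=
  measurable_pi_lambda _ fun _ => measurable_SLR_entry _ _

lemma lintegral_detDom_plane {v : Fin 2 → ℝ} (hv : v ≠ 0) {φ : (Fin 2 → ℝ) → ℝ≥0∞}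
    (hφ : Measurable φ) :
    ∫⁻ w, {w | 0 < detV v w ∧ detV v w ≤ 1}.indicator (fun w => φ ((detV v w)⁻¹ • w)) w
      = (∫⁻ s in Set.Ioc (0 : ℝ) 1, ENNReal.ofReal s) * ∫⁻ τ : ℝ, φ (perpV v + τ • v) := by
  have hd : Measurable fun w : Fin 2 → ℝ => detV v w := by unfold detV; fun_prop
  have hS : MeasurableSet {w | 0 < detV v w ∧ detV v w ≤ 1} :=
    (measurableSet_lt measurable_const hd).inter (measurableSet_le hd measurable_const)
  have hφ' : Measurable fun w : Fin 2 → ℝ => φ ((detV v w)⁻¹ • w) :=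
    hφ.comp (hd.inv.smul measurable_id)
  rw [lintegral_plane_eq hv (hφ'.indicator hS),
    ← lintegral_mul_const _ (by fun_prop), ← lintegral_indicator measurableSet_Ioc]
  refine lintegral_congr fun s => ?_
  by_cases hs : s ∈ Set.Ioc (0 : ℝ) 1
  · rw [Set.indicator_of_mem hs]
    have hψ : Measurable fun τ : ℝ => φ (perpV v + τ • v) := by fun_prop
    have h := lintegral_comp_mul_real (inv_pos.mpr hs.1) hψ
    rw [inv_inv] at h
    rw [← h]
    refine lintegral_congr fun τ => ?_
    rw [Set.indicator_of_mem (by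
      rw [Set.mem_ofPred_eq, detV_perpV hv]; exact hs)]
    refine congrArg φ ?_
    rw [detV_perpV hv, smul_add, smul_smul, smul_smul, inv_mul_cancel₀ hs.1.ne', one_smul]
  · rw [Set.indicator_of_notMem hs, lintegral_eq_zero_of_ae_eq_zero]
    refine Eventually.of_forall fun τ => ?_
    refine Set.indicator_of_notMem ?_ _
    rw [Set.mem_ofPred_eq, detV_perpV hv]
    exact hs

/-- Unfolding over the modular group, in coordinates. -/
theorem exists_lintegral_tsum_plane {m : Measure (SLR 2)} (hm : LatticeInvariant m) :
    ∃ c : ℝ≥0∞, c ≠ ∞ ∧ ∀ Ψ : (Fin 2 → ℝ) → (Fin 2 → ℝ) → ℝ≥0∞,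
      Measurable (Function.uncurry Ψ) →
      ∫⁻ g, ∑' γ : Matrix.SpecialLinearGroup (Fin 2) ℤ,
        Ψ (colV (g * intSL γ) 0) (colV (g * intSL γ) 1) ∂m
        = c * ∫⁻ v, ∫⁻ τ : ℝ, Ψ v (perpV v + τ • v) := by
  let e : Fin 1 ⊕ Fin 1 ≃ Fin 2 := finSumFinEquiv
  obtain ⟨κ, hκ, h⟩ := exists_lintegral_tsum_intSL e one_pos hm
  refine ⟨κ * ∫⁻ s in Set.Ioc (0 : ℝ) 1, ENNReal.ofReal s, ?_, fun Ψ hΨ => ?_⟩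
  · refine ENNReal.mul_ne_top hκ (ne_of_lt ?_)
    calc ∫⁻ s in Set.Ioc (0 : ℝ) 1, ENNReal.ofReal s
        ≤ ∫⁻ s in Set.Ioc (0 : ℝ) 1, 1 := by
          refine setLIntegral_mono measurable_const fun s hs => ?_
          rw [ENNReal.ofReal_le_one]
          exact hs.2
      _ < ∞ := by simp
  · have hΦ : Measurable fun g : SLR 2 => Ψ (colV g 0) (colV g 1) :=
      hΨ.comp ((measurable_colV 0).prodMk (measurable_colV 1))
    rw [h _ hΦ, mul_assoc, lintegral_indSL e one_pos _ hΦ]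
    congr 1
    have hdet : ∀ V W : Tup 2 1, (colM e V W).det = detV (V 0) (W 0) := by
      intro V W
      rw [Matrix.det_fin_two, detV, mul_comm (V 0 1)]
      rfl
    have hD : Measurable fun p : (Fin 2 → ℝ) × (Fin 2 → ℝ) => detV p.1 p.2 := by
      unfold detV; fun_prop
    have hS : MeasurableSet {p : (Fin 2 → ℝ) × (Fin 2 → ℝ) |
        0 < detV p.1 p.2 ∧ detV p.1 p.2 ≤ 1} :=
      (measurableSet_lt measurable_const hD).inter (measurableSet_le hD measurable_const)
    have hind : ∀ V W : Tup 2 1, (detDom e).indicator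
        (fun p => Ψ (colV (toSL e one_pos p) 0) (colV (toSL e one_pos p) 1)) (V, W)
        = {p : (Fin 2 → ℝ) × (Fin 2 → ℝ) | 0 < detV p.1 p.2 ∧ detV p.1 p.2 ≤ 1}.indicator
          (fun p => Ψ p.1 ((detV p.1 p.2)⁻¹ • p.2)) (V 0, W 0) := by
      intro V W
      by_cases hp : (V, W) ∈ detDom e
      · have hp' := hp
        rw [detDom, Set.mem_ofPred_eq, hdet] at hp'
        rw [Set.indicator_of_mem hp, Set.indicator_of_mem (by exact hp')]
        have h1 := congrFun (colL_toSL e one_pos hp.1) 0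
        have h2 := congrFun (colR_toSL e one_pos hp.1) 0
        dsimp only at h1 h2
        rw [hdet, Nat.cast_one, div_one, Real.rpow_neg_one] at h2
        change Ψ (colL e (toSL e one_pos (V, W)) 0) (colR e (toSL e one_pos (V, W)) 0) = _
        rw [h1, h2]
        rfl
      · have hp' := hp
        rw [detDom, Set.mem_ofPred_eq, hdet] at hp'
        rw [Set.indicator_of_notMem hp, Set.indicator_of_notMem (by exact hp')]
    simp only [hind]
    have hmI := (show Measurable fun p : (Fin 2 → ℝ) × (Fin 2 → ℝ) =>
      Ψ p.1 ((detV p.1 p.2)⁻¹ • p.2) from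
        hΨ.comp (measurable_fst.prodMk (hD.inv.smul measurable_snd))).indicator hS
    have hT : ∀ v : Fin 2 → ℝ, ∫⁻ W : Tup 2 1,
        {p : (Fin 2 → ℝ) × (Fin 2 → ℝ) | 0 < detV p.1 p.2 ∧ detV p.1 p.2 ≤ 1}.indicator
          (fun p => Ψ p.1 ((detV p.1 p.2)⁻¹ • p.2)) (v, W 0)
        = ∫⁻ w, {p : (Fin 2 → ℝ) × (Fin 2 → ℝ) | 0 < detV p.1 p.2 ∧ detV p.1 p.2 ≤ 1}.indicator
          (fun p => Ψ p.1 ((detV p.1 p.2)⁻¹ • p.2)) (v, w) := fun v =>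
      lintegral_tup_one (hmI.comp measurable_prodMk_left)
    simp only [hT]
    rw [lintegral_tup_one (φ := fun v => ∫⁻ w,
      {p : (Fin 2 → ℝ) × (Fin 2 → ℝ) | 0 < detV p.1 p.2 ∧ detV p.1 p.2 ≤ 1}.indicator
        (fun p => Ψ p.1 ((detV p.1 p.2)⁻¹ • p.2)) (v, w)) hmI.lintegral_prod_right']
    have hτ : Measurable fun v : Fin 2 → ℝ => ∫⁻ τ : ℝ, Ψ v (perpV v + τ • v) := by
      refine Measurable.lintegral_prod_right' (f := fun p : (Fin 2 → ℝ) × ℝ =>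
        Ψ p.1 (perpV p.1 + p.2 • p.1)) ?_
      exact hΨ.comp (measurable_fst.prodMk
        ((measurable_perpV.comp measurable_fst).add (measurable_snd.smul measurable_fst)))
    rw [← lintegral_const_mul _ hτ]
    refine lintegral_congr_ae ?_
    have hne : ∀ᵐ v : Fin 2 → ℝ, v ≠ 0 := by
      rw [ae_iff]
      simp
    filter_upwards [hne] with v hv
    exact lintegral_detDom_plane hv (φ := Ψ v) (hΨ.comp measurable_prodMk_left)

/-- The columns of an element of `SL(n, ℤ)`. -/
def colZ {n : ℕ} (γ : Matrix.SpecialLinearGroup (Fin n) ℤ) (j : Fin n) : Fin n → ℤ :=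
  fun i => (γ : Matrix (Fin n) (Fin n) ℤ) i j

lemma colV_mul_intSL {n : ℕ} (g : SLR n) (γ : Matrix.SpecialLinearGroup (Fin n) ℤ) (j : Fin n) :
    colV (g * intSL γ) j = vecOf n g (colZ γ j) := by
  funext i
  simp [colV, vecOf, colZ, Matrix.SpecialLinearGroup.coe_mul, Matrix.mul_apply, Matrix.mulVec,
    dotProduct, intSL_apply]

lemma mem_primV_two {v : Fin 2 → ℤ} : v ∈ PrimV 2 ↔ IsCoprime (v 0) (v 1) := by
  constructor
  · intro hv
    have h0 := PrimV.ne_zero hv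
    have hg : (Int.gcd (v 0) (v 1) : ℤ) ≠ 0 := by
      intro h
      rw [Nat.cast_eq_zero, Int.gcd_eq_zero_iff] at h
      apply h0
      funext i
      fin_cases i
      · exact h.1
      · exact h.2
    have hgR : ((Int.gcd (v 0) (v 1) : ℤ) : ℝ) ≠ 0 := by exact_mod_cast hg
    obtain ⟨a, ha⟩ := Int.gcd_dvd_left (v 0) (v 1)
    obtain ⟨b, hb⟩ := Int.gcd_dvd_right (v 0) (v 1)
    obtain ⟨k, hk⟩ := hv ((Int.gcd (v 0) (v 1) : ℤ) : ℝ)⁻¹ ![a, b] (by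
      funext i
      fin_cases i
      · change _ * ((v 0 : ℤ) : ℝ) = ((a : ℤ) : ℝ)
        rw [inv_mul_eq_iff_eq_mul₀ hgR]
        exact_mod_cast ha
      · change _ * ((v 1 : ℤ) : ℝ) = ((b : ℤ) : ℝ)
        rw [inv_mul_eq_iff_eq_mul₀ hgR]
        exact_mod_cast hb)
    have hk1 := inv_mul_cancel₀ hgR
    rw [hk] at hk1
    have hk' : k * (Int.gcd (v 0) (v 1) : ℤ) = 1 := by exact_mod_cast hk1
    rw [Int.isCoprime_iff_gcd_eq_one]
    have := Int.eq_one_or_neg_one_of_mul_eq_one' hk'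
    omega
  · rintro ⟨x, y, h⟩ a m ham
    refine ⟨x * m 0 + y * m 1, ?_⟩
    have h0 : a * (v 0 : ℝ) = m 0 := congrFun ham 0
    have h1 : a * (v 1 : ℝ) = m 1 := congrFun ham 1
    have hR : (x : ℝ) * v 0 + y * v 1 = 1 := by exact_mod_cast h
    push_cast
    rw [← h0, ← h1]
    linear_combination (-a) * hR

lemma linearIndependent_castV_two {v w : Fin 2 → ℤ} (hv : v ≠ 0) :
    (LinearIndependent ℝ fun i => castV ((![v, w] : Fin 2 → Fin 2 → ℤ) i)) ↔
      v 0 * w 1 - v 1 * w 0 ≠ 0 := by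
  have hpair : (fun i => castV ((![v, w] : Fin 2 → Fin 2 → ℤ) i)) = ![castV v, castV w] := by
    funext i
    fin_cases i <;> rfl
  rw [hpair, LinearIndependent.pair_iff]
  constructor
  · intro h hdet
    have hR : (v 0 : ℝ) * w 1 - v 1 * w 0 = 0 := by exact_mod_cast hdet
    apply hv
    funext i
    fin_cases i
    · have := (h (w 0) (-v 0) (by
        funext i
        fin_cases i
        · change (w 0 : ℝ) * v 0 + -(v 0 : ℝ) * w 0 = 0
          ring
        · change (w 0 : ℝ) * v 1 + -(v 0 : ℝ) * w 1 = 0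
          linear_combination -hR)).2
      exact_mod_cast neg_eq_zero.mp this
    · have := (h (w 1) (-v 1) (by
        funext i
        fin_cases i
        · change (w 1 : ℝ) * v 0 + -(v 1 : ℝ) * w 0 = 0
          linear_combination hR
        · change (w 1 : ℝ) * v 1 + -(v 1 : ℝ) * w 1 = 0
          ring)).2
      exact_mod_cast neg_eq_zero.mp this
  · intro hdet s t h
    have hR : (v 0 : ℝ) * w 1 - v 1 * w 0 ≠ 0 := by exact_mod_cast hdet
    have h0 : s * (v 0 : ℝ) + t * w 0 = 0 := congrFun h 0
    have h1 : s * (v 1 : ℝ) + t * w 1 = 0 := congrFun h 1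
    refine ⟨?_, ?_⟩
    · refine (mul_eq_zero.mp (?_ : s * ((v 0 : ℝ) * w 1 - v 1 * w 0) = 0)).resolve_right hR
      linear_combination (w 1 : ℝ) * h0 - (w 0 : ℝ) * h1
    · refine (mul_eq_zero.mp (?_ : t * ((v 0 : ℝ) * w 1 - v 1 * w 0) = 0)).resolve_right hR
      linear_combination (v 0 : ℝ) * h1 - (v 1 : ℝ) * h0

/-- The pairs `(d, j)` with `0 ≤ j < d` and `j` prime to `d`. -/
def ResT : Set (ℕ × ℕ) := {q | 0 < q.1 ∧ q.2 < q.1 ∧ Nat.Coprime q.2 q.1}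

/-- A primitive pair in Hermite normal form. -/
def pairOf (γ : Matrix.SpecialLinearGroup (Fin 2) ℤ) (q : ℕ × ℕ) (u : ℤˣ) : Fin 2 → Fin 2 → ℤ :=
  ![colZ γ 0, (u : ℤ) • ((q.2 : ℤ) • colZ γ 0 + (q.1 : ℤ) • colZ γ 1)]

lemma det_colZ (γ : Matrix.SpecialLinearGroup (Fin 2) ℤ) :
    colZ γ 0 0 * colZ γ 1 1 - colZ γ 0 1 * colZ γ 1 0 = 1 := by
  have := γ.2
  rw [Matrix.det_fin_two] at this
  rw [← this]
  simp only [colZ]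
  ring

lemma pairOf_mem (γ : Matrix.SpecialLinearGroup (Fin 2) ℤ) {q : ℕ × ℕ} (hq : q ∈ ResT) (u : ℤˣ) :
    pairOf γ q u ∈ PairT 2 := by
  have hdet := det_colZ γ
  have hu : (u : ℤ) * u = 1 := Int.units_coe_mul_self u
  have h0 : colZ γ 0 ∈ PrimV 2 :=
    mem_primV_two.mpr ⟨colZ γ 1 1, -colZ γ 1 0, by linear_combination hdet⟩
  refine ⟨h0, ?_, ?_⟩
  · obtain ⟨x, y, hxy⟩ := Nat.isCoprime_iff_coprime.mpr hq.2.2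
    rw [mem_primV_two]
    refine ⟨u * (x * colZ γ 1 1 - y * colZ γ 0 1), u * (y * colZ γ 0 0 - x * colZ γ 1 0), ?_⟩
    change _ * ((u : ℤ) * ((q.2 : ℤ) * colZ γ 0 0 + (q.1 : ℤ) * colZ γ 1 0))
      + _ * ((u : ℤ) * ((q.2 : ℤ) * colZ γ 0 1 + (q.1 : ℤ) * colZ γ 1 1)) = 1
    linear_combination ((u : ℤ) * u) * (x * q.2 + y * q.1) * hdet + (x * q.2 + y * q.1) * hu + hxy
  · rw [pairOf, linearIndependent_castV_two (PrimV.ne_zero h0)]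
    change colZ γ 0 0 * ((u : ℤ) * ((q.2 : ℤ) * colZ γ 0 1 + (q.1 : ℤ) * colZ γ 1 1))
      - colZ γ 0 1 * ((u : ℤ) * ((q.2 : ℤ) * colZ γ 0 0 + (q.1 : ℤ) * colZ γ 1 0)) ≠ 0
    have : colZ γ 0 0 * ((u : ℤ) * ((q.2 : ℤ) * colZ γ 0 1 + (q.1 : ℤ) * colZ γ 1 1))
      - colZ γ 0 1 * ((u : ℤ) * ((q.2 : ℤ) * colZ γ 0 0 + (q.1 : ℤ) * colZ γ 1 0))
      = u * q.1 := by linear_combination (u : ℤ) * q.1 * hdet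
    rw [this]
    exact mul_ne_zero u.ne_zero (by exact_mod_cast hq.1.ne')

lemma pairOf_injective {γ γ' : Matrix.SpecialLinearGroup (Fin 2) ℤ} {q q' : ℕ × ℕ}
    (hq : q ∈ ResT) (hq' : q' ∈ ResT) {u u' : ℤˣ} (h : pairOf γ q u = pairOf γ' q' u') :
    γ = γ' ∧ q = q' ∧ u = u' := by
  have hdet := det_colZ γ
  have hdet' := det_colZ γ'
  have h0 : colZ γ 0 = colZ γ' 0 := congrFun h 0
  have h1 : (u : ℤ) • ((q.2 : ℤ) • colZ γ 0 + (q.1 : ℤ) • colZ γ 1)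
    = (u' : ℤ) • ((q'.2 : ℤ) • colZ γ' 0 + (q'.1 : ℤ) • colZ γ' 1) := congrFun h 1
  rw [← h0] at h1 hdet'
  have e0 : (u : ℤ) * ((q.2 : ℤ) * colZ γ 0 0 + (q.1 : ℤ) * colZ γ 1 0)
    = (u' : ℤ) * ((q'.2 : ℤ) * colZ γ 0 0 + (q'.1 : ℤ) * colZ γ' 1 0) := congrFun h1 0
  have e1 : (u : ℤ) * ((q.2 : ℤ) * colZ γ 0 1 + (q.1 : ℤ) * colZ γ 1 1)
    = (u' : ℤ) * ((q'.2 : ℤ) * colZ γ 0 1 + (q'.1 : ℤ) * colZ γ' 1 1) := congrFun h1 1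
  have hd : (u : ℤ) * q.1 = u' * q'.1 := by
    linear_combination colZ γ 0 0 * e1 - colZ γ 0 1 * e0 - (u : ℤ) * q.1 * hdet
      + (u' : ℤ) * q'.1 * hdet'
  have hq1 := hq.1
  have hq1' := hq'.1
  have huu : u = u' := by
    rcases Int.units_eq_one_or u with rfl | rfl <;> rcases Int.units_eq_one_or u' with rfl | rfl <;>
      first | rfl | (exfalso; simp at hd; omega)
  subst huu
  have hqq : q.1 = q'.1 := by exact_mod_cast mul_left_cancel₀ u.ne_zero hd
  have f0 := mul_left_cancel₀ u.ne_zero e0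
  have f1 := mul_left_cancel₀ u.ne_zero e1
  rw [← hqq] at f0 f1
  have hj : ((q.2 : ℤ) - q'.2) = q.1 * (colZ γ' 1 0 * colZ γ 1 1 - colZ γ' 1 1 * colZ γ 1 0) := by
    linear_combination colZ γ 1 1 * f0 - colZ γ 1 0 * f1 - ((q.2 : ℤ) - q'.2) * hdet
  have hj0 : (q.2 : ℤ) - q'.2 = 0 := by
    refine Int.eq_zero_of_abs_lt_dvd (m := q.1) ⟨_, hj⟩ ?_
    have a1 := hq.2.1
    have a2 := hq'.2.1
    rw [abs_lt]
    omega
  have hjj : q.2 = q'.2 := by omega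
  rw [hjj] at f0 f1
  have hne : (q.1 : ℤ) ≠ 0 := by exact_mod_cast hq1.ne'
  have g0 : colZ γ 1 0 = colZ γ' 1 0 := mul_left_cancel₀ hne (add_left_cancel f0)
  have g1 : colZ γ 1 1 = colZ γ' 1 1 := mul_left_cancel₀ hne (add_left_cancel f1)
  refine ⟨?_, Prod.ext hqq hjj, rfl⟩
  ext i j
  fin_cases i <;> fin_cases j
  · exact congrFun h0 0
  · exact g0
  · exact congrFun h0 1
  · exact g1

lemma exists_pairOf {p : Fin 2 → Fin 2 → ℤ} (hp : p ∈ PairT 2) :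
    ∃ γ, ∃ q ∈ ResT, ∃ u, pairOf γ q u = p := by
  obtain ⟨h0, h1, hlin⟩ := hp
  obtain ⟨v, w, rfl⟩ : ∃ v w, p = ![v, w] := ⟨p 0, p 1, by ext i j; fin_cases i <;> rfl⟩
  change v ∈ PrimV 2 at h0
  change w ∈ PrimV 2 at h1
  rw [linearIndependent_castV_two (PrimV.ne_zero h0)] at hlin
  obtain ⟨u, hu⟩ : ∃ u : ℤˣ, 0 < (u : ℤ) * (v 0 * w 1 - v 1 * w 0) := by
    rcases lt_or_gt_of_ne hlin with h | h
    · exact ⟨-1, by simpa using h⟩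
    · exact ⟨1, by simpa using h⟩
  have huu : (u : ℤ) * u = 1 := Int.units_coe_mul_self u
  obtain ⟨d, hd⟩ := Int.eq_ofNat_of_zero_le hu.le
  obtain ⟨x, y, hxy⟩ := mem_primV_two.mp h0
  set a : ℤ := u * (w 0 * x + w 1 * y) with ha
  have hdpos : (0 : ℤ) < d := by rw [← hd]; exact hu
  obtain ⟨j, hj⟩ := Int.eq_ofNat_of_zero_le (Int.emod_nonneg a hdpos.ne')
  have hjd : (j : ℤ) < d := by rw [← hj]; exact Int.emod_lt_of_pos a hdpos
  have hak : a = j + d * (a / d) := by rw [← hj]; exact (Int.emod_add_mul_ediv a d).symm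
  set k := a / (d : ℤ) with hk
  have hw0 : w 0 = u * (j * v 0 + d * (k * v 0 - y)) := by
    linear_combination (u : ℤ) * v 0 * hak - (u : ℤ) * v 0 * ha - (u : ℤ) * y * hd
      - w 0 * ((u : ℤ) * u) * hxy - w 0 * huu
  have hw1 : w 1 = u * (j * v 1 + d * (k * v 1 + x)) := by
    linear_combination (u : ℤ) * v 1 * hak - (u : ℤ) * v 1 * ha + (u : ℤ) * x * hd
      - w 1 * ((u : ℤ) * u) * hxy - w 1 * huu
  refine ⟨⟨!![v 0, k * v 0 - y; v 1, k * v 1 + x], ?_⟩, (d, j), ⟨?_, ?_, ?_⟩, u, ?_⟩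
  · rw [Matrix.det_fin_two_of]
    linear_combination hxy
  · exact_mod_cast hdpos
  · exact_mod_cast hjd
  · rw [← Nat.isCoprime_iff_coprime]
    obtain ⟨s, t, hst⟩ := mem_primV_two.mp h1
    refine ⟨u * (s * v 0 + t * v 1), u * (s * (k * v 0 - y) + t * (k * v 1 + x)), ?_⟩
    linear_combination hst - s * hw0 - t * hw1
  · ext i i'
    fin_cases i <;> fin_cases i'
    · rfl
    · rfl
    · exact hw0.symm
    · exact hw1.symm

lemma tsum_pairT_two (Ψ : (Fin 2 → Fin 2 → ℤ) → ℝ≥0∞) :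
    ∑' p, (PairT 2).indicator Ψ p
      = ∑' q : ResT, ∑' γ, (Ψ (pairOf γ q 1) + Ψ (pairOf γ q (-1))) := by
  have hinj : Function.Injective fun z : (ResT × Matrix.SpecialLinearGroup (Fin 2) ℤ) × ℤˣ =>
      pairOf z.1.2 z.1.1 z.2 := by
    rintro ⟨⟨q, γ⟩, u⟩ ⟨⟨q', γ'⟩, u'⟩ h
    obtain ⟨h1, h2, h3⟩ := pairOf_injective q.2 q'.2 h
    dsimp only at h1 h2 h3
    rw [h1, Subtype.ext h2, h3]
  have hrange : Set.range (fun z : (ResT × Matrix.SpecialLinearGroup (Fin 2) ℤ) × ℤˣ =>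
      pairOf z.1.2 z.1.1 z.2) = PairT 2 := by
    ext p
    constructor
    · rintro ⟨z, rfl⟩
      exact pairOf_mem _ z.1.1.2 _
    · intro hp
      obtain ⟨γ, q, hq, u, rfl⟩ := exists_pairOf hp
      exact ⟨((⟨q, hq⟩, γ), u), rfl⟩
  rw [← tsum_subtype, ← hrange, tsum_range _ hinj, ENNReal.tsum_prod', ENNReal.tsum_prod']
  refine tsum_congr fun q => tsum_congr fun γ => ?_
  rw [tsum_fintype]
  simp [UnitsInt.univ]

/-- The integral of `F v * (G w + G (-w))` over the pairs of plane vectors of determinant `s`. -/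
def pairInt (F G : (Fin 2 → ℝ) → ℝ≥0∞) (s : ℝ) : ℝ≥0∞ :=
  ∫⁻ v, ∫⁻ τ : ℝ, F v * (G (s • perpV v + τ • v) + G (-(s • perpV v + τ • v)))

lemma tsum_resT (a : ℕ → ℝ≥0∞) :
    ∑' q : ResT, a (q : ℕ × ℕ).1 = ∑' d : ℕ, (Nat.totient d : ℝ≥0∞) * a d := by
  classical
  rw [tsum_subtype ResT fun q => a q.1, ENNReal.tsum_prod']
  refine tsum_congr fun d => ?_
  have : ∀ j : ℕ, ResT.indicator (fun q => a q.1) (d, j)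
      = if j ∈ {j ∈ Finset.range d | d.Coprime j} then a d else 0 := by
    intro j
    rw [Set.indicator_apply]
    refine if_congr ?_ rfl rfl
    rw [Finset.mem_filter, Finset.mem_range, Nat.coprime_comm]
    constructor
    · exact fun h => h.2
    · exact fun h => ⟨h.1.pos, h⟩
  simp only [this]
  rw [tsum_eq_sum (s := {j ∈ Finset.range d | d.Coprime j}) fun j hj => if_neg hj,
    Finset.sum_ite_mem, Finset.inter_self, Finset.sum_const, ← Nat.totient_eq_card_coprime,
    nsmul_eq_mul]

lemma lintegral_shear_plane (v : Fin 2 → ℝ) {φ : (Fin 2 → ℝ) → ℝ≥0∞} (hφ : Measurable φ)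
    {d : ℕ} (hd : 0 < d) (j : ℕ) :
    ∫⁻ τ : ℝ, φ ((j : ℝ) • v + (d : ℝ) • (perpV v + τ • v))
      = ENNReal.ofReal (d : ℝ)⁻¹ * ∫⁻ τ : ℝ, φ ((d : ℝ) • perpV v + τ • v) := by
  have hd' : (0 : ℝ) < d := by exact_mod_cast hd
  have hψ : Measurable fun τ : ℝ => φ ((d : ℝ) • perpV v + ((j : ℝ) + τ) • v) := by fun_prop
  rw [← lintegral_add_left_eq_self (fun τ : ℝ => φ ((d : ℝ) • perpV v + τ • v)) (j : ℝ),
    ← lintegral_comp_mul_real hd' hψ]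
  refine lintegral_congr fun τ => congrArg φ ?_
  rw [smul_add, smul_smul, add_smul]
  abel

/-- The second moment of the primitive Siegel transform in dimension two. -/
theorem exists_lintegral_sieg_mul_sieg_two {m : Measure (SLR 2)} (hm : LatticeInvariant m)
    {c : ℝ≥0∞} (hc : ∀ F : (Fin 2 → ℝ) → ℝ≥0∞, Measurable F →
      ∫⁻ g, sieg F g ∂m = c * ∫⁻ x, F x) :
    ∃ c' ≤ c, ∀ F G : (Fin 2 → ℝ) → ℝ≥0∞, Measurable F → Measurable G →
      ∫⁻ g, sieg F g * sieg G g ∂m = c * (∫⁻ x, F x * (G x + G (-x)))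
        + c' * ∑' d : ℕ, (Nat.totient d : ℝ≥0∞) * (ENNReal.ofReal (d : ℝ)⁻¹ * pairInt F G d) := by
  obtain ⟨c', hc't, h⟩ := exists_lintegral_tsum_plane hm
  have hne : ∀ᵐ v : Fin 2 → ℝ, v ≠ 0 := by
    rw [ae_iff]
    simp
  refine ⟨c', ?_, fun F G hF hG => ?_⟩
  · set F : (Fin 2 → ℝ) → ℝ≥0∞ := (Metric.closedBall 0 1).indicator 1 with hFdef
    have hF : Measurable F := measurable_indicator_one measurableSet_closedBall
    let θ : (Fin 2 → ℝ) → (Fin 2 → ℝ) → ℝ := fun v w =>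
      (w 0 * v 0 + w 1 * v 1) * (v 0 ^ 2 + v 1 ^ 2)⁻¹
    have hθ : Measurable fun p : (Fin 2 → ℝ) × (Fin 2 → ℝ) => θ p.1 p.2 := by
      dsimp only [θ]
      fun_prop
    have hθS : MeasurableSet {p : (Fin 2 → ℝ) × (Fin 2 → ℝ) | θ p.1 p.2 ∈ Set.Ico (0 : ℝ) 1} :=
      hθ measurableSet_Ico
    have hθadd : ∀ v : Fin 2 → ℝ, v ≠ 0 → ∀ w (k : ℝ), θ v (w + k • v) = θ v w + k := by
      intro v hv w k
      have := (sq_add_sq_pos hv).ne'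
      simp only [θ, Pi.add_apply, Pi.smul_apply, smul_eq_mul]
      field_simp
      ring
    have h1 := h (fun v w => {p : (Fin 2 → ℝ) × (Fin 2 → ℝ) |
      θ p.1 p.2 ∈ Set.Ico (0 : ℝ) 1}.indicator (fun p => F p.1) (v, w))
      ((hF.comp measurable_fst).indicator hθS)
    have h2 : ∫⁻ v, ∫⁻ τ : ℝ, {p : (Fin 2 → ℝ) × (Fin 2 → ℝ) |
        θ p.1 p.2 ∈ Set.Ico (0 : ℝ) 1}.indicator (fun p => F p.1) (v, perpV v + τ • v)
        = ∫⁻ v, F v := by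
      refine lintegral_congr_ae ?_
      filter_upwards [hne] with v hv
      have h3 : ∀ τ : ℝ, {p : (Fin 2 → ℝ) × (Fin 2 → ℝ) |
        θ p.1 p.2 ∈ Set.Ico (0 : ℝ) 1}.indicator (fun p => F p.1) (v, perpV v + τ • v)
          = (Set.Ico (0 : ℝ) 1).indicator (fun _ => F v) τ := by
        intro τ
        have h0 : θ v (perpV v) = 0 := by
          simp only [θ, perpV, Pi.smul_apply, smul_eq_mul, Matrix.cons_val_zero,
            Matrix.cons_val_one]
          ring
        have h4 : θ v (perpV v + τ • v) = τ := by rw [hθadd v hv, h0, zero_add]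
        simp only [Set.indicator_apply, Set.mem_ofPred_eq, h4]
      simp only [h3]
      rw [lintegral_indicator measurableSet_Ico, setLIntegral_const]
      simp
    rw [h2] at h1
    have h3 : c' * ∫⁻ v, F v ≤ c * ∫⁻ v, F v := by
      rw [← h1, ← hc F hF]
      refine lintegral_mono fun g => ?_
      dsimp only
      let T : Set (Matrix.SpecialLinearGroup (Fin 2) ℤ) :=
        {γ | θ (colV (g * intSL γ) 0) (colV (g * intSL γ) 1) ∈ Set.Ico (0 : ℝ) 1}
      have hprim : ∀ γ : Matrix.SpecialLinearGroup (Fin 2) ℤ, colZ γ 0 ∈ PrimV 2 := fun γ =>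
        mem_primV_two.mpr ⟨colZ γ 1 1, -colZ γ 1 0, by linear_combination det_colZ γ⟩
      have hinj : Function.Injective fun γ : T => colZ (γ : Matrix.SpecialLinearGroup (Fin 2) ℤ) 0 := by
        rintro ⟨γ, hγ⟩ ⟨γ', hγ'⟩ heq
        dsimp only at heq
        have hdet := det_colZ γ
        have hdet' := det_colZ γ'
        rw [← heq] at hdet'
        have hcol : colZ γ' 1 = colZ γ 1
            + (colZ γ 1 1 * colZ γ' 1 0 - colZ γ 1 0 * colZ γ' 1 1) • colZ γ 0 := by
          funext i
          fin_cases i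
          · change colZ γ' 1 0 = colZ γ 1 0 + (_ - _) * colZ γ 0 0
            linear_combination (-colZ γ' 1 0) * hdet + colZ γ 1 0 * hdet'
          · change colZ γ' 1 1 = colZ γ 1 1 + (_ - _) * colZ γ 0 1
            linear_combination (-colZ γ' 1 1) * hdet + colZ γ 1 1 * hdet'
        set k := colZ γ 1 1 * colZ γ' 1 0 - colZ γ 1 0 * colZ γ' 1 1
        change θ _ _ ∈ Set.Ico (0 : ℝ) 1 at hγ
        change θ _ _ ∈ Set.Ico (0 : ℝ) 1 at hγ'
        simp only [colV_mul_intSL] at hγ hγ'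
        have hv0 : vecOf 2 g (colZ γ 0) ≠ 0 := by
          rw [ne_eq, vecOf_eq]
          intro h0
          have hu : IsUnit (g : Matrix (Fin 2) (Fin 2) ℝ) := by
            rw [Matrix.isUnit_iff_isUnit_det, g.2]
            exact isUnit_one
          have h5 := Matrix.mulVec_injective_of_isUnit hu (h0.trans (Matrix.mulVec_zero _).symm)
          exact PrimV.ne_zero (hprim γ) (castV_injective (h5.trans castV_zero.symm))
        rw [← heq, hcol, vecOf_eq g (_ + _), castV_add, castV_smul, Matrix.mulVec_add,
          Matrix.mulVec_smul, ← vecOf_eq, ← vecOf_eq, hθadd _ hv0] at hγ'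
        have hk0 : k = 0 := by
          have a1 : (k : ℝ) < 1 := by linarith [hγ.1, hγ'.2]
          have a2 : (-1 : ℝ) < k := by linarith [hγ.2, hγ'.1]
          have b1 : k < 1 := by exact_mod_cast a1
          have b2 : -1 < k := by exact_mod_cast a2
          omega
        rw [hk0, zero_smul, add_zero] at hcol
        refine Subtype.ext ?_
        ext i j
        fin_cases j
        · exact congrFun heq i
        · exact (congrFun hcol i).symm
      calc ∑' γ : Matrix.SpecialLinearGroup (Fin 2) ℤ, {p : (Fin 2 → ℝ) × (Fin 2 → ℝ) |
          θ p.1 p.2 ∈ Set.Ico (0 : ℝ) 1}.indicator (fun p => F p.1)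
            (colV (g * intSL γ) 0, colV (g * intSL γ) 1)
          = ∑' γ, T.indicator (fun γ => (PrimV 2).indicator (fun v => F (vecOf 2 g v))
              (colZ γ 0)) γ := by
            refine tsum_congr fun γ => ?_
            simp only [Set.indicator_apply]
            refine if_congr Iff.rfl ?_ rfl
            rw [Set.indicator_of_mem (hprim γ), colV_mul_intSL]
        _ = ∑' γ : T, (PrimV 2).indicator (fun v => F (vecOf 2 g v))
              (colZ (γ : Matrix.SpecialLinearGroup (Fin 2) ℤ) 0) := (tsum_subtype T _).symm
        _ ≤ sieg F g := ENNReal.tsum_comp_le_tsum_of_injective hinj _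
    have hFint : ∫⁻ v, F v = volume (Metric.closedBall (0 : Fin 2 → ℝ) 1) :=
      lintegral_indicator_one measurableSet_closedBall
    rw [hFint] at h3
    exact (ENNReal.mul_le_mul_iff_left volume_closedBall_one_ne_zero
      (volume_closedBall_ne_top 1)).mp h3
  · have hD : Measurable fun x : Fin 2 → ℝ => F x * (G x + G (-x)) :=
      hF.mul (hG.add (hG.comp measurable_neg))
    simp only [sieg_mul_sieg]
    rw [lintegral_add_left (measurable_sieg hD), hc _ hD]
    congr 1
    have hGs : Measurable fun x : Fin 2 → ℝ => G x + G (-x) := hG.add (hG.comp measurable_neg)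
    let Ψ : ResT → (Fin 2 → ℝ) → (Fin 2 → ℝ) → ℝ≥0∞ := fun q v w =>
      F v * (G (((q : ℕ × ℕ).2 : ℝ) • v + ((q : ℕ × ℕ).1 : ℝ) • w)
        + G (-(((q : ℕ × ℕ).2 : ℝ) • v + ((q : ℕ × ℕ).1 : ℝ) • w)))
    have hΨ : ∀ q, Measurable (Function.uncurry (Ψ q)) := by
      intro q
      refine (hF.comp measurable_fst).mul (hGs.comp
        (f := fun p : (Fin 2 → ℝ) × (Fin 2 → ℝ) =>
          ((q : ℕ × ℕ).2 : ℝ) • p.1 + ((q : ℕ × ℕ).1 : ℝ) • p.2) ?_)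
      fun_prop
    have hpt : ∀ g : SLR 2, ∑' p, (PairT 2).indicator
        (fun p => F (evalT g p 0) * G (evalT g p 1)) p
        = ∑' q : ResT, ∑' γ : Matrix.SpecialLinearGroup (Fin 2) ℤ,
          Ψ q (colV (g * intSL γ) 0) (colV (g * intSL γ) 1) := by
      intro g
      rw [tsum_pairT_two]
      refine tsum_congr fun q => tsum_congr fun γ => ?_
      have e0 : ∀ u, evalT g (pairOf γ q u) 0 = vecOf 2 g (colZ γ 0) := fun u => rfl
      have e1 : ∀ u : ℤˣ, evalT g (pairOf γ q u) 1
          = ((u : ℤ) : ℝ) • (((q : ℕ × ℕ).2 : ℝ) • vecOf 2 g (colZ γ 0)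
            + ((q : ℕ × ℕ).1 : ℝ) • vecOf 2 g (colZ γ 1)) := by
        intro u
        change vecOf 2 g ((u : ℤ) • (((q : ℕ × ℕ).2 : ℤ) • colZ γ 0
          + ((q : ℕ × ℕ).1 : ℤ) • colZ γ 1)) = _
        simp only [vecOf_eq, castV_smul, castV_add, Matrix.mulVec_add, Matrix.mulVec_smul,
          Int.cast_natCast]
      simp only [e0, e1, Ψ, colV_mul_intSL, mul_add]
      simp [add_comm]
    simp only [hpt]
    rw [lintegral_tsum (f := fun q g => ∑' γ : Matrix.SpecialLinearGroup (Fin 2) ℤ,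
      Ψ q (colV (g * intSL γ) 0) (colV (g * intSL γ) 1)) fun q => (Measurable.tsum fun γ =>
        (hΨ q).comp (((measurable_colV 0).comp (measurable_mul_intSL γ)).prodMk
          ((measurable_colV 1).comp (measurable_mul_intSL γ)))).aemeasurable]
    simp only [h _ (hΨ _)]
    rw [ENNReal.tsum_mul_left, ← tsum_resT fun d => ENNReal.ofReal (d : ℝ)⁻¹ * pairInt F G d]
    congr 1
    refine tsum_congr fun q => ?_
    have hin : ∀ v, ∫⁻ τ : ℝ, Ψ q v (perpV v + τ • v)
        = ENNReal.ofReal (((q : ℕ × ℕ).1 : ℝ))⁻¹ * ∫⁻ τ : ℝ, F v *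
          (G (((q : ℕ × ℕ).1 : ℝ) • perpV v + τ • v)
            + G (-(((q : ℕ × ℕ).1 : ℝ) • perpV v + τ • v))) := fun v =>
      lintegral_shear_plane v (φ := fun w => F v * (G w + G (-w))) (hGs.const_mul _) q.2.1 _
    simp only [hin]
    rw [lintegral_const_mul', pairInt]
    exact ENNReal.ofReal_ne_top

lemma sum_totient_div_mul_le (k : ℝ → ℝ) (hk : ∀ s, 0 ≤ k s) (ε : ℝ) (N M : ℕ) :
    ∑ j ∈ Finset.Icc 1 N, (1 / (j : ℝ)) * ∑ d ∈ Finset.Icc 1 M,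
      (Nat.totient d : ℝ) / d * k (ε * j * d) ≤
    ∑ n ∈ Finset.Icc 1 (N * M), k (ε * n) := by
  have h1 : ∑ j ∈ Finset.Icc 1 N, (1 / (j : ℝ)) * ∑ d ∈ Finset.Icc 1 M,
      (Nat.totient d : ℝ) / d * k (ε * j * d) =
      ∑ p ∈ Finset.Icc 1 N ×ˢ Finset.Icc 1 M,
        (Nat.totient p.2 : ℝ) / (p.1 * p.2 : ℕ) * k (ε * (p.1 * p.2 : ℕ)) := by
    rw [Finset.sum_product]
    refine Finset.sum_congr rfl fun j hj => ?_
    rw [Finset.mul_sum]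
    refine Finset.sum_congr rfl fun d hd => ?_
    push_cast
    rw [mul_assoc ε]
    have hj0 : (j : ℝ) ≠ 0 := by have := (Finset.mem_Icc.1 hj).1; positivity
    have hd0 : (d : ℝ) ≠ 0 := by have := (Finset.mem_Icc.1 hd).1; positivity
    field_simp
  have hmap : ∀ p ∈ Finset.Icc 1 N ×ˢ Finset.Icc 1 M, p.1 * p.2 ∈ Finset.Icc 1 (N * M) := by
    intro p hp
    simp only [Finset.mem_product, Finset.mem_Icc] at hp ⊢
    exact ⟨Nat.mul_pos hp.1.1 hp.2.1, Nat.mul_le_mul hp.1.2 hp.2.2⟩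
  rw [h1, ← Finset.sum_fiberwise_of_maps_to hmap]
  refine Finset.sum_le_sum fun n hn => ?_
  have hn1 : 1 ≤ n := (Finset.mem_Icc.1 hn).1
  have hn0 : (0 : ℝ) < n := by exact_mod_cast hn1
  set P := (Finset.Icc 1 N ×ˢ Finset.Icc 1 M).filter (fun p => p.1 * p.2 = n) with hP
  have h2 : ∑ p ∈ P, (Nat.totient p.2 : ℝ) / (p.1 * p.2 : ℕ) * k (ε * (p.1 * p.2 : ℕ)) =
      (∑ p ∈ P, (Nat.totient p.2 : ℝ)) / n * k (ε * n) := by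
    rw [Finset.sum_div, Finset.sum_mul]
    refine Finset.sum_congr rfl fun p hp => ?_
    rw [(Finset.mem_filter.1 hp).2]
  have h3 : ∑ p ∈ P, Nat.totient p.2 ≤ n := by
    have hinj : Set.InjOn (fun p : ℕ × ℕ => p.2) (P : Set (ℕ × ℕ)) := by
      intro p hp q hq hpq
      have hp2 := Finset.mem_filter.1 (Finset.mem_coe.1 hp)
      have hq2 := Finset.mem_filter.1 (Finset.mem_coe.1 hq)
      have hpos : 0 < p.2 := (Finset.mem_Icc.1 (Finset.mem_product.1 hp2.1).2).1
      have hpq' : p.2 = q.2 := hpq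
      refine Prod.ext (Nat.eq_of_mul_eq_mul_right hpos ?_) hpq
      rw [hp2.2, hpq', hq2.2]
    rw [← Finset.sum_image (f := fun d => Nat.totient d) hinj]
    calc _ ≤ ∑ d ∈ n.divisors, Nat.totient d := by
          refine Finset.sum_le_sum_of_subset fun d hd => ?_
          obtain ⟨p, hp, rfl⟩ := Finset.mem_image.1 hd
          exact Nat.mem_divisors.2 ⟨⟨p.1, by rw [mul_comm]; exact (Finset.mem_filter.1 hp).2.symm⟩,
            by omega⟩
      _ = n := Nat.sum_totient n
  rw [h2]
  have h4 : (∑ p ∈ P, (Nat.totient p.2 : ℝ)) / n ≤ 1 := by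
    rw [div_le_one hn0]; exact_mod_cast h3
  exact mul_le_of_le_one_left (hk _) h4

lemma le_sum_Icc_inv_sq_add (Z : ℝ) (hZ : HasSum (fun j : ℕ => (((j : ℝ) + 1) ^ 2)⁻¹) Z)
    {N : ℕ} (hN : N ≠ 0) : Z ≤ ∑ j ∈ Finset.Icc 1 N, ((j : ℝ) ^ 2)⁻¹ + (N : ℝ)⁻¹ := by
  refine le_of_tendsto hZ.tendsto_sum_nat ?_
  filter_upwards [eventually_ge_atTop N] with M hM
  have h1 : ∑ j ∈ Finset.range M, (((j : ℝ) + 1) ^ 2)⁻¹ = ∑ j ∈ Finset.Ioc 0 M, ((j : ℝ) ^ 2)⁻¹ := by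
    have := Finset.sum_Ico_add' (fun j : ℕ => ((j : ℝ) ^ 2)⁻¹) 0 M 1
    simp only [Nat.cast_add, Nat.cast_one] at this
    rw [Finset.range_eq_Ico, this]
    refine Finset.sum_congr ?_ fun _ _ => rfl
    ext i; simp only [Finset.mem_Ico, Finset.mem_Ioc]; omega
  have h2 := sum_Ioc_inv_sq_le_sub (α := ℝ) hN hM
  have h3 : ∑ j ∈ Finset.Ioc 0 M, ((j : ℝ) ^ 2)⁻¹ =
      ∑ j ∈ Finset.Ioc 0 N, ((j : ℝ) ^ 2)⁻¹ + ∑ j ∈ Finset.Ioc N M, ((j : ℝ) ^ 2)⁻¹ :=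
    (Finset.sum_Ioc_consecutive _ (Nat.zero_le _) hM).symm
  have h4 : (0 : ℝ) ≤ (M : ℝ)⁻¹ := by positivity
  have h5 : Finset.Icc 1 N = Finset.Ioc 0 N := by ext; simp [Nat.succ_le_iff]
  rw [h1, h3, h5]; linarith

/-- A convexity inequality for `c' Σ φ(d) / d k(x d) - P / x` forces a bound at `x = 1`. -/
lemma le_of_convexity_totient {k T : ℝ → ℝ} {S c c' Z Q O D : ℝ} (hk : ∀ s, 0 ≤ k s) (hS : 1 ≤ S)
    (hT : ∀ x, 0 < x → ∀ M : ℕ, S ≤ x * M →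
      T x = ∑ d ∈ Finset.Icc 1 M, (Nat.totient d : ℝ) / d * k (x * d))
    (hkS : ∀ s, S ≤ s → k s = 0)
    (hZ : HasSum (fun j : ℕ => (((j : ℝ) + 1) ^ 2)⁻¹) Z) (hcZ : 1 ≤ c * Z) (hc : 0 ≤ c)
    (hc' : 0 ≤ c') (hc'c : c' ≤ c) (hQ : 0 ≤ Q)
    (hsum : ∀ ε, 0 < ε → ε ≤ 1 → ∀ M : ℕ, ∑ n ∈ Finset.Icc 1 M, k (ε * n) ≤ Q / ε + O)
    (hconv : ∀ b, 0 < b → 2 * (c' * T 1 - c ^ 2 * Q) ≤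
      D + (c' * T b - c ^ 2 * Q / b) + (c' * T b⁻¹ - c ^ 2 * Q / b⁻¹)) :
    c' * T 1 - c ^ 2 * Q ≤ D / 2 := by
  set X := 2 * (c' * T 1 - c ^ 2 * Q) - D with hX
  suffices hX0 : X ≤ 0 by linarith
  have hS0 : 0 < S := by linarith
  have key : ∀ N : ℕ, N ≠ 0 → X * ∑ j ∈ Finset.Icc 1 N, 1 / (j : ℝ) ≤ c' * O + c ^ 2 * Q * S := by
    intro N hN
    have hN0 : (0 : ℝ) < N := by positivity
    have hN1 : (1 : ℝ) ≤ N := by exact_mod_cast Nat.one_le_iff_ne_zero.2 hN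
    set ε : ℝ := 1 / (S * N) with hε
    have hε0 : 0 < ε := by positivity
    have hε1 : ε ≤ 1 := by
      rw [hε, div_le_one (by positivity)]; nlinarith
    obtain ⟨M, hM⟩ := exists_nat_ge (S / ε)
    have hM' : S ≤ ε * M := by rwa [div_le_iff₀' hε0] at hM
    have hterm : ∀ j ∈ Finset.Icc 1 N, X * (1 / (j : ℝ)) ≤
        c' * ((1 / (j : ℝ)) * ∑ d ∈ Finset.Icc 1 M, (Nat.totient d : ℝ) / d * k (ε * j * d)) -
          c ^ 2 * Q / ε * ((j : ℝ) ^ 2)⁻¹ := by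
      intro j hj
      obtain ⟨hj1, hjN⟩ := Finset.mem_Icc.1 hj
      have hj1' : (1 : ℝ) ≤ j := by exact_mod_cast hj1
      have hjN' : (j : ℝ) ≤ N := by exact_mod_cast hjN
      have hj0 : (0 : ℝ) < j := by linarith
      have hb0 : 0 < ε * j := by positivity
      have h1 := hconv (ε * j) hb0
      have hT1 : T (ε * j) = ∑ d ∈ Finset.Icc 1 M, (Nat.totient d : ℝ) / d * k (ε * j * d) := by
        refine hT _ hb0 M (hM'.trans ?_)
        have : (0 : ℝ) ≤ M := by positivity
        nlinarith [mul_nonneg hε0.le this]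
      have hbS : S ≤ (ε * j)⁻¹ := by
        rw [le_inv_comm₀ hS0 hb0, hε, div_mul_eq_mul_div, one_mul, div_le_iff₀ (by positivity)]
        rw [← mul_assoc, inv_mul_cancel₀ hS0.ne', one_mul]; exact hjN'
      have hT2 : T (ε * j)⁻¹ = 0 := by
        rw [hT _ (inv_pos.2 hb0) 1 (by simpa using hbS)]
        rw [Finset.Icc_self, Finset.sum_singleton, Nat.cast_one, mul_one, hkS _ hbS, mul_zero]
      have h2 : 0 ≤ c ^ 2 * Q / (ε * j)⁻¹ := by positivity
      have h3 : X ≤ c' * T (ε * j) - c ^ 2 * Q / (ε * j) := by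
        rw [hT2] at h1; linarith
      rw [← hT1]
      calc X * (1 / (j : ℝ)) ≤ (c' * T (ε * j) - c ^ 2 * Q / (ε * j)) * (1 / (j : ℝ)) :=
            mul_le_mul_of_nonneg_right h3 (by positivity)
        _ = _ := by field_simp
    have hs := Finset.sum_le_sum hterm
    rw [← Finset.mul_sum, Finset.sum_sub_distrib, ← Finset.mul_sum, ← Finset.mul_sum] at hs
    have h5 := (sum_totient_div_mul_le k hk ε N M).trans (hsum ε hε0 hε1 (N * M))
    have h6 := le_sum_Icc_inv_sq_add Z hZ hN
    have h7 := mul_le_mul_of_nonneg_left h5 hc'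
    have hA : 0 ≤ c ^ 2 * Q / ε := by positivity
    have h8 := mul_le_mul_of_nonneg_left h6 hA
    have h9 : c ^ 2 * Q / ε * (N : ℝ)⁻¹ = c ^ 2 * Q * S := by
      rw [hε]; field_simp
    have h10 : c' * (Q / ε) ≤ c ^ 2 * Q / ε * Z := by
      have : c' ≤ c ^ 2 * Z := by nlinarith
      have hQε : 0 ≤ Q / ε := by positivity
      calc c' * (Q / ε) ≤ c ^ 2 * Z * (Q / ε) := mul_le_mul_of_nonneg_right this hQε
        _ = _ := by ring
    rw [mul_add, h9] at h8
    linarith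
  by_contra! hpos
  have hdiv := Real.tendsto_sum_range_one_div_nat_succ_atTop
  obtain ⟨N, hN, hN0⟩ := ((hdiv.eventually_gt_atTop ((c' * O + c ^ 2 * Q * S) / X)).and
    (eventually_ne_atTop 0)).exists
  have h1 : ∑ j ∈ Finset.Icc 1 N, 1 / (j : ℝ) = ∑ j ∈ Finset.range N, 1 / ((j : ℝ) + 1) := by
    have := Finset.sum_Ico_add' (fun j : ℕ => 1 / (j : ℝ)) 0 N 1
    rw [Finset.range_eq_Ico]
    simp only [Nat.cast_add, Nat.cast_one] at this
    rw [this]; rfl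
  have h2 := key N hN0
  rw [h1] at h2
  rw [div_lt_iff₀ hpos] at hN
  linarith

lemma detV_sub_le {v w : Fin 2 → ℝ} {R : ℝ} (hv : ‖v‖ ≤ R) (hw : ‖w‖ ≤ R) :
    |detV v w| ≤ 2 * R ^ 2 := by
  have hR : 0 ≤ R := (norm_nonneg v).trans hv
  have h := fun i => (norm_le_pi_norm v i).trans hv
  have h' := fun i => (norm_le_pi_norm w i).trans hw
  simp only [Real.norm_eq_abs] at h h'
  have h1 : |v 0 * w 1| ≤ R * R := by
    rw [abs_mul]; exact mul_le_mul (h 0) (h' 1) (abs_nonneg _) hR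
  have h2 : |v 1 * w 0| ≤ R * R := by
    rw [abs_mul]; exact mul_le_mul (h 1) (h' 0) (abs_nonneg _) hR
  calc |detV v w| ≤ |v 0 * w 1| + |v 1 * w 0| := abs_sub _ _
    _ ≤ _ := by nlinarith

lemma sq_norm_le_sq_add_sq (v : Fin 2 → ℝ) : ‖v‖ ^ 2 ≤ v 0 ^ 2 + v 1 ^ 2 := by
  have h : ‖v‖ ≤ Real.sqrt (v 0 ^ 2 + v 1 ^ 2) := by
    refine (pi_norm_le_iff_of_nonneg (Real.sqrt_nonneg _)).2 fun i => ?_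
    refine Real.abs_le_sqrt ?_
    fin_cases i
    · exact le_add_of_nonneg_right (sq_nonneg _)
    · exact le_add_of_nonneg_left (sq_nonneg _)
  calc ‖v‖ ^ 2 ≤ Real.sqrt (v 0 ^ 2 + v 1 ^ 2) ^ 2 := pow_le_pow_left₀ (norm_nonneg v) h 2
    _ = _ := Real.sq_sqrt (by positivity)

lemma norm_perpV_le {v : Fin 2 → ℝ} {r R : ℝ} (hr : 0 < r) (hv : r ≤ ‖v‖) (hvR : ‖v‖ ≤ R) :
    ‖perpV v‖ ≤ R / r ^ 2 := by
  have h0 : r ^ 2 ≤ v 0 ^ 2 + v 1 ^ 2 :=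
    (pow_le_pow_left₀ hr.le hv 2).trans (sq_norm_le_sq_add_sq v)
  have hR : 0 ≤ R := (norm_nonneg v).trans hvR
  have h1 : ‖(![-v 1, v 0] : Fin 2 → ℝ)‖ ≤ R := by
    refine (pi_norm_le_iff_of_nonneg hR).2 fun i => ?_
    fin_cases i
    · simpa using (norm_le_pi_norm v 1).trans hvR
    · simpa using (norm_le_pi_norm v 0).trans hvR
  rw [perpV, norm_smul, norm_inv, Real.norm_of_nonneg (by positivity), div_eq_inv_mul]
  exact mul_le_mul (inv_anti₀ (by positivity) h0) h1 (norm_nonneg _) (by positivity)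

lemma abs_coeff_le {v : Fin 2 → ℝ} {r R s τ : ℝ} (hr : 0 < r) (hv : r ≤ ‖v‖) (hvR : ‖v‖ ≤ R)
    (hw : ‖s • perpV v + τ • v‖ ≤ R) : |τ| ≤ 2 * R ^ 2 / r ^ 2 := by
  have h0 : r ^ 2 ≤ v 0 ^ 2 + v 1 ^ 2 :=
    (pow_le_pow_left₀ hr.le hv 2).trans (sq_norm_le_sq_add_sq v)
  have h1 : ‖(![-v 1, v 0] : Fin 2 → ℝ)‖ ≤ R := by
    refine (pi_norm_le_iff_of_nonneg ((norm_nonneg v).trans hvR)).2 fun i => ?_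
    fin_cases i
    · simpa using (norm_le_pi_norm v 1).trans hvR
    · simpa using (norm_le_pi_norm v 0).trans hvR
  have h2 := detV_sub_le hw h1
  have h3 : detV (s • perpV v + τ • v) ![-v 1, v 0] = τ * (v 0 ^ 2 + v 1 ^ 2) := by
    simp [detV, perpV]; ring
  rw [h3, abs_mul, abs_of_nonneg (a := v 0 ^ 2 + v 1 ^ 2) (by positivity)] at h2
  rw [le_div_iff₀ (by positivity)]
  exact (mul_le_mul_of_nonneg_left h0 (abs_nonneg τ)).trans h2

lemma pairInt_eq_zero {F G : (Fin 2 → ℝ) → ℝ≥0∞} {R s : ℝ} (hF : ∀ v, F v ≠ 0 → v ≠ 0 ∧ ‖v‖ ≤ R)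
    (hG : ∀ v, G v ≠ 0 → ‖v‖ ≤ R) (hs : 2 * R ^ 2 < s) : pairInt F G s = 0 := by
  have h : ∀ v, ∀ τ : ℝ,
      F v * (G (s • perpV v + τ • v) + G (-(s • perpV v + τ • v))) = 0 := by
    intro v τ
    by_cases hFv : F v = 0
    · rw [hFv, zero_mul]
    obtain ⟨hv0, hvR⟩ := hF v hFv
    have key : ¬ ‖s • perpV v + τ • v‖ ≤ R := by
      intro hw
      have := detV_sub_le hvR hw
      rw [detV_perpV hv0] at this
      linarith [le_abs_self s]
    have h1 : G (s • perpV v + τ • v) = 0 := by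
      by_contra h; exact key (hG _ h)
    have h2 : G (-(s • perpV v + τ • v)) = 0 := by
      by_contra h; exact key (by simpa only [norm_neg] using hG _ h)
    rw [h1, h2, add_zero, mul_zero]
  simp only [pairInt, h, lintegral_zero]

lemma coe_le_add_of_lipschitz {E : Type*} [SeminormedAddCommGroup E] {L : NNReal} {φ : E → NNReal}
    (hφ : LipschitzWith L φ) (x y : E) :
    (φ x : ℝ≥0∞) ≤ φ y + ENNReal.ofReal (L * ‖x - y‖) := by
  have h := hφ.dist_le_mul x y
  rw [NNReal.dist_eq, dist_eq_norm] at h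
  have h1 : (φ x : ℝ) ≤ φ y + L * ‖x - y‖ := by linarith [le_abs_self ((φ x : ℝ) - φ y)]
  rw [← ENNReal.ofReal_coe_nnreal, ← ENNReal.ofReal_coe_nnreal (p := φ y),
    ← ENNReal.ofReal_add (by positivity) (by positivity)]
  exact ENNReal.ofReal_le_ofReal h1

lemma exists_pairInt_le_add {L : NNReal} {φ : (Fin 2 → ℝ) → NNReal} (hL : LipschitzWith L φ)
    (h1 : ∀ v, φ v ≤ 1) {r R : ℝ} (hr : 0 < r) (hR : ∀ v, φ v ≠ 0 → r ≤ ‖v‖ ∧ ‖v‖ ≤ R) :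
    ∃ C : ℝ, 0 ≤ C ∧ ∀ s s', pairInt (fun v => φ v) (fun v => φ v) s ≤
      pairInt (fun v => φ v) (fun v => φ v) s' + ENNReal.ofReal (C * |s - s'|) := by
  classical
  set B := Metric.closedBall (0 : Fin 2 → ℝ) R with hB
  set T := 2 * R ^ 2 / r ^ 2 with hT
  have hBfin : volume B ≠ ∞ := measure_closedBall_lt_top.ne
  refine ⟨(volume B).toReal * (2 * T) * (2 * (L * (|R| / r ^ 2))), by positivity, fun s s' => ?_⟩
  set e := ENNReal.ofReal (2 * (L * (|R| / r ^ 2)) * |s - s'|) with he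
  have key : ∀ v, ∀ τ : ℝ,
      (φ v : ℝ≥0∞) * (φ (s • perpV v + τ • v) + φ (-(s • perpV v + τ • v))) ≤
      (φ v : ℝ≥0∞) * (φ (s' • perpV v + τ • v) + φ (-(s' • perpV v + τ • v))) +
        B.indicator (fun _ => (Set.Icc (-T) T).indicator (fun _ => e) τ) v := by
    intro v τ
    by_cases hφv : φ v = 0
    · rw [hφv, ENNReal.coe_zero, zero_mul]; exact bot_le
    obtain ⟨hvr, hvR⟩ := hR v hφv
    have hvB : v ∈ B := by rw [hB, mem_closedBall_zero_iff]; exact hvR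
    rw [Set.indicator_of_mem hvB]
    by_cases hτ : τ ∈ Set.Icc (-T) T
    · rw [Set.indicator_of_mem hτ]
      have hp : ‖perpV v‖ ≤ |R| / r ^ 2 :=
        norm_perpV_le hr hvr (hvR.trans (le_abs_self R))
      have hb : ∀ x y : Fin 2 → ℝ, ‖x - y‖ ≤ |s - s'| * ‖perpV v‖ →
          (φ x : ℝ≥0∞) ≤ φ y + ENNReal.ofReal (L * (|R| / r ^ 2) * |s - s'|) := by
        intro x y hxy
        refine (coe_le_add_of_lipschitz hL x y).trans ?_
        refine add_le_add le_rfl (ENNReal.ofReal_le_ofReal ?_)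
        rw [mul_assoc]
        refine mul_le_mul_of_nonneg_left (hxy.trans ?_) (by positivity)
        rw [mul_comm]
        exact mul_le_mul_of_nonneg_right hp (abs_nonneg _)
      have e1 := hb (s • perpV v + τ • v) (s' • perpV v + τ • v) (by
        rw [add_sub_add_right_eq_sub, ← sub_smul, norm_smul, Real.norm_eq_abs])
      have e2 := hb (-(s • perpV v + τ • v)) (-(s' • perpV v + τ • v)) (by
        rw [neg_sub_neg, add_sub_add_right_eq_sub, ← sub_smul, norm_smul, Real.norm_eq_abs,
          abs_sub_comm])
      have e3 : e = ENNReal.ofReal (L * (|R| / r ^ 2) * |s - s'|) +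
          ENNReal.ofReal (L * (|R| / r ^ 2) * |s - s'|) := by
        rw [he, ← ENNReal.ofReal_add (by positivity) (by positivity)]; congr 1; ring
      have hv1 : (φ v : ℝ≥0∞) ≤ 1 := by exact_mod_cast h1 v
      calc _ ≤ (φ v : ℝ≥0∞) * ((φ (s' • perpV v + τ • v) + φ (-(s' • perpV v + τ • v))) + e) := by
            refine mul_le_mul_right ?_ _
            rw [e3, add_add_add_comm]
            exact add_le_add e1 e2
        _ ≤ _ := by
            rw [mul_add]
            gcongr
            exact mul_le_of_le_one_left bot_le hv1
    · have hw : ∀ w, ‖w‖ = ‖s • perpV v + τ • v‖ → φ w = 0 := by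
        intro w hww
        by_contra hne
        exact hτ (abs_le.1 (abs_coeff_le hr hvr hvR (hww ▸ (hR w hne).2)))
      rw [hw _ rfl, hw _ (norm_neg _), ENNReal.coe_zero, add_zero, mul_zero]
      exact bot_le
  have hInt : ∫⁻ v, ∫⁻ τ : ℝ, B.indicator (fun _ => (Set.Icc (-T) T).indicator (fun _ => e) τ) v =
      ENNReal.ofReal ((volume B).toReal * (2 * T) * (2 * (L * (|R| / r ^ 2))) * |s - s'|) := by
    have h : ∀ v, ∫⁻ τ : ℝ, B.indicator (fun _ => (Set.Icc (-T) T).indicator (fun _ => e) τ) v =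
        B.indicator (fun _ => e * ENNReal.ofReal (2 * T)) v := by
      intro v
      by_cases hv : v ∈ B
      · simp only [Set.indicator_of_mem hv]
        rw [lintegral_indicator_const measurableSet_Icc, Real.volume_Icc]
        ring_nf
      · simp only [Set.indicator_of_notMem hv, lintegral_zero]
    simp only [h]
    rw [lintegral_indicator_const Metric.isClosed_closedBall.measurableSet, he,
      ← ENNReal.ofReal_toReal hBfin, ← ENNReal.ofReal_mul (by positivity),
      ← ENNReal.ofReal_mul (by positivity), ENNReal.toReal_ofReal (by positivity)]
    congr 1; ring
  have hmeas : ∀ v, Measurable fun τ : ℝ =>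
      B.indicator (fun _ => (Set.Icc (-T) T).indicator (fun _ => e) τ) v := by
    intro v
    by_cases hv : v ∈ B
    · simp only [Set.indicator_of_mem hv]
      exact measurable_const.indicator measurableSet_Icc
    · simp only [Set.indicator_of_notMem hv]
      exact measurable_const
  have hmeas2 : Measurable fun v => ∫⁻ τ : ℝ,
      B.indicator (fun _ => (Set.Icc (-T) T).indicator (fun _ => e) τ) v := by
    have : Measurable fun p : (Fin 2 → ℝ) × ℝ =>
        B.indicator (fun _ => (Set.Icc (-T) T).indicator (fun _ => e) p.2) p.1 := by
      have : (fun p : (Fin 2 → ℝ) × ℝ =>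
        B.indicator (fun _ => (Set.Icc (-T) T).indicator (fun _ => e) p.2) p.1) =
        (B ×ˢ Set.Icc (-T) T).indicator (fun _ => e) := by
        ext p
        simp only [Set.indicator_apply, Set.mem_prod]
        by_cases h : p.1 ∈ B <;> simp [h]
      rw [this]
      exact measurable_const.indicator
        (Metric.isClosed_closedBall.measurableSet.prod measurableSet_Icc)
    exact this.lintegral_prod_right'
  rw [← hInt, pairInt, pairInt, ← lintegral_add_right _ hmeas2]
  refine lintegral_mono fun v => ?_
  rw [← lintegral_add_right _ (hmeas v)]
  exact lintegral_mono (key v)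

lemma lintegral_Ioi_pairInt_le {F G : (Fin 2 → ℝ) → ℝ≥0∞} (hF : Measurable F) (hG : Measurable G) :
    ∫⁻ s in Set.Ioi (0 : ℝ), pairInt F G s ≤ (∫⁻ v, F v) * ∫⁻ v, G v := by
  have hp := measurable_perpV
  have hm1 : Measurable fun q : (ℝ × (Fin 2 → ℝ)) × ℝ =>
      G (q.1.1 • perpV q.1.2 + q.2 • q.1.2) := by fun_prop
  have hm2 : Measurable fun q : (ℝ × (Fin 2 → ℝ)) × ℝ =>
      G (-(q.1.1 • perpV q.1.2 + q.2 • q.1.2)) := by fun_prop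
  have hm : Measurable fun q : (ℝ × (Fin 2 → ℝ)) × ℝ => F q.1.2 *
      (G (q.1.1 • perpV q.1.2 + q.2 • q.1.2) + G (-(q.1.1 • perpV q.1.2 + q.2 • q.1.2))) := by
    fun_prop
  simp only [pairInt]
  rw [lintegral_lintegral_swap hm.lintegral_prod_right'.aemeasurable,
    ← lintegral_mul_const _ hF]
  refine lintegral_mono_ae ?_
  have hne : ∀ᵐ v : Fin 2 → ℝ, v ≠ 0 := by rw [ae_iff]; simp
  filter_upwards [hne] with v hv
  have hA : Measurable fun q : ℝ × ℝ => G (q.1 • perpV v + q.2 • v) := by fun_prop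
  set A : ℝ → ℝ≥0∞ := fun s => ∫⁻ τ : ℝ, G (s • perpV v + τ • v) with hAdef
  have hAm : Measurable A := hA.lintegral_prod_right'
  have h : ∀ s : ℝ, ∫⁻ τ : ℝ, F v * (G (s • perpV v + τ • v) + G (-(s • perpV v + τ • v))) =
      F v * (A s + A (-s)) := by
    intro s
    have h1 : Measurable fun τ : ℝ => G (s • perpV v + τ • v) := by fun_prop
    have h2 : Measurable fun τ : ℝ => G (-(s • perpV v + τ • v)) := by fun_prop
    have h3 : ∫⁻ τ : ℝ, G (-(s • perpV v + τ • v)) = A (-s) := by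
      rw [hAdef]
      simp only
      rw [← lintegral_neg_eq_self (fun τ : ℝ => G ((-s) • perpV v + τ • v))]
      refine lintegral_congr fun τ => ?_
      rw [neg_add, neg_smul, neg_smul]
    rw [lintegral_const_mul (f := fun τ : ℝ =>
      G (s • perpV v + τ • v) + G (-(s • perpV v + τ • v))) (F v) (h1.add h2), lintegral_add_left h1, h3]
  simp only [h]
  rw [lintegral_const_mul (f := fun s => A s + A (-s)) (F v)
    (hAm.add (hAm.comp measurable_neg)), lintegral_add_left hAm]
  refine mul_le_mul_right ?_ _
  have h4 : ∫⁻ s in Set.Ioi (0 : ℝ), A (-s) = ∫⁻ s in Set.Iio (0 : ℝ), A s := by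
    rw [← lintegral_indicator measurableSet_Ioi, ← lintegral_indicator measurableSet_Iio,
      ← lintegral_neg_eq_self ((Set.Iio (0 : ℝ)).indicator A)]
    refine lintegral_congr fun s => ?_
    simp only [Set.indicator_apply, Set.mem_Ioi, Set.mem_Iio, Left.neg_neg_iff]
  rw [h4, lintegral_plane_eq hv hG, ← lintegral_union measurableSet_Iio
    (by rw [Set.disjoint_left]; intro x hx hx'; exact lt_asymm (Set.mem_Ioi.1 hx) (Set.mem_Iio.1 hx'))]
  exact setLIntegral_le_lintegral _ _

lemma sum_mul_le_lintegral_Ioi_add {K : ℝ → ℝ≥0∞} {C S ε : ℝ} (hC : 0 ≤ C)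
    (hK : ∀ s s', K s ≤ K s' + ENNReal.ofReal (C * |s - s'|)) (hz : ∀ s, S ≤ s → K s = 0)
    (hε : 0 < ε) (M : ℕ) :
    ENNReal.ofReal ε * ∑ n ∈ Finset.Icc 1 M, K (ε * n) ≤
      (∫⁻ s in Set.Ioi (0 : ℝ), K s) + ENNReal.ofReal (C * ε) * ENNReal.ofReal S := by
  classical
  set e := ENNReal.ofReal (C * ε) with he
  set J : ℝ → ℝ≥0∞ := fun s => K s + (Set.Icc 0 S).indicator (fun _ => e) s with hJ
  set I : ℕ → Set ℝ := fun n => Set.Ioc (ε * ((n : ℝ) - 1)) (ε * n) with hI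
  have hIm : ∀ n, MeasurableSet (I n) := fun n => measurableSet_Ioc
  have hterm : ∀ n ∈ Finset.Icc 1 M, ENNReal.ofReal ε * K (ε * n) ≤ ∫⁻ s in I n, J s := by
    intro n hn
    have hn1 : (1 : ℝ) ≤ n := by exact_mod_cast (Finset.mem_Icc.1 hn).1
    have hv : volume (I n) = ENNReal.ofReal ε := by
      rw [hI, Real.volume_Ioc]; congr 1; ring
    rw [mul_comm, ← hv, ← setLIntegral_const]
    refine setLIntegral_mono_ae' (hIm n) (ae_of_all _ fun s hs => ?_)
    obtain ⟨hs1, hs2⟩ := Set.mem_Ioc.1 hs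
    by_cases hnS : S ≤ ε * n
    · rw [hz _ hnS]; exact bot_le
    · push Not at hnS
      have hs0 : s ∈ Set.Icc 0 S :=
        ⟨(mul_nonneg hε.le (by linarith)).trans hs1.le, hs2.trans hnS.le⟩
      simp only [hJ, Set.indicator_of_mem hs0]
      refine (hK _ s).trans (add_le_add le_rfl (ENNReal.ofReal_le_ofReal ?_))
      refine mul_le_mul_of_nonneg_left ?_ hC
      rw [abs_of_nonneg (by linarith)]
      linarith
  have hdisj : Set.PairwiseDisjoint ((Finset.Icc 1 M : Finset ℕ) : Set ℕ) I := by
    have key : ∀ i j : ℕ, i < j → Disjoint (I i) (I j) := by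
      intro i j hij
      rw [Set.disjoint_left]
      intro x hx hy
      have h1 := (Set.mem_Ioc.1 hx).2
      have h2 := (Set.mem_Ioc.1 hy).1
      have h3 : (i : ℝ) + 1 ≤ j := by exact_mod_cast hij
      nlinarith
    intro i _ j _ hij
    rcases lt_or_gt_of_ne hij with h | h
    · exact key i j h
    · exact (key j i h).symm
  calc _ ≤ ∑ n ∈ Finset.Icc 1 M, ∫⁻ s in I n, J s := by
        rw [Finset.mul_sum]; exact Finset.sum_le_sum hterm
    _ = ∫⁻ s in ⋃ n ∈ Finset.Icc 1 M, I n, J s :=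
        (lintegral_biUnion_finset hdisj (fun n _ => hIm n) _).symm
    _ ≤ ∫⁻ s in Set.Ioi (0 : ℝ), J s := by
        refine lintegral_mono_set ?_
        intro x hx
        simp only [Set.mem_iUnion] at hx
        obtain ⟨n, hn, hx⟩ := hx
        have hn1 : (1 : ℝ) ≤ n := by exact_mod_cast (Finset.mem_Icc.1 hn).1
        exact lt_of_le_of_lt (mul_nonneg hε.le (by linarith)) (Set.mem_Ioc.1 hx).1
    _ ≤ _ := by
        rw [hJ, lintegral_add_right _ (measurable_const.indicator measurableSet_Icc)]
        refine add_le_add le_rfl ((setLIntegral_le_lintegral _ _).trans ?_)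
        rw [lintegral_indicator_const measurableSet_Icc, Real.volume_Icc, sub_zero]

/-- `x ↦ a f (a x)`. -/
def scaleFun (a : ℝ) (F : (Fin 2 → ℝ) → ℝ≥0∞) (v : Fin 2 → ℝ) : ℝ≥0∞ :=
  ENNReal.ofReal a * F (a • v)

lemma measurable_scaleFun (a : ℝ) {F : (Fin 2 → ℝ) → ℝ≥0∞} (hF : Measurable F) :
    Measurable (scaleFun a F) := by
  unfold scaleFun; fun_prop

lemma lintegral_scaleFun {a : ℝ} (ha : 0 < a) {F : (Fin 2 → ℝ) → ℝ≥0∞} (hF : Measurable F) :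
    ∫⁻ v, scaleFun a F v = ENNReal.ofReal a⁻¹ * ∫⁻ v, F v := by
  simp only [scaleFun]
  have h : Measurable fun v : Fin 2 → ℝ => F (a • v) := by fun_prop
  rw [lintegral_const_mul _ h, lintegral_comp_smul_vec ha hF, ← mul_assoc,
    ← ENNReal.ofReal_mul ha.le]
  congr 2; field_simp

lemma perpV_smul {a : ℝ} (ha : 0 < a) (v : Fin 2 → ℝ) : perpV (a • v) = a⁻¹ • perpV v := by
  ext i
  have h : (a * v 0) ^ 2 + (a * v 1) ^ 2 = a ^ 2 * (v 0 ^ 2 + v 1 ^ 2) := by ring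
  fin_cases i <;> simp [perpV, h] <;> field_simp

lemma pairInt_scaleFun {a b : ℝ} (ha : 0 < a) (hb : 0 < b) {F G : (Fin 2 → ℝ) → ℝ≥0∞}
    (hF : Measurable F) (hG : Measurable G) (s : ℝ) :
    pairInt (scaleFun a F) (scaleFun b G) s = pairInt F G (a * b * s) := by
  have hp := measurable_perpV
  set Φ : (Fin 2 → ℝ) → ℝ≥0∞ := fun u => ∫⁻ τ : ℝ,
    F u * (G ((a * b * s) • perpV u + τ • u) + G (-((a * b * s) • perpV u + τ • u))) with hΦ
  have hΦm : Measurable Φ := by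
    have : Measurable fun q : (Fin 2 → ℝ) × ℝ => F q.1 *
      (G ((a * b * s) • perpV q.1 + q.2 • q.1) + G (-((a * b * s) • perpV q.1 + q.2 • q.1))) := by
      have h1 : Measurable fun q : (Fin 2 → ℝ) × ℝ =>
        G ((a * b * s) • perpV q.1 + q.2 • q.1) := by fun_prop
      have h2 : Measurable fun q : (Fin 2 → ℝ) × ℝ =>
        G (-((a * b * s) • perpV q.1 + q.2 • q.1)) := by fun_prop
      fun_prop
    exact this.lintegral_prod_right'
  have key : ∀ v, ∫⁻ τ : ℝ, scaleFun a F v * (scaleFun b G (s • perpV v + τ • v) +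
      scaleFun b G (-(s • perpV v + τ • v))) = ENNReal.ofReal (a ^ 2) * Φ (a • v) := by
    intro v
    set ψ : ℝ → ℝ≥0∞ := fun σ => F (a • v) * (G ((a * b * s) • perpV (a • v) + σ • (a • v)) +
      G (-((a * b * s) • perpV (a • v) + σ • (a • v)))) with hψ
    have hψm : Measurable ψ := by
      have h1 : Measurable fun σ : ℝ =>
        G ((a * b * s) • perpV (a • v) + σ • (a • v)) := by fun_prop
      have h2 : Measurable fun σ : ℝ =>
        G (-((a * b * s) • perpV (a • v) + σ • (a • v))) := by fun_prop
      fun_prop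
    have e1 : ∀ τ : ℝ, scaleFun a F v * (scaleFun b G (s • perpV v + τ • v) +
        scaleFun b G (-(s • perpV v + τ • v))) = ENNReal.ofReal (a * b) * ψ (b / a * τ) := by
      intro τ
      have e2 : (a * b * s) • perpV (a • v) + (b / a * τ) • (a • v) =
          b • (s • perpV v + τ • v) := by
        rw [perpV_smul ha, smul_smul, smul_smul, smul_add, smul_smul, smul_smul]
        congr 2 <;> field_simp
      simp only [hψ, scaleFun, e2, smul_neg]
      rw [ENNReal.ofReal_mul ha.le]
      ring
    have hcm : Measurable fun τ : ℝ => ψ (b / a * τ) := by fun_prop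
    simp only [e1]
    rw [lintegral_const_mul _ hcm, lintegral_comp_mul_real (by positivity) hψm, ← mul_assoc,
      ← ENNReal.ofReal_mul (by positivity)]
    congr 2; field_simp
  have hcm : Measurable fun v : Fin 2 → ℝ => Φ (a • v) := by fun_prop
  have ha2 : 0 < a ^ 2 := by positivity
  rw [pairInt]
  simp only [key]
  rw [lintegral_const_mul _ hcm, lintegral_comp_smul_vec ha hΦm, ← mul_assoc,
    ← ENNReal.ofReal_mul ha2.le, mul_inv_cancel₀ ha2.ne', ENNReal.ofReal_one, one_mul]
  rfl

lemma two_mul_mul_add_le (x y : ℝ≥0∞) {p q : ℝ≥0∞} (hp : p ≠ ∞) (hq : q ≠ ∞) :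
    2 * (x * y) + 2 * (p * x) + 2 * (q * y) + 2 * (p * q) ≤
      x * x + y * y + 2 * (p * y) + 2 * (q * x) + p * p + q * q := by
  by_cases hx : x = ∞
  · simp [hx]
  by_cases hy : y = ∞
  · simp [hy]
  lift x to NNReal using hx
  lift y to NNReal using hy
  lift p to NNReal using hp
  lift q to NNReal using hq
  norm_cast
  rw [← NNReal.coe_le_coe]
  push_cast
  nlinarith [sq_nonneg ((x : ℝ) - y - (p - q))]

lemma lintegral_cross_le {α : Type*} [MeasurableSpace α] {m : Measure α} [IsProbabilityMeasure m]
    {U V : α → ℝ≥0∞} (hU : Measurable U) (hV : Measurable V) {p q : ℝ≥0∞}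
    (hp : ∫⁻ g, U g ∂m = p) (hq : ∫⁻ g, V g ∂m = q) (hpt : p ≠ ∞) (hqt : q ≠ ∞) :
    2 * ∫⁻ g, U g * V g ∂m + 2 * (p * p) + 2 * (q * q) + 2 * (p * q) ≤
      ∫⁻ g, U g * U g ∂m + ∫⁻ g, V g * V g ∂m + 2 * (p * q) + 2 * (q * p) + p * p + q * q := by
  have h := lintegral_mono (μ := m) fun g => two_mul_mul_add_le (U g) (V g) hpt hqt
  have hUV : Measurable fun g => U g * V g := hU.mul hV
  have hUU : Measurable fun g => U g * U g := hU.mul hU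
  have hVV : Measurable fun g => V g * V g := hV.mul hV
  have hL : ∫⁻ g, (2 * (U g * V g) + 2 * (p * U g) + 2 * (q * V g) + 2 * (p * q)) ∂m =
      2 * ∫⁻ g, U g * V g ∂m + 2 * (p * p) + 2 * (q * q) + 2 * (p * q) := by
    rw [lintegral_add_right _ measurable_const, lintegral_add_right _ (by fun_prop),
      lintegral_add_right _ (by fun_prop), lintegral_const_mul _ hUV,
      lintegral_const_mul _ (hU.const_mul p), lintegral_const_mul _ (hV.const_mul q),
      lintegral_const_mul _ hU, lintegral_const_mul _ hV, hp, hq, lintegral_const, measure_univ,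
      mul_one]
  have hR : ∫⁻ g, (U g * U g + V g * V g + 2 * (p * V g) + 2 * (q * U g) + p * p + q * q) ∂m =
      ∫⁻ g, U g * U g ∂m + ∫⁻ g, V g * V g ∂m + 2 * (p * q) + 2 * (q * p) + p * p + q * q := by
    rw [lintegral_add_right _ measurable_const, lintegral_add_right _ measurable_const,
      lintegral_add_right _ (by fun_prop), lintegral_add_right _ (by fun_prop),
      lintegral_add_right _ hVV, lintegral_const_mul _ (hV.const_mul p),
      lintegral_const_mul _ (hU.const_mul q),
      lintegral_const_mul _ hU, lintegral_const_mul _ hV, hp, hq, lintegral_const, lintegral_const,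
      measure_univ, mul_one, mul_one]
  rw [hL, hR] at h
  exact h

lemma toReal_convexity {c c' m₀ t t₁ t₂ : ℝ≥0∞} (hc : c ≠ ∞) (hc' : c' ≠ ∞) (hm₀ : m₀ ≠ ∞)
    (ht : t ≠ ∞) (ht₁ : t₁ ≠ ∞) (ht₂ : t₂ ≠ ∞) {a : ℝ} (ha : 0 < a) {p q : ℝ≥0∞}
    (hp : p = c * (ENNReal.ofReal a⁻¹ * m₀)) (hq : q = c * (ENNReal.ofReal a * m₀))
    (h : 2 * (c' * t) + 2 * (p * p) + 2 * (q * q) + 2 * (p * q) ≤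
      (c * (2 * m₀) + c' * t₁) + (c * (2 * m₀) + c' * t₂) +
        2 * (p * q) + 2 * (q * p) + p * p + q * q) :
    2 * (c'.toReal * t.toReal - c.toReal ^ 2 * m₀.toReal ^ 2) ≤ 4 * c.toReal * m₀.toReal +
      (c'.toReal * t₁.toReal - c.toReal ^ 2 * m₀.toReal ^ 2 / a ^ 2) +
      (c'.toReal * t₂.toReal - c.toReal ^ 2 * m₀.toReal ^ 2 / (a ^ 2)⁻¹) := by
  lift c to NNReal using hc
  lift c' to NNReal using hc'
  lift m₀ to NNReal using hm₀
  lift t to NNReal using ht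
  lift t₁ to NNReal using ht₁
  lift t₂ to NNReal using ht₂
  lift a to NNReal using ha.le
  rw [← NNReal.coe_inv, ENNReal.ofReal_coe_nnreal] at hp
  rw [ENNReal.ofReal_coe_nnreal] at hq
  rw [hp, hq] at h
  norm_cast at h
  rw [← NNReal.coe_le_coe] at h
  push_cast at h
  simp only [ENNReal.coe_toReal]
  have ha0 : (a : ℝ) ≠ 0 := ha.ne'
  rw [div_inv_eq_mul, div_eq_mul_inv, ← inv_pow]
  generalize hα : ((a : ℝ))⁻¹ = α at *
  have h1 : α * a = 1 := by rw [← hα]; exact inv_mul_cancel₀ ha0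
  have h2 : (c : ℝ) * (α * m₀) * (c * (a * m₀)) = c ^ 2 * m₀ ^ 2 := by
    calc (c : ℝ) * (α * m₀) * (c * (a * m₀)) = c ^ 2 * m₀ ^ 2 * (α * a) := by ring
      _ = _ := by rw [h1, mul_one]
  nlinarith [h, h2]

lemma exists_hasSum_zetaT_two : ∃ Z : ℝ, HasSum (fun j : ℕ => (((j : ℝ) + 1) ^ 2)⁻¹) Z ∧
    zetaT 2 = ENNReal.ofReal Z := by
  have hs : Summable fun j : ℕ => (((j : ℝ) + 1) ^ 2)⁻¹ := by
    have := (summable_nat_add_iff (f := fun j : ℕ => ((j : ℝ) ^ 2)⁻¹) 1).2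
      (Real.summable_nat_pow_inv.2 one_lt_two)
    simpa using this
  refine ⟨_, hs.hasSum, ?_⟩
  rw [ENNReal.ofReal_tsum_of_nonneg (fun j => by positivity) hs]
  rfl

/-- The second moment bound in dimension two, for Lipschitz functions supported away from `0`. -/
theorem lintegral_sieg_sq_le_two {m : Measure (SLR 2)} (hm : LatticeInvariant m)
    {c : ℝ≥0∞} (hct : c ≠ ∞) (hc : ∀ F : (Fin 2 → ℝ) → ℝ≥0∞, Measurable F →
      ∫⁻ g, sieg F g ∂m = c * ∫⁻ x, F x) {L : NNReal} {φ : (Fin 2 → ℝ) → NNReal}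
    (hL : LipschitzWith L φ) (h1 : ∀ v, φ v ≤ 1) {r R : ℝ} (hr : 0 < r)
    (hR : ∀ v, φ v ≠ 0 → r ≤ ‖v‖ ∧ ‖v‖ ≤ R) :
    ∫⁻ g, sieg (fun v => (φ v : ℝ≥0∞)) g * sieg (fun v => (φ v : ℝ≥0∞)) g ∂m ≤
      (c * ∫⁻ v, φ v) * (c * ∫⁻ v, φ v) + 4 * c * ∫⁻ v, φ v := by
  classical
  have := hm.prob
  set F : (Fin 2 → ℝ) → ℝ≥0∞ := fun v => (φ v : ℝ≥0∞) with hF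
  have hFm : Measurable F := hL.continuous.measurable.coe_nnreal_ennreal
  have hF1 : ∀ v, F v ≤ 1 := fun v => ENNReal.coe_le_one_iff.2 (h1 v)
  have hFR : ∀ v, F v ≠ 0 → v ≠ 0 ∧ ‖v‖ ≤ R := by
    intro v hv
    have hv' : φ v ≠ 0 := by simpa [hF] using hv
    exact ⟨norm_pos_iff.1 (hr.trans_le (hR v hv').1), (hR v hv').2⟩
  set m₀ := ∫⁻ v, F v with hm₀
  have hm₀t : m₀ ≠ ∞ := by
    refine ne_top_of_le_ne_top (measure_closedBall_lt_top (x := (0 : Fin 2 → ℝ)) (r := R)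
      (μ := volume)).ne ?_
    rw [← lintegral_indicator_one Metric.isClosed_closedBall.measurableSet]
    refine lintegral_mono fun v => ?_
    by_cases hv : F v = 0
    · rw [hv]; exact bot_le
    · rw [Set.indicator_of_mem (mem_closedBall_zero_iff.2 (hFR v hv).2)]; exact hF1 v
  obtain ⟨c', hc'c, hform⟩ := exists_lintegral_sieg_mul_sieg_two hm hc
  have hc't : c' ≠ ∞ := ne_top_of_le_ne_top hct hc'c
  obtain ⟨C, hC, hKL⟩ := exists_pairInt_le_add hL h1 hr hR
  set K := pairInt F F with hK
  set S : ℝ := 2 * R ^ 2 + 1 with hS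
  have hS1 : 1 ≤ S := by nlinarith [sq_nonneg R]
  have hKS : ∀ s, S ≤ s → K s = 0 := fun s hs =>
    pairInt_eq_zero hFR (fun v hv => (hFR v hv).2) (by linarith)
  have hKt : ∀ s, K s ≠ ∞ := by
    intro s
    refine ne_top_of_le_ne_top ?_ (hKL s S)
    rw [hKS S le_rfl, zero_add]
    exact ofReal_ne_top
  set TT : ℝ → ℝ≥0∞ := fun x =>
    ∑' d : ℕ, (Nat.totient d : ℝ≥0∞) * (ENNReal.ofReal (d : ℝ)⁻¹ * K (x * d)) with hTT
  have hTTs : ∀ x, 0 < x → ∀ M : ℕ, S ≤ x * M → TT x = ∑ d ∈ Finset.Icc 1 M,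
      (Nat.totient d : ℝ≥0∞) * (ENNReal.ofReal (d : ℝ)⁻¹ * K (x * d)) := by
    intro x hx M hM
    refine tsum_eq_sum fun d hd => ?_
    rcases Nat.eq_zero_or_pos d with rfl | hd0
    · simp
    · have hMd : M < d := by
        by_contra! hle
        exact hd (Finset.mem_Icc.2 ⟨hd0, hle⟩)
      have hMd' : (M : ℝ) ≤ d := by exact_mod_cast hMd.le
      rw [hKS _ (hM.trans (mul_le_mul_of_nonneg_left hMd' hx.le)), mul_zero, mul_zero]
  have hterm : ∀ (x : ℝ) (d : ℕ),
      (Nat.totient d : ℝ≥0∞) * (ENNReal.ofReal (d : ℝ)⁻¹ * K (x * d)) ≠ ∞ := fun x d =>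
    ENNReal.mul_ne_top (ENNReal.natCast_ne_top _) (ENNReal.mul_ne_top ofReal_ne_top (hKt _))
  have hTTt : ∀ x, 0 < x → TT x ≠ ∞ := by
    intro x hx
    obtain ⟨M, hM⟩ := exists_nat_ge (S / x)
    rw [hTTs x hx M (by rwa [div_le_iff₀' hx] at hM)]
    exact ENNReal.sum_ne_top.2 fun d _ => hterm x d
  have hT : ∀ x, 0 < x → ∀ M : ℕ, S ≤ x * M → (TT x).toReal =
      ∑ d ∈ Finset.Icc 1 M, (Nat.totient d : ℝ) / d * (K (x * d)).toReal := by
    intro x hx M hM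
    rw [hTTs x hx M hM, ENNReal.toReal_sum fun d _ => hterm x d]
    refine Finset.sum_congr rfl fun d _ => ?_
    rw [ENNReal.toReal_mul, ENNReal.toReal_mul, ENNReal.toReal_natCast,
      ENNReal.toReal_ofReal (by positivity), ← mul_assoc, div_eq_mul_inv]
  obtain ⟨Z, hZ, hZe⟩ := exists_hasSum_zetaT_two
  have hZ0 : 0 ≤ Z := hZ.nonneg fun j => by positivity
  have hcZ : 1 ≤ c.toReal * Z := by
    have h := one_le_mul_zetaT le_rfl hm hc
    rw [hZe] at h
    have h' := ENNReal.toReal_mono (ENNReal.mul_ne_top hct ofReal_ne_top) h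
    rwa [ENNReal.toReal_mul, ENNReal.toReal_ofReal hZ0, ENNReal.toReal_one] at h'
  have hsum : ∀ ε, 0 < ε → ε ≤ 1 → ∀ M : ℕ,
      ∑ n ∈ Finset.Icc 1 M, (K (ε * n)).toReal ≤ m₀.toReal ^ 2 / ε + C * S := by
    intro ε hε _ M
    have h := (sum_mul_le_lintegral_Ioi_add hC hKL hKS hε M).trans
      (add_le_add (lintegral_Ioi_pairInt_le hFm hFm) le_rfl)
    have h' := ENNReal.toReal_mono (ENNReal.add_ne_top.2 ⟨ENNReal.mul_ne_top hm₀t hm₀t,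
      ENNReal.mul_ne_top ofReal_ne_top ofReal_ne_top⟩) h
    rw [ENNReal.toReal_mul, ENNReal.toReal_ofReal hε.le, ENNReal.toReal_sum fun n _ => hKt _,
      ENNReal.toReal_add (ENNReal.mul_ne_top hm₀t hm₀t)
        (ENNReal.mul_ne_top ofReal_ne_top ofReal_ne_top), ENNReal.toReal_mul, ENNReal.toReal_mul,
      ENNReal.toReal_ofReal (by positivity), ENNReal.toReal_ofReal (by positivity)] at h'
    rw [div_add' _ _ _ hε.ne', le_div_iff₀' hε]
    refine h'.trans (le_of_eq ?_)
    ring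
  have hdiag : ∀ a : ℝ, 0 < a →
      ∫⁻ x, scaleFun a F x * (scaleFun a F x + scaleFun a F (-x)) ≤ 2 * m₀ := by
    intro a ha
    have hle : ∀ x, scaleFun a F x ≤ ENNReal.ofReal a := fun x =>
      mul_le_of_le_one_right bot_le (hF1 _)
    calc _ ≤ ∫⁻ x, scaleFun a F x * (ENNReal.ofReal a + ENNReal.ofReal a) :=
          lintegral_mono fun x => mul_le_mul_right (add_le_add (hle _) (hle _)) _
      _ = (ENNReal.ofReal a⁻¹ * ENNReal.ofReal a) * (2 * m₀) := by
          rw [lintegral_mul_const _ (measurable_scaleFun a hFm), lintegral_scaleFun ha hFm]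
          ring
      _ = 2 * m₀ := by
          rw [← ENNReal.ofReal_mul (by positivity), inv_mul_cancel₀ ha.ne', ENNReal.ofReal_one,
            one_mul]
  have hform' : ∀ a b : ℝ, 0 < a → 0 < b →
      ∫⁻ g, sieg (scaleFun a F) g * sieg (scaleFun b F) g ∂m =
      c * (∫⁻ x, scaleFun a F x * (scaleFun b F x + scaleFun b F (-x))) + c' * TT (a * b) := by
    intro a b ha hb
    rw [hform _ _ (measurable_scaleFun a hFm) (measurable_scaleFun b hFm)]
    simp only [pairInt_scaleFun ha hb hFm hFm, hTT]
    rfl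
  have hconv : ∀ b, 0 < b →
      2 * (c'.toReal * (TT 1).toReal - c.toReal ^ 2 * m₀.toReal ^ 2) ≤ 4 * c.toReal * m₀.toReal +
      (c'.toReal * (TT b).toReal - c.toReal ^ 2 * m₀.toReal ^ 2 / b) +
      (c'.toReal * (TT b⁻¹).toReal - c.toReal ^ 2 * m₀.toReal ^ 2 / b⁻¹) := by
    intro b hb
    obtain ⟨a, ha, rfl⟩ : ∃ a : ℝ, 0 < a ∧ a ^ 2 = b := ⟨√b, Real.sqrt_pos.2 hb, Real.sq_sqrt hb.le⟩
    have hai : 0 < a⁻¹ := inv_pos.2 ha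
    have hU := measurable_sieg (measurable_scaleFun a hFm)
    have hV := measurable_sieg (measurable_scaleFun a⁻¹ hFm)
    have eU := hc _ (measurable_scaleFun a hFm)
    have eV := hc _ (measurable_scaleFun a⁻¹ hFm)
    rw [lintegral_scaleFun ha hFm] at eU
    rw [lintegral_scaleFun hai hFm, inv_inv] at eV
    have hpt : c * (ENNReal.ofReal a⁻¹ * m₀) ≠ ∞ :=
      ENNReal.mul_ne_top hct (ENNReal.mul_ne_top ofReal_ne_top hm₀t)
    have hqt : c * (ENNReal.ofReal a * m₀) ≠ ∞ :=
      ENNReal.mul_ne_top hct (ENNReal.mul_ne_top ofReal_ne_top hm₀t)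
    have h := lintegral_cross_le hU hV eU eV hpt hqt
    rw [hform' a a⁻¹ ha hai, hform' a a ha ha, hform' a⁻¹ a⁻¹ hai hai, mul_inv_cancel₀ ha.ne',
      ← mul_inv, ← sq a] at h
    refine toReal_convexity hct hc't hm₀t (hTTt 1 one_pos) (hTTt _ hb) (hTTt _ (inv_pos.2 hb)) ha
      rfl rfl (le_trans ?_ (h.trans ?_))
    · gcongr
      exact le_add_self
    · gcongr
      · exact hdiag a ha
      · exact hdiag _ hai
  have hmain := le_of_convexity_totient (k := fun s => (K s).toReal) (T := fun x => (TT x).toReal)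
    (S := S) (O := C * S) (fun s => ENNReal.toReal_nonneg) hS1 hT
    (fun s hs => by simp only [hKS s hs, ENNReal.toReal_zero]) hZ hcZ ENNReal.toReal_nonneg
    ENNReal.toReal_nonneg (ENNReal.toReal_mono hct hc'c) (sq_nonneg m₀.toReal) hsum hconv
  have hone : scaleFun 1 F = F := by
    ext v; simp [scaleFun]
  have h2 := hform' 1 1 one_pos one_pos
  have h3 := hdiag 1 one_pos
  rw [hone] at h2 h3
  rw [mul_one] at h2
  rw [h2]
  have h4 : c' * TT 1 ≤ c * m₀ * (c * m₀) + 2 * (c * m₀) := by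
    rw [← ENNReal.toReal_le_toReal (ENNReal.mul_ne_top hc't (hTTt 1 one_pos)) (by finiteness),
      ENNReal.toReal_add (by finiteness) (by finiteness)]
    simp only [ENNReal.toReal_mul, ENNReal.toReal_ofNat]
    nlinarith [hmain]
  calc _ ≤ c * (2 * m₀) + (c * m₀ * (c * m₀) + 2 * (c * m₀)) :=
        add_le_add (mul_le_mul_right h3 _) h4
    _ = _ := by ring

lemma lintegral_sieg_indicator_sq_le_two {m : Measure (SLR 2)} (hm : LatticeInvariant m)
    {c : ℝ≥0∞} (hct : c ≠ ∞) (hc : ∀ F : (Fin 2 → ℝ) → ℝ≥0∞, Measurable F →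
      ∫⁻ g, sieg F g ∂m = c * ∫⁻ x, F x) {K : Set (Fin 2 → ℝ)} (hK : IsCompact K)
    (h0 : (0 : Fin 2 → ℝ) ∉ K) :
    ∫⁻ g, sieg (K.indicator 1) g * sieg (K.indicator 1) g ∂m
      ≤ (c * volume K) * (c * volume K) + 4 * c * volume K := by
  classical
  obtain ⟨ρ, hρ, hρK⟩ := Metric.isOpen_iff.1 hK.isClosed.isOpen_compl 0 h0
  obtain ⟨R, hR⟩ := hK.isBounded.exists_norm_le
  have hρK' : ∀ x ∈ K, ρ ≤ ‖x‖ := by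
    intro x hx
    by_contra! hlt
    exact hρK (mem_ball_zero_iff.2 hlt) hx
  have hfin : ∃ δ, 0 < δ ∧ volume (Metric.cthickening δ K) ≠ ∞ :=
    ⟨1, one_pos, hK.isBounded.cthickening.measure_lt_top.ne⟩
  have hlim : Tendsto (fun δ => volume (Metric.cthickening δ K)) (nhdsWithin 0 (Set.Ioi 0))
      (nhds (volume K)) :=
    (tendsto_measure_cthickening_of_isClosed hfin hK.isClosed).mono_left nhdsWithin_le_nhds
  have hvK : volume K ≠ ∞ := hK.measure_lt_top.ne
  have hlim1 := ENNReal.Tendsto.const_mul (a := c) hlim (Or.inr hct)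
  have hlim2 := (ENNReal.Tendsto.mul hlim1 (Or.inr (ENNReal.mul_ne_top hct hvK)) hlim1
    (Or.inr (ENNReal.mul_ne_top hct hvK))).add
    (ENNReal.Tendsto.const_mul (a := 4 * c) hlim (Or.inr (ENNReal.mul_ne_top (by simp) hct)))
  refine ge_of_tendsto hlim2 ?_
  filter_upwards [Ioo_mem_nhdsGT (half_pos hρ)] with δ hδ
  obtain ⟨hδ0, hδρ⟩ := hδ
  have hsupp : ∀ v, thickenedIndicator hδ0 K v ≠ 0 → v ∈ Metric.thickening δ K := by
    intro v hv
    by_contra h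
    exact hv (thickenedIndicator_zero hδ0 K h)
  have hle : ∫⁻ v, (thickenedIndicator hδ0 K v : ℝ≥0∞) ≤ volume (Metric.cthickening δ K) := by
    rw [← lintegral_indicator_one Metric.isClosed_cthickening.measurableSet]
    refine lintegral_mono fun v => ?_
    by_cases hv : thickenedIndicator hδ0 K v = 0
    · simp [hv]
    · rw [Set.indicator_of_mem (Metric.thickening_subset_cthickening _ _ (hsupp v hv))]
      exact ENNReal.coe_le_one_iff.2 (thickenedIndicator_le_one hδ0 K v)
  have hmain := lintegral_sieg_sq_le_two hm hct hc (lipschitzWith_thickenedIndicator hδ0 K)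
    (thickenedIndicator_le_one hδ0 K) (r := ρ / 2) (R := R + ρ) (half_pos hρ) (by
      intro v hv
      obtain ⟨x, hx, hvx⟩ := Metric.mem_thickening_iff.1 (hsupp v hv)
      rw [dist_eq_norm] at hvx
      have h1 := norm_sub_norm_le x v
      have h2 := norm_sub_norm_le v x
      rw [norm_sub_rev] at h1
      have h3 := hR x hx
      have h4 := hρK' x hx
      constructor <;> linarith)
  have hind : K.indicator (1 : (Fin 2 → ℝ) → ℝ≥0∞) ≤
      fun v => (thickenedIndicator hδ0 K v : ℝ≥0∞) := by
    intro v
    by_cases hv : v ∈ K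
    · simp [hv, thickenedIndicator_one hδ0 K hv]
    · simp [hv]
  calc _ ≤ _ := lintegral_mono fun g => mul_le_mul' (sieg_mono hind g) (sieg_mono hind g)
    _ ≤ _ := hmain
    _ ≤ _ := by gcongr

lemma lintegral_sieg_indicator_sq_le {n : ℕ} (hn : 2 ≤ n) {m : Measure (SLR n)}
    (hm : LatticeInvariant m) {c : ℝ≥0∞} (hct : c ≠ ∞)
    (hc : ∀ F : (Fin n → ℝ) → ℝ≥0∞, Measurable F → ∫⁻ g, sieg F g ∂m = c * ∫⁻ x, F x)
    {K : Set (Fin n → ℝ)} (hK : IsCompact K) (h0 : (0 : Fin n → ℝ) ∉ K) :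
    ∫⁻ g, sieg (K.indicator 1) g * sieg (K.indicator 1) g ∂m
      ≤ (c * volume K) * (c * volume K) + 4 * c * volume K := by
  rcases hn.eq_or_lt with rfl | hn
  · exact lintegral_sieg_indicator_sq_le_two hm hct hc hK h0
  · exact lintegral_sieg_sq_le_of_three_le hn hm hct hc hK.measurableSet

lemma sieg_eq_zero_of_mem_avoidSet {n : ℕ} {K : Set (Fin n → ℝ)} {g : SLR n}
    (hg : g ∈ avoidSet n K) : sieg (K.indicator 1) g = 0 := by
  refine ENNReal.tsum_eq_zero.2 fun v => ?_
  by_cases hv : v ∈ PrimV n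
  · rw [Set.indicator_of_mem hv, Set.indicator_of_notMem (hg v (PrimV.ne_zero hv))]
  · exact Set.indicator_of_notMem hv _

lemma measure_avoidSet_mul_le {n : ℕ} (hn : 2 ≤ n) {m : Measure (SLR n)}
    (hm : LatticeInvariant m) {c : ℝ≥0∞} (hct : c ≠ ∞)
    (hc : ∀ F : (Fin n → ℝ) → ℝ≥0∞, Measurable F → ∫⁻ g, sieg F g ∂m = c * ∫⁻ x, F x)
    {K : Set (Fin n → ℝ)} (hK : IsCompact K) (h0 : (0 : Fin n → ℝ) ∉ K) :
    m (avoidSet n K) * (c * volume K) ≤ 4 := by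
  classical
  have := hm.prob
  have hKm := hK.measurableSet
  have hU : Measurable (sieg (K.indicator (1 : (Fin n → ℝ) → ℝ≥0∞))) :=
    measurable_sieg (measurable_indicator_one hKm)
  set U : SLR n → ℝ≥0∞ := sieg (K.indicator 1) with hUdef
  have hUU : Measurable fun g => U g * U g := hU.mul hU
  have h2 : ∫⁻ g, U g * U g ∂m ≤ _ := lintegral_sieg_indicator_sq_le hn hm hct hc hK h0
  have h1 : ∫⁻ g, U g ∂m = c * volume K := by
    rw [hUdef, hc _ (measurable_indicator_one hKm), lintegral_indicator_one hKm]
  have hpt : c * volume K ≠ ∞ := ENNReal.mul_ne_top hct hK.measure_lt_top.ne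
  rw [mul_assoc 4] at h2
  set p := c * volume K with hp
  by_cases hp0 : p = 0
  · rw [hp0, mul_zero]; exact bot_le
  have hav : MeasurableSet (avoidSet n K) := measurableSet_avoidSet hKm
  have key : ∀ g, 2 * (p * U g) + (avoidSet n K).indicator (fun _ => p * p) g ≤
      U g * U g + p * p := by
    intro g
    by_cases hg : g ∈ avoidSet n K
    · rw [Set.indicator_of_mem hg, hUdef, sieg_eq_zero_of_mem_avoidSet hg]; simp
    · rw [Set.indicator_of_notMem hg, add_zero]
      simpa using two_mul_mul_add_le (U g) 0 hpt ENNReal.zero_ne_top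
  have hbound := lintegral_mono (μ := m) key
  rw [lintegral_add_right _ (measurable_const.indicator hav), lintegral_add_right _ measurable_const,
    lintegral_const_mul _ (hU.const_mul p), lintegral_const_mul _ hU, h1,
    lintegral_indicator_const hav, lintegral_const, measure_univ, mul_one] at hbound
  have h3 : 2 * (p * p) + p * p * m (avoidSet n K) ≤ 2 * (p * p) + p * 4 :=
    calc _ ≤ _ := hbound
      _ ≤ p * p + 4 * p + p * p := by gcongr
      _ = _ := by ring
  have h4 : p * p * m (avoidSet n K) ≤ p * 4 :=
    (ENNReal.add_le_add_iff_left (by finiteness)).1 h3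
  rw [mul_assoc, ENNReal.mul_le_mul_iff_right hp0 hpt] at h4
  rwa [mul_comm]

/-- **Random Minkowski theorem.** There is a constant `C_n`, depending only on `n ≥ 2`, such
that for any measurable `A ⊆ ℝⁿ` of positive Lebesgue measure, the Haar probability measure of
the set of unimodular lattices avoiding `A` is at most `C_n / m(A)`. -/
theorem random_minkowski (n : ℕ) (hn : 2 ≤ n)
    (μ : Measure (LatticeSpace n)) [IsProbabilityMeasure μ]
    (hinv : ∀ (g : SLR n) (s : Set (LatticeSpace n)), μ ((fun x => g • x) ⁻¹' s) = μ s) :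
    ∃ C : ℝ, 0 < C ∧ ∀ A : Set (Fin n → ℝ), MeasurableSet A → 0 < volume A →
      μ {Λ : LatticeSpace n | ¬ Intersects n Λ A} ≤ ENNReal.ofReal C / volume A := by
  have : Nonempty (Fin n) := ⟨⟨0, by omega⟩⟩
  obtain ⟨m, hm, hμ⟩ := exists_latticeInvariant n μ hinv
  obtain ⟨c, hct, hc⟩ := exists_lintegral_sieg hn hm
  have hc0 : c ≠ 0 := by
    rintro rfl
    simpa using one_le_mul_zetaT hn hm hc
  have hCt : 4 / c ≠ ∞ := ENNReal.div_ne_top (by simp) hc0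
  refine ⟨(4 / c).toReal, ENNReal.toReal_pos (ENNReal.div_ne_zero.2 ⟨by simp, hct⟩) hCt,
    fun A hA hA0 => ?_⟩
  rw [ENNReal.ofReal_toReal hCt, hμ A hA, ENNReal.le_div_iff_mul_le (Or.inl hA0.ne') (Or.inr hCt),
    ENNReal.le_div_iff_mul_le (Or.inl hc0) (Or.inl hct)]
  have hvol : volume (A \ {0}) = volume A := measure_sdiff_null (measure_singleton 0)
  have hA' : MeasurableSet (A \ {0}) := by measurability
  rw [← hvol, hA'.measure_eq_iSup_isCompact, ENNReal.mul_iSup,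
    ENNReal.iSup_mul]
  refine iSup_le fun K => ?_
  rw [ENNReal.mul_iSup, ENNReal.iSup_mul]
  refine iSup_le fun hKA => ?_
  rw [ENNReal.mul_iSup, ENNReal.iSup_mul]
  refine iSup_le fun hK => ?_
  have h0 : (0 : Fin n → ℝ) ∉ K := fun h => (hKA h).2 rfl
  have hsub : avoidSet n A ⊆ avoidSet n K := fun g hg v hv hvK => hg v hv (hKA hvK).1
  calc _ = m (avoidSet n A) * (c * volume K) := by ring
    _ ≤ m (avoidSet n K) * (c * volume K) := by gcongr
    _ ≤ 4 := measure_avoidSet_mul_le hn hm hct hc hK h0
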